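/- Under the standing assumptions, the non-local quasi-variational inequality min{ v(t,x) − Mv(t,x), −∂_t v(t,x) − Lv(t,x) − f(t,x, v(t,·), σ^⊤(t,x)∇_x v(t,x)) } = 0 on [0,T) × ℝ^n with terminal condition v(T,x) = ψ(x) admits a viscosity solution v ∈ Π^g_c, and this solution is unique in Π^g_c. -/

import Mathlib

open Set Filter Matrix Topology

noncomputable section

/-- The state space `ℝ^n` with the Euclidean norm. -/
abbrev En (n : ℕ) : Type := EuclideanSpace ℝ (Fin n)

/-- The space `ℝ^d` (values of `σᵀ∇v`). -/
abbrev Ed (d : ℕ) : Type := EuclideanSpace ℝ (Fin d)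

/-- Frobenius norm of a matrix. -/
noncomputable def frob {n d : ℕ} (M : Matrix (Fin n) (Fin d) ℝ) : ℝ :=
  Real.sqrt (∑ i, ∑ j, (M i j) ^ 2)

/-- The intervention operator `Mv(t,x) = sup_b { v(t,Γ(t,x,b)) - ℓ(t,x,b) }`. -/
noncomputable def Mop {n : ℕ} {U : Type} [Nonempty U]
    (Γ : ℝ → En n → U → En n) (ℓ : ℝ → En n → U → ℝ)
    (v : ℝ → En n → ℝ) (t : ℝ) (x : En n) : ℝ :=
  ⨆ b : U, (v t (Γ t x b) - ℓ t x b)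

/-- The (parabolic) domain `[0,T] × ℝ^n`. -/
def Strip (n : ℕ) (T : ℝ) : Set (ℝ × En n) := Icc 0 T ×ˢ (univ : Set (En n))

/-- First-order partial derivative `∂g/∂x_i`. -/
noncomputable def pd {n : ℕ} (g : En n → ℝ) (x : En n) (i : Fin n) : ℝ :=
  fderiv ℝ g x (EuclideanSpace.single i 1)

/-- Second-order partial derivative `∂²g/∂x_i∂x_j`. -/
noncomputable def pd2 {n : ℕ} (g : En n → ℝ) (x : En n) (i j : Fin n) : ℝ :=
  fderiv ℝ (fun y => fderiv ℝ g y (EuclideanSpace.single j 1)) x (EuclideanSpace.single i 1)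

/-- The generator `Lφ = Σ_j a_j ∂φ/∂x_j + (1/2) Σ_{i,j} (σσᵀ)_{ij} ∂²φ/∂x_i∂x_j`. -/
noncomputable def genL {n d : ℕ} (a : ℝ → En n → En n)
    (σm : ℝ → En n → Matrix (Fin n) (Fin d) ℝ)
    (φ : ℝ → En n → ℝ) (t : ℝ) (x : En n) : ℝ :=
  (∑ j, a t x j * pd (φ t) x j)
    + (1/2) * ∑ i, ∑ j, (σm t x * (σm t x)ᵀ) i j * pd2 (φ t) x i j

/-- `σ(t,x)ᵀ ∇_x φ(t,x) ∈ ℝ^d`. -/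
noncomputable def sigGrad {n d : ℕ} (σm : ℝ → En n → Matrix (Fin n) (Fin d) ℝ)
    (φ : ℝ → En n → ℝ) (t : ℝ) (x : En n) : Ed d :=
  (WithLp.equiv 2 (Fin d → ℝ)).symm (fun k => ∑ i, σm t x i k * pd (φ t) x i)

/-- Test functions: `C¹` in `t` and `C²` in `x` (jointly `C²`). -/
def IsTest {n : ℕ} (φ : ℝ → En n → ℝ) : Prop :=
  ContDiff ℝ 2 (fun p : ℝ × En n => φ p.1 p.2)

/-- Time derivative `∂φ/∂t`. -/
noncomputable def ptd {n : ℕ} (φ : ℝ → En n → ℝ) (t : ℝ) (x : En n) : ℝ :=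
  deriv (fun s => φ s x) t

/-- Polynomial growth in `x`, uniformly for `t ∈ [0,T]` (the class `Π^g`). -/
def PolyGrowth {n : ℕ} (T : ℝ) (φ : ℝ → En n → ℝ) : Prop :=
  ∃ C > (0:ℝ), ∃ ρ > (0:ℝ), ∀ t ∈ Icc (0:ℝ) T, ∀ x : En n, |φ t x| ≤ C * (1 + ‖x‖ ^ ρ)

/-- The class `Π^g_c`: jointly continuous functions of polynomial growth. -/
def PGc {n : ℕ} (T : ℝ) (φ : ℝ → En n → ℝ) : Prop :=
  PolyGrowth T φ ∧ ContinuousOn (fun p : ℝ × En n => φ p.1 p.2) (Strip n T)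

/-- Locally bounded on `[0,T] × ℝ^n`. -/
def LocBdd {n : ℕ} (T : ℝ) (g : ℝ → En n → ℝ) : Prop :=
  ∀ p ∈ Strip n T, ∃ s ∈ 𝓝 p, ∃ C : ℝ, ∀ q ∈ s ∩ Strip n T, |g q.1 q.2| ≤ C

/-- Viscosity supersolution (local driver `f(t,x,y,z)`). -/
def IsSuper {n d : ℕ} {U : Type} [Nonempty U] (T : ℝ)
    (Γ : ℝ → En n → U → En n) (ℓ : ℝ → En n → U → ℝ)
    (a : ℝ → En n → En n) (σm : ℝ → En n → Matrix (Fin n) (Fin d) ℝ)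
    (f : ℝ → En n → ℝ → Ed d → ℝ) (ψ : En n → ℝ)
    (v : ℝ → En n → ℝ) : Prop :=
  LowerSemicontinuousOn (fun p : ℝ × En n => v p.1 p.2) (Strip n T) ∧
  (∀ x : En n, ψ x ≤ v T x) ∧
  ∀ t ∈ Ico (0:ℝ) T, ∀ x : En n, ∀ φ : ℝ → En n → ℝ, IsTest φ →
    φ t x = v t x →
    IsLocalMaxOn (fun p : ℝ × En n => φ p.1 p.2 - v p.1 p.2) (Strip n T) (t, x) →
    0 ≤ min (v t x - Mop Γ ℓ v t x)
        (-(ptd φ t x) - genL a σm φ t x - f t x (v t x) (sigGrad σm φ t x))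

/-- Viscosity subsolution (local driver `f(t,x,y,z)`). -/
def IsSub {n d : ℕ} {U : Type} [Nonempty U] (T : ℝ)
    (Γ : ℝ → En n → U → En n) (ℓ : ℝ → En n → U → ℝ)
    (a : ℝ → En n → En n) (σm : ℝ → En n → Matrix (Fin n) (Fin d) ℝ)
    (f : ℝ → En n → ℝ → Ed d → ℝ) (ψ : En n → ℝ)
    (u : ℝ → En n → ℝ) : Prop :=
  UpperSemicontinuousOn (fun p : ℝ × En n => u p.1 p.2) (Strip n T) ∧
  (∀ x : En n, u T x ≤ ψ x) ∧
  ∀ t ∈ Ico (0:ℝ) T, ∀ x : En n, ∀ φ : ℝ → En n → ℝ, IsTest φ →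
    φ t x = u t x →
    IsLocalMinOn (fun p : ℝ × En n => φ p.1 p.2 - u p.1 p.2) (Strip n T) (t, x) →
    min (u t x - Mop Γ ℓ u t x)
        (-(ptd φ t x) - genL a σm φ t x - f t x (u t x) (sigGrad σm φ t x)) ≤ 0

/-- Viscosity supersolution (non-local driver `f(t,x,g,z)`, `g ∈ C(ℝ^n,ℝ)`). -/
def IsSuperNL {n d : ℕ} {U : Type} [Nonempty U] (T : ℝ)
    (Γ : ℝ → En n → U → En n) (ℓ : ℝ → En n → U → ℝ)
    (a : ℝ → En n → En n) (σm : ℝ → En n → Matrix (Fin n) (Fin d) ℝ)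
    (f : ℝ → En n → (En n → ℝ) → Ed d → ℝ) (ψ : En n → ℝ)
    (v : ℝ → En n → ℝ) : Prop :=
  LowerSemicontinuousOn (fun p : ℝ × En n => v p.1 p.2) (Strip n T) ∧
  (∀ x : En n, ψ x ≤ v T x) ∧
  ∀ t ∈ Ico (0:ℝ) T, ∀ x : En n, ∀ φ : ℝ → En n → ℝ, IsTest φ →
    φ t x = v t x →
    IsLocalMaxOn (fun p : ℝ × En n => φ p.1 p.2 - v p.1 p.2) (Strip n T) (t, x) →
    0 ≤ min (v t x - Mop Γ ℓ v t x)
        (-(ptd φ t x) - genL a σm φ t x - f t x (v t) (sigGrad σm φ t x))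

/-- Viscosity subsolution (non-local driver `f(t,x,g,z)`). -/
def IsSubNL {n d : ℕ} {U : Type} [Nonempty U] (T : ℝ)
    (Γ : ℝ → En n → U → En n) (ℓ : ℝ → En n → U → ℝ)
    (a : ℝ → En n → En n) (σm : ℝ → En n → Matrix (Fin n) (Fin d) ℝ)
    (f : ℝ → En n → (En n → ℝ) → Ed d → ℝ) (ψ : En n → ℝ)
    (u : ℝ → En n → ℝ) : Prop :=
  UpperSemicontinuousOn (fun p : ℝ × En n => u p.1 p.2) (Strip n T) ∧
  (∀ x : En n, u T x ≤ ψ x) ∧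
  ∀ t ∈ Ico (0:ℝ) T, ∀ x : En n, ∀ φ : ℝ → En n → ℝ, IsTest φ →
    φ t x = u t x →
    IsLocalMinOn (fun p : ℝ × En n => φ p.1 p.2 - u p.1 p.2) (Strip n T) (t, x) →
    min (u t x - Mop Γ ℓ u t x)
        (-(ptd φ t x) - genL a σm φ t x - f t x (u t) (sigGrad σm φ t x)) ≤ 0

section QuadraticHull

open MeasureTheory

variable {H : Type*} [NormedAddCommGroup H] [InnerProductSpace ℝ H]

open scoped RealInnerProductSpace

/-- Every upper semicontinuous function on a compact set has a lower envelope of paraboloids of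
opening `2` above its sup-convolution; the minimising paraboloid exists at each point. -/
lemma exists_min_paraboloid [FiniteDimensional ℝ H] {K : Set H} (hK : IsCompact K)
    (hne : K.Nonempty) {u : H → ℝ} (hu : UpperSemicontinuousOn u K) (P : H) :
    ∃ p : H × ℝ, (∀ R ∈ K, u R ≤ p.2 + 1/3 * ‖p.1 - R‖^2) ∧
      ∀ q : H × ℝ, (∀ R ∈ K, u R ≤ q.2 + 1/3 * ‖q.1 - R‖^2) →
        p.2 + ‖P - p.1‖^2 ≤ q.2 + ‖P - q.1‖^2 := by
  obtain ⟨M, hM⟩ := hu.bddAbove_of_isCompact hK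
  have hM' : ∀ R ∈ K, u R ≤ M := fun R hR => hM ⟨R, hR, rfl⟩
  obtain ⟨R₀, hR₀⟩ := hne
  set F : Set (H × ℝ) := {p | ∀ R ∈ K, u R ≤ p.2 + 1/3 * ‖p.1 - R‖^2} with hF
  have hFc : IsClosed F := by
    have : F = ⋂ R ∈ K, {p : H × ℝ | u R ≤ p.2 + 1/3 * ‖p.1 - R‖^2} := by
      ext p; simp [hF]
    rw [this]
    refine isClosed_biInter fun R _ => isClosed_le (by fun_prop) (by fun_prop)
  set S : Set (H × ℝ) := F ∩ {p | p.2 + ‖P - p.1‖^2 ≤ M} with hS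
  have hSc : IsClosed S := hFc.inter (isClosed_le (by fun_prop) (by fun_prop))
  set D : ℝ := M - u R₀ + ‖P - R₀‖^2 with hD
  have hbd : S ⊆ Metric.closedBall P (Real.sqrt (2 * D)) ×ˢ
      Icc (u R₀ - 1/3 * (4 * D + 2 * ‖P - R₀‖^2)) M := by
    rintro ⟨a, β⟩ ⟨h1, h2⟩
    have h1' := h1 R₀ hR₀
    simp only [mem_ofPred_eq] at h1' h2
    have e : a - R₀ = (P - R₀) - (P - a) := by abel
    have e1 := norm_sub_sq_real (P - R₀) (P - a)
    rw [← e] at e1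
    have e2 := norm_add_sq_real ((2:ℝ) • (P - R₀)) (P - a)
    have e3 := norm_add_sq_real (P - R₀) (P - a)
    rw [norm_smul, inner_smul_left] at e2
    simp only [Real.norm_eq_abs, conj_trivial] at e2
    rw [abs_of_pos (by norm_num : (0:ℝ) < 2)] at e2
    have h3 : ‖P - a‖^2 ≤ 2 * D := by
      nlinarith [sq_nonneg ‖(2:ℝ) • (P - R₀) + (P - a)‖]
    refine ⟨?_, ?_, ?_⟩
    · rw [Metric.mem_closedBall, dist_comm, dist_eq_norm]
      exact Real.le_sqrt_of_sq_le h3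
    · simp only
      nlinarith [sq_nonneg ‖(P - R₀) + (P - a)‖]
    · simp only
      nlinarith [sq_nonneg ‖P - a‖]
  have hScomp : IsCompact S :=
    ((isCompact_closedBall _ _).prod isCompact_Icc).of_isClosed_subset hSc hbd
  have hSne : S.Nonempty := by
    refine ⟨(P, M), fun R hR => ?_, ?_⟩
    · have := hM' R hR
      simp only
      nlinarith [sq_nonneg ‖P - R‖]
    · simp
  obtain ⟨p, hp, hpm⟩ := hScomp.exists_isMinOn hSne
    (f := fun p : H × ℝ => p.2 + ‖P - p.1‖^2) (by fun_prop)
  refine ⟨p, hp.1, fun q hq => ?_⟩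
  by_cases h : q.2 + ‖P - q.1‖^2 ≤ M
  · exact hpm (show q ∈ S from ⟨hq, h⟩)
  · exact le_trans hp.2 (le_of_not_ge h)

/-- The paraboloid hull of the sup-convolution: a `C^{1,1}` function lying above the
sup-convolution and below every paraboloid of opening `2` that lies above the sup-convolution. -/
lemma exists_paraboloid_hull [FiniteDimensional ℝ H] {K : Set H} (hK : IsCompact K)
    (hne : K.Nonempty) {u : H → ℝ} (hu : UpperSemicontinuousOn u K) :
    ∃ (V : H → ℝ) (g : H → H),
      (∀ P h, |V (P + h) - V P - ⟪g P, h⟫| ≤ 2 * ‖h‖^2) ∧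
      (∀ P, ∀ R ∈ K, u R - 1/2 * ‖P - R‖^2 ≤ V P) ∧
      (∀ P q b, (∀ P', ∀ R ∈ K,
        u R - 1/2 * ‖P' - R‖^2 ≤ b + ⟪q, P' - P⟫ + ‖P' - P‖^2) → V P ≤ b) := by
  choose p hpF hpm using exists_min_paraboloid hK hne hu
  set V : H → ℝ := fun P => (p P).2 + ‖P - (p P).1‖^2 with hV
  set g : H → H := fun P => (2:ℝ) • (P - (p P).1) with hg
  have hup : ∀ P h, V (P + h) ≤ V P + ⟪g P, h⟫ + ‖h‖^2 := by
    intro P h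
    have h1 := hpm (P + h) (p P) (hpF P)
    have e : P + h - (p P).1 = (P - (p P).1) + h := by abel
    rw [e, norm_add_sq_real (P - (p P).1) h] at h1
    simp only [hV, hg, inner_smul_left, conj_trivial]
    linarith
  have hmid : ∀ P h, 2 * V P - ‖h‖^2 ≤ V (P + h) + V (P - h) := by
    intro P h
    set a₁ := (p (P + h)).1 with ha₁
    set a₂ := (p (P - h)).1 with ha₂
    set e : H := (1/2 : ℝ) • (a₁ - a₂) with he
    set m : H := (1/2 : ℝ) • (a₁ + a₂) with hm
    have hae : a₁ = m + e := by rw [hm, he]; module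
    have hae2 : a₂ = m - e := by rw [hm, he]; module
    have hf : ∀ R ∈ K, u R ≤
        ((p (P + h)).2 + (p (P - h)).2) / 2 + 1/3 * ‖e‖^2 + 1/3 * ‖m - R‖^2 := by
      intro R hR
      have h1 := hpF (P + h) R hR
      have h2 := hpF (P - h) R hR
      rw [← ha₁, hae, show m + e - R = (m - R) + e by abel, norm_add_sq_real] at h1
      rw [← ha₂, hae2, show m - e - R = (m - R) - e by abel, norm_sub_sq_real] at h2
      linarith
    have h3 := hpm P (m, ((p (P + h)).2 + (p (P - h)).2) / 2 + 1/3 * ‖e‖^2) hf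
    simp only [hV] at h3 ⊢
    rw [← ha₁, ← ha₂, hae, hae2, show P + h - (m + e) = (P - m) + (h - e) by abel,
      show P - h - (m - e) = (P - m) - (h - e) by abel, norm_add_sq_real,
      norm_sub_sq_real (P - m) (h - e), norm_sub_sq_real h e]
    have h4 := norm_sub_sq_real ((3:ℝ) • h) ((2:ℝ) • e)
    rw [norm_smul, norm_smul, inner_smul_left, inner_smul_right] at h4
    simp only [Real.norm_eq_abs, conj_trivial] at h4
    rw [abs_of_pos (by norm_num : (0:ℝ) < 2), abs_of_pos (by norm_num : (0:ℝ) < 3)] at h4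
    nlinarith [sq_nonneg ‖(3:ℝ) • h - (2:ℝ) • e‖]
  refine ⟨V, g, ?_, ?_, ?_⟩
  · intro P h
    have h1 := hup P h
    have h2 := hup P (-h)
    have h3 := hmid P h
    rw [← sub_eq_add_neg, norm_neg, inner_neg_right] at h2
    rw [abs_le]
    constructor <;> nlinarith [sq_nonneg ‖h‖]
  · intro P R hR
    have h1 := hpF P R hR
    simp only [hV]
    set a := (p P).1
    have e1 := norm_sub_sq_real (P - R) (P - a)
    rw [show P - R - (P - a) = a - R by abel] at e1
    have e2 := norm_add_sq_real (P - R) ((2:ℝ) • (P - a))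
    rw [norm_smul, inner_smul_right] at e2
    simp only [Real.norm_eq_abs] at e2
    rw [abs_of_pos (by norm_num : (0:ℝ) < 2)] at e2
    nlinarith [sq_nonneg ‖(P - R) + (2:ℝ) • (P - a)‖]
  · intro P q b hb
    set a : H := P - (1/2 : ℝ) • q with ha
    have hq : q = (2:ℝ) • (P - a) := by rw [ha]; module
    have hf : ∀ R ∈ K, u R ≤ (b - ‖P - a‖^2) + 1/3 * ‖a - R‖^2 := by
      intro R hR
      have h1 := hb (a - (1/3:ℝ) • (a - R)) R hR
      rw [hq, show a - (1/3:ℝ) • (a - R) - R = (2/3:ℝ) • (a - R) by module,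
        show a - (1/3:ℝ) • (a - R) - P = -((P - a) + (1/3:ℝ) • (a - R)) by module,
        norm_neg, norm_add_sq_real, norm_smul, norm_smul, inner_neg_right, inner_add_right,
        inner_smul_left, inner_smul_left, inner_smul_right,
        real_inner_self_eq_norm_sq] at h1
      simp only [Real.norm_eq_abs, conj_trivial] at h1
      rw [abs_of_pos (by norm_num : (0:ℝ) < 2/3), abs_of_pos (by norm_num : (0:ℝ) < 1/3)] at h1
      nlinarith
    have := hpm P (a, b - ‖P - a‖^2) hf
    simp only [hV]
    simp only at this
    linarith

end QuadraticHull

section TwiceDifferentiable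

open MeasureTheory

variable {H : Type*} [NormedAddCommGroup H] [InnerProductSpace ℝ H]

open scoped RealInnerProductSpace

/-- `V` is differentiable with derivative `g`, with a uniform quadratic error. -/
def QuadDiff (V : H → ℝ) (g : H → H) : Prop :=
  ∀ P h, |V (P + h) - V P - ⟪g P, h⟫| ≤ 2 * ‖h‖^2

lemma QuadDiff.hasFDerivAt {V : H → ℝ} {g : H → H} (hV : QuadDiff V g) (P : H) :
    HasFDerivAt V (innerSL ℝ (g P)) P := by
  rw [hasFDerivAt_iff_isLittleO_nhds_zero]
  refine Asymptotics.IsBigO.trans_isLittleO (g := fun h : H => ‖h‖^2) ?_ ?_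
  · refine Asymptotics.IsBigO.of_bound 2 (Eventually.of_forall fun h => ?_)
    simpa using hV P h
  · simpa using Asymptotics.isLittleO_norm_pow_id (E' := H) (n := 2) (by norm_num)

lemma QuadDiff.continuous {V : H → ℝ} {g : H → H} (hV : QuadDiff V g) : Continuous V :=
  continuous_iff_continuousAt.2 fun P => (hV.hasFDerivAt P).continuousAt

lemma QuadDiff.lipschitzWith {V : H → ℝ} {g : H → H} (hV : QuadDiff V g) :
    LipschitzWith 12 g := by
  refine LipschitzWith.of_dist_le_mul fun P Q => ?_
  rw [dist_eq_norm, dist_eq_norm]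
  set Δ := g P - g Q with hΔ
  set w := Q - P with hw
  have key : ∀ h : H, ⟪Δ, h⟫ ≤ 2 * ‖w + h‖^2 + 2 * ‖w‖^2 + 2 * ‖h‖^2 := by
    intro h
    have h1 := abs_le.1 (hV P (w + h))
    have h2 := abs_le.1 (hV P w)
    have h3 := abs_le.1 (hV Q h)
    rw [show P + (w + h) = Q + h by rw [hw]; abel, inner_add_right] at h1
    rw [show P + w = Q by rw [hw]; abel] at h2
    rw [hΔ, inner_sub_left]
    linarith
  have hn : ‖P - Q‖ = ‖w‖ := by rw [hw, norm_sub_rev]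
  rw [hn]
  by_cases h0 : ‖Δ‖ = 0
  · rw [h0]; positivity
  have hp : 0 < ‖Δ‖ := lt_of_le_of_ne (norm_nonneg _) (Ne.symm h0)
  by_cases hw0 : ‖w‖ = 0
  · exfalso
    have : P = Q := by
      have := norm_eq_zero.1 hw0
      rw [hw, sub_eq_zero] at this
      exact this.symm
    apply h0
    rw [hΔ, this]; simp
  have hwp : 0 < ‖w‖ := lt_of_le_of_ne (norm_nonneg _) (Ne.symm hw0)
  have h1 := key ((‖w‖ / ‖Δ‖) • Δ)
  have hnorm : ‖(‖w‖ / ‖Δ‖) • Δ‖ = ‖w‖ := by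
    rw [norm_smul, norm_div, norm_norm, norm_norm]; field_simp
  have h2 : ‖w + (‖w‖ / ‖Δ‖) • Δ‖ ≤ 2 * ‖w‖ := by
    refine (norm_add_le _ _).trans ?_
    rw [hnorm]; linarith
  have h3 : ‖w + (‖w‖ / ‖Δ‖) • Δ‖^2 ≤ (2 * ‖w‖)^2 := by gcongr
  rw [inner_smul_right, real_inner_self_eq_norm_sq, hnorm] at h1
  have h4 : ‖w‖ / ‖Δ‖ * ‖Δ‖^2 = ‖w‖ * ‖Δ‖ := by field_simp
  rw [h4] at h1
  have h5 : ‖w‖ * ‖Δ‖ ≤ ‖w‖ * (12 * ‖w‖) := by nlinarith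
  simpa using le_of_mul_le_mul_left h5 hwp

/-- A first-order touching from above determines the gradient. -/
lemma QuadDiff.eq_of_le {V : H → ℝ} {g : H → H} (hV : QuadDiff V g) {P q : H} {c : ℝ}
    (h : ∀ P', V P' ≤ V P + ⟪q, P' - P⟫ + c * ‖P' - P‖^2) : g P = q := by
  have key : ∀ s : ℝ, 0 < s → ‖g P - q‖^2 ≤ s * ((c + 2) * ‖g P - q‖^2) := by
    intro s hs
    have h1 := h (P + s • (g P - q))
    have h2 := abs_le.1 (hV P (s • (g P - q)))
    rw [add_sub_cancel_left] at h1
    rw [norm_smul, inner_smul_right, mul_pow, Real.norm_eq_abs, sq_abs] at h1 h2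
    have h3 : ⟪g P, g P - q⟫ - ⟪q, g P - q⟫ = ‖g P - q‖^2 := by
      rw [← inner_sub_left, real_inner_self_eq_norm_sq]
    have : s * ‖g P - q‖^2 ≤ s * (s * ((c + 2) * ‖g P - q‖^2)) := by nlinarith
    exact le_of_mul_le_mul_left this hs
  have hz : ‖g P - q‖^2 ≤ 0 := by
    have ht : Tendsto (fun s : ℝ => s * ((c + 2) * ‖g P - q‖^2)) (𝓝[>] 0) (𝓝 0) := by
      have : Tendsto (fun s : ℝ => s * ((c + 2) * ‖g P - q‖^2)) (𝓝 0)
          (𝓝 (0 * ((c + 2) * ‖g P - q‖^2))) := (continuous_id.mul continuous_const).tendsto 0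
      rw [zero_mul] at this
      exact this.mono_left nhdsWithin_le_nhds
    exact ge_of_tendsto ht (eventually_nhdsWithin_of_forall fun s hs => key s hs)
  have : ‖g P - q‖ = 0 := by
    have := sq_nonneg ‖g P - q‖
    exact pow_eq_zero_iff (n := 2) (by norm_num) |>.1 (le_antisymm hz this)
  exact sub_eq_zero.1 (norm_eq_zero.1 this)

lemma QuadDiff.neg {V : H → ℝ} {g : H → H} (hV : QuadDiff V g) :
    QuadDiff (fun P => -V P) (fun P => -g P) := by
  intro P h
  have := hV P h
  rw [inner_neg_left, show -V (P + h) - -V P - -⟪g P, h⟫ = -(V (P + h) - V P - ⟪g P, h⟫) by ring,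
    abs_neg]
  exact this

/-- A first-order touching from below determines the gradient. -/
lemma QuadDiff.eq_of_ge {V : H → ℝ} {g : H → H} (hV : QuadDiff V g) {P q : H} {c : ℝ}
    (h : ∀ P', V P + ⟪q, P' - P⟫ - c * ‖P' - P‖^2 ≤ V P') : g P = q := by
  have := hV.neg.eq_of_le (P := P) (q := -q) (c := c) fun P' => by
    have := h P'
    rw [inner_neg_left]
    linarith
  exact neg_injective this

/-- Second-order expansion where the gradient is differentiable. -/
lemma QuadDiff.second_order {V : H → ℝ} {g : H → H} (hV : QuadDiff V g) {P : H}
    {D : H →L[ℝ] H} (hD : HasFDerivAt g D P) {η : ℝ} (hη : 0 < η) :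
    ∀ᶠ h in 𝓝 (0 : H),
      |V (P + h) - V P - ⟪g P, h⟫ - 1/2 * ⟪D h, h⟫| ≤ η * ‖h‖^2 := by
  rw [hasFDerivAt_iff_isLittleO_nhds_zero] at hD
  have h1 := hD.def hη
  rw [Metric.eventually_nhds_iff] at h1 ⊢
  obtain ⟨r, hr, h1⟩ := h1
  refine ⟨r, hr, fun h hh => ?_⟩
  rw [dist_zero_right] at hh
  set φ : ℝ → ℝ := fun s => V (P + s • h) - s * ⟪g P, h⟫ - s^2 / 2 * ⟪D h, h⟫ with hφ
  have hder : ∀ s : ℝ, HasDerivAt φ (⟪g (P + s • h) - g P - s • D h, h⟫) s := by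
    intro s
    have e1 : HasDerivAt (fun s : ℝ => P + s • h) h s := by
      simpa using ((hasDerivAt_id s).smul_const h).const_add P
    have e2 : HasDerivAt (fun s => V (P + s • h)) (⟪g (P + s • h), h⟫) s := by
      have := (hV.hasFDerivAt (P + s • h)).comp_hasDerivAt s e1
      rw [innerSL_apply_apply] at this
      exact this
    have e3 : HasDerivAt (fun s : ℝ => s * ⟪g P, h⟫) (⟪g P, h⟫) s := by
      simpa using (hasDerivAt_id s).mul_const (⟪g P, h⟫)
    have e4 : HasDerivAt (fun s : ℝ => s^2 / 2 * ⟪D h, h⟫) (s * ⟪D h, h⟫) s := by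
      exact (((hasDerivAt_pow 2 s).div_const 2).mul_const (⟪D h, h⟫)).congr_deriv (by norm_num)
    exact ((e2.sub e3).sub e4).congr_deriv (by
      rw [inner_sub_left, inner_sub_left, inner_smul_left]
      simp)
  have hb : ∀ s ∈ Ico (0:ℝ) 1, ‖⟪g (P + s • h) - g P - s • D h, h⟫‖ ≤ η * ‖h‖^2 := by
    intro s hs
    have hn : ‖s • h‖ ≤ ‖h‖ := by
      rw [norm_smul, Real.norm_eq_abs, abs_of_nonneg hs.1]
      nlinarith [norm_nonneg h, hs.2]
    have h2 := h1 (y := s • h) (by rw [dist_zero_right]; exact hn.trans_lt hh)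
    rw [map_smul] at h2
    calc ‖⟪g (P + s • h) - g P - s • D h, h⟫‖ ≤ ‖g (P + s • h) - g P - s • D h‖ * ‖h‖ :=
          norm_inner_le_norm _ _
      _ ≤ (η * ‖h‖) * ‖h‖ := by gcongr; exact h2.trans (by gcongr)
      _ = η * ‖h‖^2 := by ring
  have := norm_image_sub_le_of_norm_deriv_le_segment_01' (f := φ)
    (fun s _ => (hder s).hasDerivWithinAt) hb
  rw [Real.norm_eq_abs] at this
  convert this using 2
  simp only [hφ, one_smul, zero_smul, add_zero]
  ring

/-- Where the hull is touched from above by a paraboloid of opening less than `2`, it is in contact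
with the sup-convolution. -/
lemma exists_contact_of_hull {K : Set H} (hK : IsCompact K) (hne : K.Nonempty) {u : H → ℝ}
    (hu : UpperSemicontinuousOn u K) {V : H → ℝ}
    (hlow : ∀ P, ∀ R ∈ K, u R - 1/2 * ‖P - R‖^2 ≤ V P)
    (hhull : ∀ P q b, (∀ P', ∀ R ∈ K,
        u R - 1/2 * ‖P' - R‖^2 ≤ b + ⟪q, P' - P⟫ + ‖P' - P‖^2) → V P ≤ b)
    {P q : H} {c : ℝ} (hc : c < 1) (htouch : ∀ P', V P' ≤ V P + ⟪q, P' - P⟫ + c * ‖P' - P‖^2) :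
    ∃ R ∈ K, V P = u R - 1/2 * ‖P - R‖^2 := by
  have husc : UpperSemicontinuousOn (fun R => u R + (- (1/2 * ‖P - R‖^2))) K :=
    hu.add ((Continuous.upperSemicontinuous (f := fun R => -(1/2 * ‖P - R‖^2))
      (by fun_prop)).upperSemicontinuousOn K)
  obtain ⟨R₁, hR₁, hmax⟩ := husc.exists_isMaxOn hne hK
  refine ⟨R₁, hR₁, le_antisymm ?_ (hlow P R₁ hR₁)⟩
  by_contra hcon
  push Not at hcon
  set γ := V P - (u R₁ - 1/2 * ‖P - R₁‖^2) with hγ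
  have hγ0 : 0 < γ := by linarith
  obtain ⟨D, hD⟩ := (hK.image (f := fun R => ‖P - R‖) (by fun_prop)).bddAbove
  have hD' : ∀ R ∈ K, ‖P - R‖ ≤ D := fun R hR => hD ⟨R, hR, rfl⟩
  have hD0 : 0 ≤ D := (norm_nonneg _).trans (hD' R₁ hR₁)
  set r := γ / (2 * (D + ‖q‖ + 1)) with hr
  have hden : 0 < 2 * (D + ‖q‖ + 1) := by positivity
  have hr0 : 0 < r := by positivity
  have hrr : r * (2 * (D + ‖q‖ + 1)) = γ := by rw [hr]; field_simp
  set γ' := min (γ / 2) ((1 - c) * r^2) with hγ'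
  have hγ'0 : 0 < γ' := lt_min (by linarith) (mul_pos (by linarith) (by positivity))
  have := hhull P q (V P - γ') fun P' R hR => by
    have hA := (hlow P' R hR).trans (htouch P')
    by_cases hx : r ≤ ‖P' - P‖
    · have h1 : r^2 ≤ ‖P' - P‖^2 := by gcongr
      have h2 : γ' ≤ (1 - c) * r^2 := min_le_right _ _
      have h3 : (1 - c) * r^2 ≤ (1 - c) * ‖P' - P‖^2 := by
        apply mul_le_mul_of_nonneg_left h1; linarith
      linarith
    · push Not at hx
      have h1 : u R + -(1/2 * ‖P - R‖^2) ≤ u R₁ + -(1/2 * ‖P - R₁‖^2) := hmax hR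
      have e := norm_add_sq_real (P' - P) (P - R)
      rw [sub_add_sub_cancel] at e
      have h2 := (abs_le.1 (abs_real_inner_le_norm (P' - P) (P - R))).1
      have h3 := (abs_le.1 (abs_real_inner_le_norm q (P' - P))).1
      have h4 : ‖P' - P‖ * ‖P - R‖ ≤ r * D := by
        have := hD' R hR
        gcongr
      have h5 : ‖q‖ * ‖P' - P‖ ≤ ‖q‖ * r := by gcongr
      have h6 : γ' ≤ γ / 2 := min_le_left _ _
      nlinarith [sq_nonneg ‖P' - P‖]
  linarith

/-- A Lipschitz self-map whose image of `A` contains a ball is differentiable at some point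
of `A`. -/
lemma LipschitzWith.exists_differentiableAt_of_ball_subset_image {E : Type*}
    [NormedAddCommGroup E] [NormedSpace ℝ E] [FiniteDimensional ℝ E] {C : NNReal} {G : E → E}
    (hG : LipschitzWith C G) {A : Set E} {x : E} {r : ℝ} (hr : 0 < r)
    (hA : Metric.ball x r ⊆ G '' A) : ∃ Z ∈ A, DifferentiableAt ℝ G Z := by
  let _ : MeasurableSpace E := borel E
  have : BorelSpace E := ⟨rfl⟩
  set μ : Measure E := μH[Module.finrank ℝ E] with hμ
  by_contra hcon
  push Not at hcon
  have h0 : μ A = 0 := by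
    have := hG.ae_differentiableAt (μ := μ)
    exact measure_mono_null (fun z hz => hcon z hz) this
  have h1 : μ (G '' A) = 0 := by
    have := hG.hausdorffMeasure_image_le (d := Module.finrank ℝ E) (by positivity) A
    rw [← hμ, h0, mul_zero] at this
    exact le_antisymm this bot_le
  have h2 : μ (Metric.ball x r) = 0 := measure_mono_null hA h1
  exact (Metric.measure_ball_pos μ x hr).ne' h2

end TwiceDifferentiable

section TheoremOnSums

variable {H : Type*} [NormedAddCommGroup H] [InnerProductSpace ℝ H]

open scoped RealInnerProductSpace

lemma norm_sub_sq_expand (P P' Q : H) :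
    ‖P' - Q‖^2 = ‖P - Q‖^2 + 2 * ⟪P - Q, P' - P⟫ + ‖P' - P‖^2 := by
  rw [← norm_add_sq_real, sub_add_sub_cancel']

lemma hull_le_of_le_paraboloid {K : Set H} {u V : H → ℝ}
    (hhull : ∀ P q b, (∀ P', ∀ R ∈ K,
        u R - 1/2 * ‖P' - R‖^2 ≤ b + ⟪q, P' - P⟫ + ‖P' - P‖^2) → V P ≤ b)
    {Q : H} {b : ℝ} (h : ∀ P', ∀ R ∈ K, u R - 1/2 * ‖P' - R‖^2 ≤ b + 1/2 * ‖P' - Q‖^2) (P : H) :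
    V P ≤ b + 1/2 * ‖P - Q‖^2 := by
  refine hhull P (P - Q) _ fun P' R hR => (h P' R hR).trans ?_
  have := norm_sub_sq_expand P P' Q
  nlinarith [sq_nonneg ‖P' - P‖]

/-- At a point of contact between the hull and the sup-convolution, `u` has an upper second-order
expansion. -/
lemma exists_upper_jet_of_hull {K : Set H} (hK : IsCompact K) (hne : K.Nonempty) {u : H → ℝ}
    (hu : UpperSemicontinuousOn u K) {V : H → ℝ} {g : H → H} (hV : QuadDiff V g)
    (hlow : ∀ P, ∀ R ∈ K, u R - 1/2 * ‖P - R‖^2 ≤ V P)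
    (hhull : ∀ P q b, (∀ P', ∀ R ∈ K,
        u R - 1/2 * ‖P' - R‖^2 ≤ b + ⟪q, P' - P⟫ + ‖P' - P‖^2) → V P ≤ b)
    {P q : H} {c : ℝ} (hc : c < 1) (htouch : ∀ P', V P' ≤ V P + ⟪q, P' - P⟫ + c * ‖P' - P‖^2)
    {D : H →L[ℝ] H} (hD : HasFDerivAt g D P) {η : ℝ} (hη : 0 < η) :
    P + g P ∈ K ∧ u (P + g P) = V P + 1/2 * ‖g P‖^2 ∧
      ∀ᶠ R in 𝓝[K] (P + g P), u R ≤ u (P + g P) + ⟪g P, R - (P + g P)⟫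
        + 1/2 * ⟪D (R - (P + g P)), R - (P + g P)⟫ + η * ‖R - (P + g P)‖^2 := by
  obtain ⟨R', hR', hcon⟩ := exists_contact_of_hull hK hne hu hlow hhull hc htouch
  have hg : g P = R' - P := hV.eq_of_ge (c := 1/2) fun P' => by
    have h1 := hlow P' R' hR'
    have h2 := norm_sub_sq_expand P P' R'
    have h3 : ⟪R' - P, P' - P⟫ = -⟪P - R', P' - P⟫ := by rw [← inner_neg_left, neg_sub]
    linarith
  have hPg : P + g P = R' := by rw [hg]; abel
  have hn : ‖P - R'‖ = ‖g P‖ := by rw [hg, norm_sub_rev]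
  rw [hPg]
  refine ⟨hR', by rw [← hn]; linarith, ?_⟩
  have ht : Tendsto (fun R : H => R - R') (𝓝[K] R') (𝓝 0) := by
    have : Tendsto (fun R : H => R - R') (𝓝 R') (𝓝 (R' - R')) :=
      (continuous_id.sub continuous_const).tendsto R'
    rw [sub_self] at this
    exact this.mono_left nhdsWithin_le_nhds
  filter_upwards [ht.eventually (hV.second_order hD hη), self_mem_nhdsWithin] with R h1 h2
  have h3 := hlow (P + (R - R')) R h2
  rw [show P + (R - R') - R = P - R' by abel] at h3
  have := (abs_le.1 h1).2
  linarith

set_option maxHeartbeats 1600000 in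
/-- Crandall–Ishii lemma (theorem on sums) in an approximate form: near a maximum point of
`u(x) + v(y) - ‖x - y‖² / 6` there are points with upper second-order expansions whose Hessians
satisfy the usual matrix inequality. -/
theorem exists_upper_jets_of_max [FiniteDimensional ℝ H] {K₁ K₂ : Set H} (hK₁ : IsCompact K₁)
    (hK₂ : IsCompact K₂) {u v : H → ℝ} (hu : UpperSemicontinuousOn u K₁)
    (hv : UpperSemicontinuousOn v K₂) {R S : H} (hR : R ∈ K₁) (hS : S ∈ K₂)
    (hmax : ∀ R' ∈ K₁, ∀ S' ∈ K₂,
      u R' + v S' - 1/6 * ‖R' - S'‖^2 ≤ u R + v S - 1/6 * ‖R - S‖^2)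
    {η : ℝ} (hη : 0 < η) :
    ∃ R' ∈ K₁, ∃ S' ∈ K₂, ∃ (g₁ g₂ : H) (D₁ D₂ : H →L[ℝ] H),
      dist R' R < η ∧ dist S' S < η ∧ |u R' - u R| < η ∧ |v S' - v S| < η ∧
      ‖g₁ - (1/3 : ℝ) • (R - S)‖ < η ∧ ‖g₂ + (1/3 : ℝ) • (R - S)‖ < η ∧
      (∀ᶠ P in 𝓝[K₁] R', u P ≤ u R' + ⟪g₁, P - R'⟫ + 1/2 * ⟪D₁ (P - R'), P - R'⟫
        + η * ‖P - R'‖^2) ∧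
      (∀ᶠ P in 𝓝[K₂] S', v P ≤ v S' + ⟪g₂, P - S'⟫ + 1/2 * ⟪D₂ (P - S'), P - S'⟫
        + η * ‖P - S'‖^2) ∧
      ∀ ξ ζ, ⟪D₁ ξ, ξ⟫ + ⟪D₂ ζ, ζ⟫ ≤ ‖ξ - ζ‖^2 + η * (‖ξ‖^2 + ‖ζ‖^2) := by
  obtain ⟨V₁, g₁, hV₁, hlow₁, hhull₁⟩ := exists_paraboloid_hull hK₁ ⟨R, hR⟩ hu
  obtain ⟨V₂, g₂, hV₂, hlow₂, hhull₂⟩ := exists_paraboloid_hull hK₂ ⟨S, hS⟩ hv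
  replace hV₁ : QuadDiff V₁ g₁ := hV₁
  replace hV₂ : QuadDiff V₂ g₂ := hV₂
  set m := u R + v S - 1/6 * ‖R - S‖^2 with hm
  have hraw : ∀ P Q, ∀ R' ∈ K₁, ∀ S' ∈ K₂,
      (u R' - 1/2 * ‖P - R'‖^2) + (v S' - 1/2 * ‖Q - S'‖^2) ≤ m + 1/2 * ‖P - Q‖^2 := by
    intro P Q R' hR' S' hS'
    have h1 := hmax R' hR' S' hS'
    have h2 : ‖R' - S'‖ ≤ ‖P - R'‖ + ‖P - Q‖ + ‖Q - S'‖ := by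
      have : R' - S' = -(P - R') + (P - Q) + (Q - S') := by abel
      rw [this]
      refine (norm_add₃_le).trans ?_
      rw [norm_neg]
    have h3 : ‖R' - S'‖^2 ≤ (‖P - R'‖ + ‖P - Q‖ + ‖Q - S'‖)^2 := by gcongr
    nlinarith [sq_nonneg (‖P - R'‖ - ‖P - Q‖), sq_nonneg (‖P - R'‖ - ‖Q - S'‖),
      sq_nonneg (‖P - Q‖ - ‖Q - S'‖)]
  have hsum : ∀ P Q, V₁ P + V₂ Q - 1/2 * ‖P - Q‖^2 ≤ m := by
    intro P Q
    have h1 : ∀ Q', ∀ S' ∈ K₂, v S' - 1/2 * ‖Q' - S'‖^2 ≤ (m - V₁ P) + 1/2 * ‖Q' - P‖^2 := by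
      intro Q' S' hS'
      have := hull_le_of_le_paraboloid hhull₁ (Q := Q')
        (b := m - (v S' - 1/2 * ‖Q' - S'‖^2)) (fun P' R' hR' => by
          have := hraw P' Q' R' hR' S' hS'
          linarith) P
      rw [norm_sub_rev Q' P]
      linarith
    have := hull_le_of_le_paraboloid hhull₂ h1 Q
    rw [norm_sub_rev Q P] at this
    linarith
  set P₀ := R + (1/3 : ℝ) • (S - R) with hP₀
  set Q₀ := R + (2/3 : ℝ) • (S - R) with hQ₀
  have ePR : P₀ - R = (1/3 : ℝ) • (S - R) := by rw [hP₀]; abel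
  have eQS : Q₀ - S = -((1/3 : ℝ) • (S - R)) := by rw [hQ₀]; module
  have ePQ : P₀ - Q₀ = -((1/3 : ℝ) • (S - R)) := by rw [hQ₀, hP₀]; module
  have enorm : ‖(1/3 : ℝ) • (S - R)‖^2 = 1/9 * ‖R - S‖^2 := by
    rw [norm_smul, mul_pow, norm_sub_rev S R]; norm_num
  have l₁ := hlow₁ P₀ R hR
  have l₂ := hlow₂ Q₀ S hS
  have l₃ := hsum P₀ Q₀
  have nPR : ‖P₀ - R‖^2 = 1/9 * ‖R - S‖^2 := by rw [ePR, enorm]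
  have nQS : ‖Q₀ - S‖^2 = 1/9 * ‖R - S‖^2 := by rw [eQS, norm_neg, enorm]
  have nPQ : ‖P₀ - Q₀‖^2 = 1/9 * ‖R - S‖^2 := by rw [ePQ, norm_neg, enorm]
  have v₁ : V₁ P₀ = u R - 1/2 * ‖P₀ - R‖^2 := by linarith
  have v₂ : V₂ Q₀ = v S - 1/2 * ‖Q₀ - S‖^2 := by linarith
  have hg₁ : g₁ P₀ = R - P₀ := hV₁.eq_of_ge (c := 1/2) fun P' => by
    have h1 := hlow₁ P' R hR
    have h2 := norm_sub_sq_expand P₀ P' R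
    have h3 : ⟪R - P₀, P' - P₀⟫ = -⟪P₀ - R, P' - P₀⟫ := by rw [← inner_neg_left, neg_sub]
    linarith
  have hg₂ : g₂ Q₀ = S - Q₀ := hV₂.eq_of_ge (c := 1/2) fun P' => by
    have h1 := hlow₂ P' S hS
    have h2 := norm_sub_sq_expand Q₀ P' S
    have h3 : ⟪S - Q₀, P' - Q₀⟫ = -⟪Q₀ - S, P' - Q₀⟫ := by rw [← inner_neg_left, neg_sub]
    linarith
  have e₁ : P₀ + g₁ P₀ = R := by rw [hg₁]; abel
  have e₂ : Q₀ + g₂ Q₀ = S := by rw [hg₂]; abel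
  have hgc₁ : Continuous g₁ := hV₁.lipschitzWith.continuous
  have hgc₂ : Continuous g₂ := hV₂.lipschitzWith.continuous
  have hVc₁ := hV₁.continuous
  have hVc₂ := hV₂.continuous
  have near : ∀ {V : H → ℝ} {g : H → H} {P : H}, Continuous V → Continuous g →
      ∃ ρ > 0, ∀ P' ∈ Metric.closedBall P ρ, dist (P' + g P') (P + g P) < η ∧
        |(V P' + 1/2 * ‖g P'‖^2) - (V P + 1/2 * ‖g P‖^2)| < η ∧ ‖g P' - g P‖ < η := by
    intro V g P hV hg
    have h1 : ∀ᶠ P' in 𝓝 P, dist (P' + g P') (P + g P) < η :=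
      (Metric.tendsto_nhds.1 ((continuous_id.add hg).tendsto P)) η hη
    have h2 : ∀ᶠ P' in 𝓝 P, |(V P' + 1/2 * ‖g P'‖^2) - (V P + 1/2 * ‖g P‖^2)| < η := by
      have hc : Continuous fun P' => V P' + 1/2 * ‖g P'‖^2 := by fun_prop
      have := (Metric.tendsto_nhds.1 (hc.tendsto P)) η hη
      simpa only [Real.dist_eq] using this
    have h3 : ∀ᶠ P' in 𝓝 P, ‖g P' - g P‖ < η := by
      have := (Metric.tendsto_nhds.1 (hg.tendsto P)) η hη
      simpa only [dist_eq_norm] using this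
    obtain ⟨ρ, hρ, h⟩ := Metric.nhds_basis_closedBall.eventually_iff.1 (h1.and (h2.and h3))
    exact ⟨ρ, hρ, fun P' hP' => h hP'⟩
  obtain ⟨ρ₁, hρ₁, near₁⟩ := near (P := P₀) hVc₁ hgc₁
  obtain ⟨ρ₂, hρ₂, near₂⟩ := near (P := Q₀) hVc₂ hgc₂
  set ρ := min ρ₁ ρ₂ with hρ
  have hρ0 : 0 < ρ := lt_min hρ₁ hρ₂
  set κ := min (1/4) (η/4) with hκ
  have hκ0 : 0 < κ := lt_min (by norm_num) (by linarith)
  have hκ1 : κ ≤ 1/4 := min_le_left _ _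
  have hκ2 : κ ≤ η/4 := min_le_right _ _
  set F : H → H → H × H → ℝ := fun p₁ p₂ Z => V₁ Z.1 + V₂ Z.2 - 1/2 * ‖Z.1 - Z.2‖^2
    - κ * (‖Z.1 - P₀‖^2 + ‖Z.2 - Q₀‖^2) - ⟪p₁, Z.1 - P₀⟫ - ⟪p₂, Z.2 - Q₀⟫ with hF
  have hFc : ∀ p₁ p₂, Continuous (F p₁ p₂) := fun p₁ p₂ => by
    simp only [hF]; fun_prop
  have hF0 : ∀ p₁ p₂, F p₁ p₂ (P₀, Q₀) = m := fun p₁ p₂ => by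
    simp only [hF, sub_self, norm_zero, inner_zero_right]
    linarith
  set A : Set (H × H) := {Z | Z.1 ∈ Metric.closedBall P₀ ρ ∧ Z.2 ∈ Metric.closedBall Q₀ ρ ∧
    ∃ p₁ p₂, ∀ Z', F p₁ p₂ Z' ≤ F p₁ p₂ Z} with hA
  have hmaxF : ∀ p₁ p₂ : H, ‖p₁‖ ≤ κ * ρ / 2 → ‖p₂‖ ≤ κ * ρ / 2 →
      ∃ Z : H × H, Z.1 ∈ Metric.closedBall P₀ ρ ∧ Z.2 ∈ Metric.closedBall Q₀ ρ ∧
        ∀ Z', F p₁ p₂ Z' ≤ F p₁ p₂ Z := by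
    intro p₁ p₂ hp₁ hp₂
    obtain ⟨Z, hZ, hZm⟩ := ((isCompact_closedBall P₀ ρ).prod
      (isCompact_closedBall Q₀ ρ)).exists_isMaxOn
      ⟨(P₀, Q₀), by simp [hρ0.le]⟩ (hFc p₁ p₂).continuousOn
    refine ⟨Z, hZ.1, hZ.2, fun Z' => ?_⟩
    by_cases hin : Z' ∈ Metric.closedBall P₀ ρ ×ˢ Metric.closedBall Q₀ ρ
    · exact hZm hin
    · have h0 : m ≤ F p₁ p₂ Z := by
        rw [← hF0 p₁ p₂]
        exact hZm (show (P₀, Q₀) ∈ _ by simp [hρ0.le])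
      refine le_trans ?_ h0
      have hs := hsum Z'.1 Z'.2
      have i₁ := (abs_le.1 (abs_real_inner_le_norm p₁ (Z'.1 - P₀))).1
      have i₂ := (abs_le.1 (abs_real_inner_le_norm p₂ (Z'.2 - Q₀))).1
      have j₁ : ‖p₁‖ * ‖Z'.1 - P₀‖ ≤ κ * ρ / 2 * ‖Z'.1 - P₀‖ := by gcongr
      have j₂ : ‖p₂‖ * ‖Z'.2 - Q₀‖ ≤ κ * ρ / 2 * ‖Z'.2 - Q₀‖ := by gcongr
      set α := ‖Z'.1 - P₀‖ with hα
      set β := ‖Z'.2 - Q₀‖ with hβ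
      have hα0 : 0 ≤ α := norm_nonneg _
      have hβ0 : 0 ≤ β := norm_nonneg _
      have hq : ρ / 2 * α + ρ / 2 * β ≤ α^2 + β^2 := by
        rw [mem_prod, Metric.mem_closedBall, Metric.mem_closedBall, dist_eq_norm,
          dist_eq_norm, not_and_or, not_le, not_le] at hin
        rcases le_total α β with h | h
        · have : ρ ≤ β := by rcases hin with h' | h' <;> linarith
          nlinarith
        · have : ρ ≤ α := by rcases hin with h' | h' <;> linarith
          nlinarith
      have hq2 := mul_le_mul_of_nonneg_left hq hκ0.le
      simp only [hF]
      linarith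
  have hgrad : ∀ p₁ p₂ : H, ∀ Z : H × H, (∀ Z', F p₁ p₂ Z' ≤ F p₁ p₂ Z) → ∀ h k : H,
      V₁ (Z.1 + h) + V₂ (Z.2 + k) ≤ V₁ Z.1 + V₂ Z.2
        + ⟪(Z.1 - Z.2) + (2 * κ) • (Z.1 - P₀) + p₁, h⟫
        + ⟪(Z.2 - Z.1) + (2 * κ) • (Z.2 - Q₀) + p₂, k⟫
        + 1/2 * ‖h - k‖^2 + κ * (‖h‖^2 + ‖k‖^2) := by
    intro p₁ p₂ Z hZ h k
    have h1 := hZ (Z.1 + h, Z.2 + k)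
    simp only [hF] at h1
    rw [show Z.1 + h - (Z.2 + k) = (Z.1 - Z.2) + (h - k) by abel,
      show Z.1 + h - P₀ = (Z.1 - P₀) + h by abel, show Z.2 + k - Q₀ = (Z.2 - Q₀) + k by abel,
      norm_add_sq_real, norm_add_sq_real, norm_add_sq_real, inner_add_right, inner_add_right,
      inner_sub_right (Z.1 - Z.2)] at h1
    rw [inner_add_left, inner_add_left, inner_add_left, inner_add_left, inner_smul_left,
      inner_smul_left, ← neg_sub Z.1 Z.2, inner_neg_left]
    simp only [conj_trivial]
    linarith
  have htouch₁ : ∀ p₁ p₂ : H, ∀ Z : H × H, (∀ Z', F p₁ p₂ Z' ≤ F p₁ p₂ Z) → ∀ P',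
      V₁ P' ≤ V₁ Z.1 + ⟪(Z.1 - Z.2) + (2 * κ) • (Z.1 - P₀) + p₁, P' - Z.1⟫
        + (1/2 + κ) * ‖P' - Z.1‖^2 := by
    intro p₁ p₂ Z hZ P'
    have h1 := hgrad p₁ p₂ Z hZ (P' - Z.1) 0
    rw [add_sub_cancel, add_zero, inner_zero_right, sub_zero, norm_zero] at h1
    linarith
  have htouch₂ : ∀ p₁ p₂ : H, ∀ Z : H × H, (∀ Z', F p₁ p₂ Z' ≤ F p₁ p₂ Z) → ∀ P',
      V₂ P' ≤ V₂ Z.2 + ⟪(Z.2 - Z.1) + (2 * κ) • (Z.2 - Q₀) + p₂, P' - Z.2⟫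
        + (1/2 + κ) * ‖P' - Z.2‖^2 := by
    intro p₁ p₂ Z hZ P'
    have h1 := hgrad p₁ p₂ Z hZ 0 (P' - Z.2)
    rw [add_sub_cancel, add_zero, inner_zero_right, zero_sub, norm_neg, norm_zero] at h1
    linarith
  set L₁ : H × H →L[ℝ] H := (1 + 2 * κ) • ContinuousLinearMap.fst ℝ H H
    - ContinuousLinearMap.snd ℝ H H with hL₁
  set L₂ : H × H →L[ℝ] H := (1 + 2 * κ) • ContinuousLinearMap.snd ℝ H H
    - ContinuousLinearMap.fst ℝ H H with hL₂
  set G : H × H → H × H := fun Z => (g₁ Z.1 - (L₁ Z - (2 * κ) • P₀),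
    g₂ Z.2 - (L₂ Z - (2 * κ) • Q₀)) with hG
  obtain ⟨C, hGL⟩ : ∃ C, LipschitzWith C G := by
    refine ⟨_, LipschitzWith.prodMk
      ((hV₁.lipschitzWith.comp LipschitzWith.prod_fst).sub
        (L₁.lipschitz.sub (LipschitzWith.const _)))
      ((hV₂.lipschitzWith.comp LipschitzWith.prod_snd).sub
        (L₂.lipschitz.sub (LipschitzWith.const _)))⟩
  have hGp : ∀ p₁ p₂ : H, ∀ Z : H × H, (∀ Z', F p₁ p₂ Z' ≤ F p₁ p₂ Z) →
      G Z = (p₁, p₂) := by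
    intro p₁ p₂ Z hZ
    have h1 := hV₁.eq_of_le (htouch₁ p₁ p₂ Z hZ)
    have h2 := hV₂.eq_of_le (htouch₂ p₁ p₂ Z hZ)
    simp only [hG, hL₁, hL₂, h1, h2, _root_.sub_apply, _root_.smul_apply,
      ContinuousLinearMap.coe_fst', ContinuousLinearMap.coe_snd']
    congr 1 <;> module
  have hball : Metric.ball (0 : H × H) (κ * ρ / 2) ⊆ G '' A := by
    rintro ⟨p₁, p₂⟩ hp
    rw [mem_ball_zero_iff, Prod.norm_def, max_lt_iff] at hp
    obtain ⟨Z, hZ1, hZ2, hZ⟩ := hmaxF p₁ p₂ hp.1.le hp.2.le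
    exact ⟨Z, ⟨hZ1, hZ2, p₁, p₂, hZ⟩, hGp p₁ p₂ Z hZ⟩
  obtain ⟨Z, ⟨hZ1, hZ2, p₁, p₂, hZ⟩, hdiff⟩ :=
    hGL.exists_differentiableAt_of_ball_subset_image (by positivity) hball
  obtain ⟨P, Q⟩ := Z
  simp only at hZ1 hZ2
  have hd₁ : DifferentiableAt ℝ g₁ P := by
    have h1 : DifferentiableAt ℝ (fun P' : H => ((P', Q) : H × H)) P := by fun_prop
    have h2 := ((hdiff.fst).add ((L₁.differentiableAt).sub_const ((2 * κ) • P₀))).comp P h1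
    refine h2.congr_of_eventuallyEq (Eventually.of_forall fun P' => ?_)
    simp [hG]
  have hd₂ : DifferentiableAt ℝ g₂ Q := by
    have h1 : DifferentiableAt ℝ (fun Q' : H => ((P, Q') : H × H)) Q := by fun_prop
    have h2 := ((hdiff.snd).add ((L₂.differentiableAt).sub_const ((2 * κ) • Q₀))).comp Q h1
    refine h2.congr_of_eventuallyEq (Eventually.of_forall fun Q' => ?_)
    simp [hG]
  have hc : 1/2 + κ < 1 := by linarith
  obtain ⟨a₁, b₁, c₁⟩ := exists_upper_jet_of_hull hK₁ ⟨R, hR⟩ hu hV₁ hlow₁ hhull₁ hc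
    (htouch₁ p₁ p₂ _ hZ) hd₁.hasFDerivAt hη
  obtain ⟨a₂, b₂, c₂⟩ := exists_upper_jet_of_hull hK₂ ⟨S, hS⟩ hv hV₂ hlow₂ hhull₂ hc
    (htouch₂ p₁ p₂ _ hZ) hd₂.hasFDerivAt hη
  simp only at a₁ b₁ c₁ a₂ b₂ c₂
  obtain ⟨n₁, n₂, n₃⟩ := near₁ P (Metric.closedBall_subset_closedBall (min_le_left _ _) hZ1)
  obtain ⟨n₄, n₅, n₆⟩ := near₂ Q (Metric.closedBall_subset_closedBall (min_le_right _ _) hZ2)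
  rw [e₁] at n₁
  rw [e₂] at n₄
  have w₁ : u R = V₁ P₀ + 1/2 * ‖g₁ P₀‖^2 := by
    rw [v₁, hg₁, norm_sub_rev R P₀]; ring
  have w₂ : v S = V₂ Q₀ + 1/2 * ‖g₂ Q₀‖^2 := by
    rw [v₂, hg₂, norm_sub_rev S Q₀]; ring
  refine ⟨P + g₁ P, a₁, Q + g₂ Q, a₂, g₁ P, g₂ Q, fderiv ℝ g₁ P, fderiv ℝ g₂ Q, n₁, n₄,
    by rw [b₁, w₁]; exact n₂, by rw [b₂, w₂]; exact n₅, ?_, ?_, c₁, c₂, ?_⟩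
  · have : (1/3 : ℝ) • (R - S) = g₁ P₀ := by rw [hg₁, hP₀]; module
    rw [this]; exact n₃
  · have : g₂ Q + (1/3 : ℝ) • (R - S) = g₂ Q - g₂ Q₀ := by rw [hg₂, hQ₀]; module
    rw [this]; exact n₆
  · intro ξ ζ
    have s₁ := hV₁.second_order hd₁.hasFDerivAt hκ0
    have s₂ := hV₂.second_order hd₂.hasFDerivAt hκ0
    have t : ∀ w : H, Tendsto (fun s : ℝ => s • w) (𝓝[>] 0) (𝓝 0) := fun w => by
      have : Tendsto (fun s : ℝ => s • w) (𝓝 0) (𝓝 ((0:ℝ) • w)) :=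
        (continuous_id.smul continuous_const).tendsto 0
      rw [zero_smul] at this
      exact this.mono_left nhdsWithin_le_nhds
    obtain ⟨s, ⟨hs₁, hs₂⟩, hs⟩ := ((((t ξ).eventually s₁).and ((t ζ).eventually s₂)).and
      self_mem_nhdsWithin).exists
    have hs0 : (0:ℝ) < s := hs
    have hm := hgrad p₁ p₂ _ hZ (s • ξ) (s • ζ)
    simp only at hm
    have q₁ := hV₁.eq_of_le (htouch₁ p₁ p₂ _ hZ)
    have q₂ := hV₂.eq_of_le (htouch₂ p₁ p₂ _ hZ)
    simp only at q₁ q₂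
    rw [← q₁, ← q₂, ← smul_sub] at hm
    have r₁ := (abs_le.1 hs₁).1
    have r₂ := (abs_le.1 hs₂).1
    have nn : ∀ w : H, ‖s • w‖^2 = s^2 * ‖w‖^2 := fun w => by
      rw [norm_smul, mul_pow, Real.norm_eq_abs, sq_abs]
    have ii : ∀ (D : H →L[ℝ] H) (w : H), ⟪D (s • w), s • w⟫ = s^2 * ⟪D w, w⟫ := fun D w => by
      rw [map_smul, inner_smul_left, inner_smul_right, conj_trivial]; ring
    rw [ii, nn] at r₁ r₂
    rw [nn, nn, nn] at hm
    have hfin : s^2 * (⟪fderiv ℝ g₁ P ξ, ξ⟫ + ⟪fderiv ℝ g₂ Q ζ, ζ⟫) ≤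
        s^2 * (‖ξ - ζ‖^2 + 4 * κ * (‖ξ‖^2 + ‖ζ‖^2)) := by linarith
    refine (le_of_mul_le_mul_left hfin (by positivity)).trans ?_
    have : 4 * κ ≤ η := by linarith
    gcongr

end TheoremOnSums

section ParabolicJets

variable {n d : ℕ}

/-- The `k`-th column of a matrix, as a Euclidean vector. -/
def colVec (s : Matrix (Fin n) (Fin d) ℝ) (k : Fin d) : En n := WithLp.toLp 2 (fun i => s i k)

/-- The linear part of the parabolic operator on a first- and second-order jet. -/
def jetOp (b : En n) (s : Matrix (Fin n) (Fin d) ℝ) (l : ℝ × En n →L[ℝ] ℝ)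
    (B : ℝ × En n →L[ℝ] ℝ × En n →L[ℝ] ℝ) : ℝ :=
  l (1, b) + 1/2 * ∑ k, B (0, colVec s k) (0, colVec s k)

/-- The diffusion gradient of a first-order jet. -/
def jetGrad (s : Matrix (Fin n) (Fin d) ℝ) (l : ℝ × En n →L[ℝ] ℝ) : Ed d :=
  WithLp.toLp 2 (fun k => l (0, colVec s k))

/-- The space-time derivative of `φ`. -/
def jet1 (φ : ℝ → En n → ℝ) (t : ℝ) (x : En n) : ℝ × En n →L[ℝ] ℝ :=
  fderiv ℝ (fun p : ℝ × En n => φ p.1 p.2) (t, x)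

/-- The second space-time derivative of `φ`. -/
def jet2 (φ : ℝ → En n → ℝ) (t : ℝ) (x : En n) : ℝ × En n →L[ℝ] ℝ × En n →L[ℝ] ℝ :=
  fderiv ℝ (fderiv ℝ (fun p : ℝ × En n => φ p.1 p.2)) (t, x)

/-- The parabolic operator `∂_t + L`. -/
def parOp (a : ℝ → En n → En n) (σm : ℝ → En n → Matrix (Fin n) (Fin d) ℝ)
    (φ : ℝ → En n → ℝ) (t : ℝ) (x : En n) : ℝ :=
  ptd φ t x + genL a σm φ t x

lemma sum_smul_single (v : En n) : ∑ i, v i • (EuclideanSpace.single i (1:ℝ) : En n) = v := by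
  ext j
  simp [Pi.single_apply]

lemma sum_mul_pd (g : En n → ℝ) (x v : En n) : ∑ i, v i * pd g x i = fderiv ℝ g x v := by
  conv_rhs => rw [← sum_smul_single v]
  simp [pd]

lemma pd2_eq {g : En n → ℝ} (hg : ContDiff ℝ 2 g) (x : En n) (i j : Fin n) :
    pd2 g x i j = fderiv ℝ (fderiv ℝ g) x (EuclideanSpace.single i 1)
      (EuclideanSpace.single j 1) := by
  have h : DifferentiableAt ℝ (fderiv ℝ g) x :=
    (hg.fderiv_right (m := 1) (by norm_num)).differentiable (by norm_num) x
  rw [pd2, fderiv_clm_apply h (differentiableAt_const _)]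
  simp

/-- Coordinate-free form of the generator. -/
lemma genL_eq_fderiv {a : ℝ → En n → En n} {σm : ℝ → En n → Matrix (Fin n) (Fin d) ℝ}
    {φ : ℝ → En n → ℝ} {t : ℝ} (hφ : ContDiff ℝ 2 (φ t)) (x : En n) :
    genL a σm φ t x = fderiv ℝ (φ t) x (a t x) + 1/2 * ∑ k,
      fderiv ℝ (fderiv ℝ (φ t)) x (colVec (σm t x) k) (colVec (σm t x) k) := by
  rw [genL, sum_mul_pd]
  congr 2
  have h : ∀ k, fderiv ℝ (fderiv ℝ (φ t)) x (colVec (σm t x) k) (colVec (σm t x) k)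
      = ∑ i, ∑ j, σm t x i k * σm t x j k * pd2 (φ t) x i j := by
    intro k
    conv_lhs => rw [← sum_smul_single (colVec (σm t x) k)]
    simp only [map_sum, map_smul, FunLike.coe_sum, Finset.sum_apply, FunLike.coe_smul,
      Pi.smul_apply, smul_eq_mul, colVec, pd2_eq hφ]
    rw [Finset.sum_comm]
    refine Finset.sum_congr rfl fun i _ => ?_
    simp only [Finset.mul_sum]
    refine Finset.sum_congr rfl fun j _ => by ring
  simp only [h, Matrix.mul_apply, Matrix.transpose_apply, Finset.sum_mul]
  rw [Finset.sum_comm (γ := Fin d)]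
  refine Finset.sum_congr rfl fun i _ => ?_
  rw [Finset.sum_comm]

lemma sigGrad_apply (σm : ℝ → En n → Matrix (Fin n) (Fin d) ℝ) (φ : ℝ → En n → ℝ) (t : ℝ)
    (x : En n) (k : Fin d) :
    sigGrad σm φ t x k = fderiv ℝ (φ t) x (colVec (σm t x) k) := by
  rw [← sum_mul_pd]
  rfl

lemma IsTest.differentiable {φ : ℝ → En n → ℝ} (hφ : IsTest φ) :
    Differentiable ℝ (fun p : ℝ × En n => φ p.1 p.2) :=
  ContDiff.differentiable hφ (by norm_num)

lemma IsTest.differentiable_fderiv {φ : ℝ → En n → ℝ} (hφ : IsTest φ) :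
    Differentiable ℝ (fderiv ℝ (fun p : ℝ × En n => φ p.1 p.2)) :=
  (ContDiff.fderiv_right (m := 1) hφ (by norm_num)).differentiable (by norm_num)

lemma IsTest.slice {φ : ℝ → En n → ℝ} (hφ : IsTest φ) (t : ℝ) : ContDiff ℝ 2 (φ t) :=
  ContDiff.comp (g := fun p : ℝ × En n => φ p.1 p.2) (f := fun x => (t, x)) hφ (by fun_prop)

lemma IsTest.hasDerivAt {φ : ℝ → En n → ℝ} (hφ : IsTest φ) (t : ℝ) (x : En n) :
    HasDerivAt (fun s => φ s x) (jet1 φ t x (1, 0)) t := by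
  have h1 : HasDerivAt (fun s : ℝ => ((s, x) : ℝ × En n)) (1, 0) t :=
    (hasDerivAt_id t).prodMk (hasDerivAt_const t x)
  exact (hφ.differentiable (t, x)).hasFDerivAt.comp_hasDerivAt t h1

lemma IsTest.ptd_eq {φ : ℝ → En n → ℝ} (hφ : IsTest φ) (t : ℝ) (x : En n) :
    ptd φ t x = jet1 φ t x (1, 0) := (hφ.hasDerivAt t x).deriv

lemma IsTest.fderiv_slice {φ : ℝ → En n → ℝ} (hφ : IsTest φ) (t : ℝ) (x : En n) :
    fderiv ℝ (φ t) x = (jet1 φ t x).comp (ContinuousLinearMap.inr ℝ ℝ (En n)) := by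
  have h1 : HasFDerivAt (fun y : En n => ((t, y) : ℝ × En n))
      (ContinuousLinearMap.inr ℝ ℝ (En n)) x := hasFDerivAt_prodMk_right t x
  exact ((hφ.differentiable (t, x)).hasFDerivAt.comp x h1).fderiv

lemma IsTest.fderiv_fderiv_slice {φ : ℝ → En n → ℝ} (hφ : IsTest φ) (t : ℝ) (x v w : En n) :
    fderiv ℝ (fderiv ℝ (φ t)) x v w = jet2 φ t x (0, v) (0, w) := by
  have h1 : HasFDerivAt (fun y : En n => ((t, y) : ℝ × En n))
      (ContinuousLinearMap.inr ℝ ℝ (En n)) x := hasFDerivAt_prodMk_right t x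
  have h2 : HasFDerivAt (fun y => jet1 φ t y)
      ((jet2 φ t x).comp (ContinuousLinearMap.inr ℝ ℝ (En n))) x :=
    (hφ.differentiable_fderiv (t, x)).hasFDerivAt.comp x h1
  have h3 := h2.clm_comp (hasFDerivAt_const (ContinuousLinearMap.inr ℝ ℝ (En n)) x)
  have h4 : fderiv ℝ (φ t) = fun y => (jet1 φ t y).comp (ContinuousLinearMap.inr ℝ ℝ (En n)) :=
    funext fun y => hφ.fderiv_slice t y
  rw [h4, h3.fderiv]
  simp

lemma IsTest.parOp_eq {φ : ℝ → En n → ℝ} (hφ : IsTest φ) (a : ℝ → En n → En n)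
    (σm : ℝ → En n → Matrix (Fin n) (Fin d) ℝ) (t : ℝ) (x : En n) :
    parOp a σm φ t x = jetOp (a t x) (σm t x) (jet1 φ t x) (jet2 φ t x) := by
  rw [parOp, genL_eq_fderiv (hφ.slice t), hφ.ptd_eq, hφ.fderiv_slice, jetOp]
  simp only [hφ.fderiv_fderiv_slice]
  rw [← add_assoc, ContinuousLinearMap.comp_apply, ContinuousLinearMap.inr_apply, ← map_add]
  simp

lemma IsTest.sigGrad_eq {φ : ℝ → En n → ℝ} (hφ : IsTest φ)
    (σm : ℝ → En n → Matrix (Fin n) (Fin d) ℝ) (t : ℝ) (x : En n) :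
    sigGrad σm φ t x = jetGrad (σm t x) (jet1 φ t x) := by
  ext k
  rw [sigGrad_apply, hφ.fderiv_slice]
  rfl

lemma jetOp_add (b : En n) (s : Matrix (Fin n) (Fin d) ℝ) (l l' : ℝ × En n →L[ℝ] ℝ)
    (B B' : ℝ × En n →L[ℝ] ℝ × En n →L[ℝ] ℝ) :
    jetOp b s (l + l') (B + B') = jetOp b s l B + jetOp b s l' B' := by
  simp only [jetOp, _root_.add_apply, Finset.sum_add_distrib]; ring

lemma jetOp_smul (b : En n) (s : Matrix (Fin n) (Fin d) ℝ) (c : ℝ) (l : ℝ × En n →L[ℝ] ℝ)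
    (B : ℝ × En n →L[ℝ] ℝ × En n →L[ℝ] ℝ) :
    jetOp b s (c • l) (c • B) = c * jetOp b s l B := by
  simp only [jetOp, _root_.smul_apply, smul_eq_mul, ← Finset.mul_sum]; ring

lemma jetGrad_add (s : Matrix (Fin n) (Fin d) ℝ) (l l' : ℝ × En n →L[ℝ] ℝ) :
    jetGrad s (l + l') = jetGrad s l + jetGrad s l' := by
  ext k; simp [jetGrad]

lemma jetGrad_smul (s : Matrix (Fin n) (Fin d) ℝ) (c : ℝ) (l : ℝ × En n →L[ℝ] ℝ) :
    jetGrad s (c • l) = c • jetGrad s l := by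
  ext k; simp [jetGrad]

lemma IsTest.add {φ φ' : ℝ → En n → ℝ} (hφ : IsTest φ) (hφ' : IsTest φ') :
    IsTest (fun t x => φ t x + φ' t x) := ContDiff.add hφ hφ'

lemma IsTest.const_mul {φ : ℝ → En n → ℝ} (hφ : IsTest φ) (c : ℝ) :
    IsTest (fun t x => c * φ t x) := contDiff_const.mul hφ

lemma IsTest.sub {φ φ' : ℝ → En n → ℝ} (hφ : IsTest φ) (hφ' : IsTest φ') :
    IsTest (fun t x => φ t x - φ' t x) := ContDiff.sub hφ hφ'

lemma isTest_const (c : ℝ) : IsTest (fun (_ : ℝ) (_ : En n) => c) := contDiff_const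

lemma IsTest.continuous {φ : ℝ → En n → ℝ} (hφ : IsTest φ) :
    Continuous (fun p : ℝ × En n => φ p.1 p.2) := ContDiff.continuous hφ

variable {a : ℝ → En n → En n} {σm : ℝ → En n → Matrix (Fin n) (Fin d) ℝ}

lemma jet1_add {φ φ' : ℝ → En n → ℝ} (hφ : IsTest φ) (hφ' : IsTest φ') (t : ℝ) (x : En n) :
    jet1 (fun t x => φ t x + φ' t x) t x = jet1 φ t x + jet1 φ' t x :=
  fderiv_add (hφ.differentiable _) (hφ'.differentiable _)

lemma jet2_add {φ φ' : ℝ → En n → ℝ} (hφ : IsTest φ) (hφ' : IsTest φ') (t : ℝ) (x : En n) :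
    jet2 (fun t x => φ t x + φ' t x) t x = jet2 φ t x + jet2 φ' t x := by
  have h : fderiv ℝ (fun p : ℝ × En n => φ p.1 p.2 + φ' p.1 p.2) =
      fun p => fderiv ℝ (fun p : ℝ × En n => φ p.1 p.2) p
        + fderiv ℝ (fun p : ℝ × En n => φ' p.1 p.2) p :=
    funext fun p => fderiv_add (hφ.differentiable _) (hφ'.differentiable _)
  rw [jet2, h]
  exact fderiv_add (hφ.differentiable_fderiv _) (hφ'.differentiable_fderiv _)

lemma jet1_const_mul {φ : ℝ → En n → ℝ} (hφ : IsTest φ) (c t : ℝ) (x : En n) :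
    jet1 (fun t x => c * φ t x) t x = c • jet1 φ t x :=
  fderiv_const_mul (hφ.differentiable _) c

lemma jet2_const_mul {φ : ℝ → En n → ℝ} (hφ : IsTest φ) (c t : ℝ) (x : En n) :
    jet2 (fun t x => c * φ t x) t x = c • jet2 φ t x := by
  have h : fderiv ℝ (fun p : ℝ × En n => c * φ p.1 p.2) =
      fun p => c • fderiv ℝ (fun p : ℝ × En n => φ p.1 p.2) p :=
    funext fun p => fderiv_const_mul (hφ.differentiable _) c
  rw [jet2, h]
  exact fderiv_const_smul (hφ.differentiable_fderiv _) c

lemma IsTest.parOp_add {φ φ' : ℝ → En n → ℝ} (hφ : IsTest φ) (hφ' : IsTest φ') (t : ℝ) (x : En n) :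
    parOp a σm (fun t x => φ t x + φ' t x) t x = parOp a σm φ t x + parOp a σm φ' t x := by
  rw [(hφ.add hφ').parOp_eq, hφ.parOp_eq, hφ'.parOp_eq, jet1_add hφ hφ', jet2_add hφ hφ',
    jetOp_add]

lemma IsTest.parOp_const_mul {φ : ℝ → En n → ℝ} (hφ : IsTest φ) (c t : ℝ) (x : En n) :
    parOp a σm (fun t x => c * φ t x) t x = c * parOp a σm φ t x := by
  rw [(hφ.const_mul c).parOp_eq, hφ.parOp_eq, jet1_const_mul hφ, jet2_const_mul hφ, jetOp_smul]

lemma IsTest.sigGrad_add {φ φ' : ℝ → En n → ℝ} (hφ : IsTest φ) (hφ' : IsTest φ') (t : ℝ)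
    (x : En n) :
    sigGrad σm (fun t x => φ t x + φ' t x) t x = sigGrad σm φ t x + sigGrad σm φ' t x := by
  rw [(hφ.add hφ').sigGrad_eq, hφ.sigGrad_eq, hφ'.sigGrad_eq, jet1_add hφ hφ', jetGrad_add]

lemma IsTest.sigGrad_const_mul {φ : ℝ → En n → ℝ} (hφ : IsTest φ) (c t : ℝ) (x : En n) :
    sigGrad σm (fun t x => c * φ t x) t x = c • sigGrad σm φ t x := by
  rw [(hφ.const_mul c).sigGrad_eq, hφ.sigGrad_eq, jet1_const_mul hφ, jetGrad_smul]

lemma IsTest.parOp_sub {φ φ' : ℝ → En n → ℝ} (hφ : IsTest φ) (hφ' : IsTest φ') (t : ℝ) (x : En n) :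
    parOp a σm (fun t x => φ t x - φ' t x) t x = parOp a σm φ t x - parOp a σm φ' t x := by
  have := hφ'.parOp_add (hφ.sub hφ') (a := a) (σm := σm) t x
  simp only [add_sub_cancel] at this
  linarith

lemma IsTest.sigGrad_sub {φ φ' : ℝ → En n → ℝ} (hφ : IsTest φ) (hφ' : IsTest φ') (t : ℝ)
    (x : En n) :
    sigGrad σm (fun t x => φ t x - φ' t x) t x = sigGrad σm φ t x - sigGrad σm φ' t x := by
  have := hφ'.sigGrad_add (hφ.sub hφ') (σm := σm) t x
  simp only [add_sub_cancel] at this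
  rw [this]; abel

lemma parOp_const (c t : ℝ) (x : En n) : parOp a σm (fun _ _ => c) t x = 0 := by
  have h1 : jet1 (fun (_ : ℝ) (_ : En n) => c) t x = 0 := by simp [jet1]
  have h2 : jet2 (fun (_ : ℝ) (_ : En n) => c) t x = 0 := by simp [jet2]
  rw [(isTest_const c).parOp_eq, h1, h2]
  simp [jetOp]

lemma sigGrad_const (c t : ℝ) (x : En n) : sigGrad σm (fun _ _ => c) t x = 0 := by
  have h1 : jet1 (fun (_ : ℝ) (_ : En n) => c) t x = 0 := by simp [jet1]
  rw [(isTest_const c).sigGrad_eq, h1]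
  ext k
  simp [jetGrad]

end ParabolicJets

section ParabolicTests

variable {n d : ℕ} {a : ℝ → En n → En n} {σm : ℝ → En n → Matrix (Fin n) (Fin d) ℝ} {T : ℝ}

lemma continuous_colVec (k : Fin d) :
    Continuous (fun s : Matrix (Fin n) (Fin d) ℝ => colVec s k) := by
  unfold colVec
  fun_prop

lemma IsTest.continuous_jet1 {φ : ℝ → En n → ℝ} (hφ : IsTest φ) :
    Continuous (fun p : ℝ × En n => jet1 φ p.1 p.2) :=
  hφ.differentiable_fderiv.continuous

lemma IsTest.continuous_jet2 {φ : ℝ → En n → ℝ} (hφ : IsTest φ) :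
    Continuous (fun p : ℝ × En n => jet2 φ p.1 p.2) :=
  (ContDiff.fderiv_right (m := 1) hφ (by norm_num)).continuous_fderiv (by norm_num)

lemma IsTest.continuousOn_parOp {φ : ℝ → En n → ℝ} (hφ : IsTest φ)
    (ha : ContinuousOn (fun p : ℝ × En n => a p.1 p.2) (Strip n T))
    (hσ : ContinuousOn (fun p : ℝ × En n => σm p.1 p.2) (Strip n T)) :
    ContinuousOn (fun p : ℝ × En n => parOp a σm φ p.1 p.2) (Strip n T) := by
  simp only [hφ.parOp_eq, jetOp]
  have hk : ∀ k, ContinuousOn (fun p : ℝ × En n => colVec (σm p.1 p.2) k) (Strip n T) :=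
    fun k => (continuous_colVec k).comp_continuousOn hσ
  have h1 := hφ.continuous_jet1.continuousOn (s := Strip n T)
  have h2 := hφ.continuous_jet2.continuousOn (s := Strip n T)
  refine (h1.clm_apply (continuousOn_const.prodMk ha)).add
    (continuousOn_const.mul (continuousOn_finsetSum _ fun k _ => ?_))
  exact (h2.clm_apply (continuousOn_const.prodMk (hk k))).clm_apply
    (continuousOn_const.prodMk (hk k))

lemma IsTest.continuousOn_sigGrad {φ : ℝ → En n → ℝ} (hφ : IsTest φ)
    (hσ : ContinuousOn (fun p : ℝ × En n => σm p.1 p.2) (Strip n T)) :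
    ContinuousOn (fun p : ℝ × En n => sigGrad σm φ p.1 p.2) (Strip n T) := by
  simp only [hφ.sigGrad_eq, jetGrad]
  have hk : ∀ k, ContinuousOn (fun p : ℝ × En n => colVec (σm p.1 p.2) k) (Strip n T) :=
    fun k => (continuous_colVec k).comp_continuousOn hσ
  have h1 := hφ.continuous_jet1.continuousOn (s := Strip n T)
  refine (PiLp.continuous_toLp 2 _).comp_continuousOn (continuousOn_pi.2 fun k => ?_)
  exact h1.clm_apply (continuousOn_const.prodMk (hk k))

lemma fderiv_fderiv_nonneg_of_isLocalMin {E : Type*} [NormedAddCommGroup E] [NormedSpace ℝ E]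
    {g : E → ℝ} (hg : ContDiff ℝ 2 g) {x : E}
    (hx : IsLocalMin g x) (v : E) : 0 ≤ fderiv ℝ (fderiv ℝ g) x v v := by
  set f : ℝ → ℝ := fun s => g (x + s • v) with hf
  have hline : ∀ s : ℝ, HasDerivAt (fun s : ℝ => x + s • v) v s := fun s => by
    simpa using ((hasDerivAt_id s).smul_const v).const_add x
  have hd : deriv f = fun s => fderiv ℝ g (x + s • v) v := by
    funext s
    exact ((hg.differentiable (by norm_num) _).hasFDerivAt.comp_hasDerivAt s (hline s)).deriv
  have hg' : Differentiable ℝ (fderiv ℝ g) :=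
    (hg.fderiv_right (m := 1) (by norm_num)).differentiable (by norm_num)
  have hdd : deriv (deriv f) 0 = fderiv ℝ (fderiv ℝ g) x v v := by
    rw [hd]
    have h1 := (hg' (x + (0:ℝ) • v)).hasFDerivAt.comp_hasDerivAt 0 (hline 0)
    have h2 := h1.clm_apply (hasDerivAt_const (0:ℝ) v)
    rw [zero_smul, add_zero] at h2
    simpa using h2.deriv
  have hc : Continuous f := by
    have := hg.continuous
    fun_prop
  have hmin : IsLocalMin f 0 := by
    have ht : Tendsto (fun s : ℝ => x + s • v) (𝓝 0) (𝓝 x) := by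
      have : Continuous (fun s : ℝ => x + s • v) := by fun_prop
      simpa using this.tendsto 0
    have := ht.eventually hx
    filter_upwards [this] with s hs
    simpa [hf] using hs
  by_contra hneg
  push Not at hneg
  rw [← hdd] at hneg
  have hmax := isLocalMax_of_deriv_deriv_neg hneg hmin.deriv_eq_zero hc.continuousAt
  have hconst : f =ᶠ[𝓝 0] fun _ => f 0 := by
    filter_upwards [hmax, hmin] with s h1 h2
    exact le_antisymm h1 h2
  have := hconst.deriv.deriv_eq
  simp at this
  linarith

/-- The degenerate maximum principle for the parabolic operator. -/
lemma IsTest.parOp_nonneg_of_isLocalMinOn {D : ℝ → En n → ℝ} (hD : IsTest D) {t : ℝ}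
    (ht : t ∈ Ico 0 T) {x : En n}
    (hmin : IsLocalMinOn (fun p : ℝ × En n => D p.1 p.2) (Strip n T) (t, x)) :
    0 ≤ parOp a σm D t x ∧ sigGrad σm D t x = 0 := by
  have htm : t ∈ Icc 0 T := ⟨ht.1, ht.2.le⟩
  have h1 : 0 ≤ jet1 D t x (1, 0) := by
    have hcone : ((T, x) - (t, x) : ℝ × En n) ∈ posTangentConeAt (Strip n T) (t, x) := by
      refine mem_posTangentConeAt_of_segment_subset ?_
      rw [add_sub_cancel]
      refine (((convex_Icc 0 T).prod convex_univ).segment_subset ?_ ?_)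
      · exact ⟨htm, mem_univ _⟩
      · exact ⟨⟨ht.1.trans ht.2.le, le_rfl⟩, mem_univ _⟩
    have := hmin.hasFDerivWithinAt_nonneg
      (hD.differentiable (t, x)).hasFDerivAt.hasFDerivWithinAt hcone
    have e : ((T, x) - (t, x) : ℝ × En n) = (T - t) • ((1, 0) : ℝ × En n) := by
      ext <;> simp
    rw [e, map_smul, smul_eq_mul] at this
    exact nonneg_of_mul_nonneg_right this (sub_pos.2 ht.2)
  have hloc : IsLocalMin (D t) x := by
    have htend : Tendsto (fun y : En n => ((t, y) : ℝ × En n)) (𝓝 x) (𝓝[Strip n T] (t, x)) := by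
      refine tendsto_nhdsWithin_of_tendsto_nhds_of_eventually_within _ ?_
        (Eventually.of_forall fun y => ⟨htm, mem_univ _⟩)
      exact (Continuous.prodMk_right t).tendsto x
    exact htend.eventually hmin
  have h2 : fderiv ℝ (D t) x = 0 := hloc.fderiv_eq_zero
  refine ⟨?_, ?_⟩
  · rw [parOp, genL_eq_fderiv (hD.slice t), h2, hD.ptd_eq]
    have : 0 ≤ ∑ k, fderiv ℝ (fderiv ℝ (D t)) x (colVec (σm t x) k) (colVec (σm t x) k) :=
      Finset.sum_nonneg fun k _ => fderiv_fderiv_nonneg_of_isLocalMin (hD.slice t) hloc _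
    simp only [_root_.zero_apply]
    linarith
  · ext k
    rw [sigGrad_apply, h2]
    simp

/-- The quadratic polynomial with a given jet at `(t₀, x₀)`. -/
def quadPoly (t₀ : ℝ) (x₀ : En n) (c : ℝ) (l : ℝ × En n →L[ℝ] ℝ)
    (B : ℝ × En n →L[ℝ] ℝ × En n →L[ℝ] ℝ) (t : ℝ) (x : En n) : ℝ :=
  c + l ((t, x) - (t₀, x₀)) + 1/2 * B ((t, x) - (t₀, x₀)) ((t, x) - (t₀, x₀))

lemma isTest_quadPoly (t₀ : ℝ) (x₀ : En n) (c : ℝ) (l : ℝ × En n →L[ℝ] ℝ)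
    (B : ℝ × En n →L[ℝ] ℝ × En n →L[ℝ] ℝ) : IsTest (quadPoly t₀ x₀ c l B) := by
  unfold IsTest quadPoly
  have h : ContDiff ℝ 2 (fun p : ℝ × En n => (p.1, p.2) - (t₀, x₀)) := by fun_prop
  exact (contDiff_const.add (l.contDiff.comp h)).add
    (contDiff_const.mul ((B.contDiff.comp h).clm_apply h))

set_option synthInstance.maxHeartbeats 200000 in
lemma hasFDerivAt_quadPoly (t₀ : ℝ) (x₀ : En n) (c : ℝ) (l : ℝ × En n →L[ℝ] ℝ)
    (B : ℝ × En n →L[ℝ] ℝ × En n →L[ℝ] ℝ) (p : ℝ × En n) :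
    HasFDerivAt (fun p : ℝ × En n => quadPoly t₀ x₀ c l B p.1 p.2)
      (l + ((1/2 : ℝ) • (B + B.flip)) (p - (t₀, x₀))) p := by
  have h0 : HasFDerivAt (fun p : ℝ × En n => p - (t₀, x₀)) (.id ℝ (ℝ × En n)) p :=
    (hasFDerivAt_id p).sub_const _
  have h1 := l.hasFDerivAt.comp p h0
  have h2 := ((B.hasFDerivAt.comp p h0).clm_apply h0).const_mul (1/2 : ℝ)
  refine (((h1.const_add c).add h2).congr_fderiv ?_)
  ext v <;> simp

lemma jet1_quadPoly (t₀ : ℝ) (x₀ : En n) (c : ℝ) (l : ℝ × En n →L[ℝ] ℝ)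
    (B : ℝ × En n →L[ℝ] ℝ × En n →L[ℝ] ℝ) : jet1 (quadPoly t₀ x₀ c l B) t₀ x₀ = l := by
  rw [jet1, (hasFDerivAt_quadPoly t₀ x₀ c l B _).fderiv, sub_self, map_zero, add_zero]

lemma jet2_quadPoly (t₀ : ℝ) (x₀ : En n) (c : ℝ) (l : ℝ × En n →L[ℝ] ℝ)
    (B : ℝ × En n →L[ℝ] ℝ × En n →L[ℝ] ℝ) :
    jet2 (quadPoly t₀ x₀ c l B) t₀ x₀ = (1/2 : ℝ) • (B + B.flip) := by
  have h : fderiv ℝ (fun p : ℝ × En n => quadPoly t₀ x₀ c l B p.1 p.2) =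
      fun p => l + ((1/2 : ℝ) • (B + B.flip)) (p - (t₀, x₀)) :=
    funext fun p => (hasFDerivAt_quadPoly t₀ x₀ c l B p).fderiv
  rw [jet2, h]
  have h0 : HasFDerivAt (fun p : ℝ × En n => p - (t₀, x₀)) (.id ℝ (ℝ × En n)) (t₀, x₀) :=
    (hasFDerivAt_id _).sub_const _
  exact ((((1/2 : ℝ) • (B + B.flip)).hasFDerivAt.comp _ h0).const_add l).fderiv

lemma parOp_quadPoly (t₀ : ℝ) (x₀ : En n) (c : ℝ) (l : ℝ × En n →L[ℝ] ℝ)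
    (B : ℝ × En n →L[ℝ] ℝ × En n →L[ℝ] ℝ) :
    parOp a σm (quadPoly t₀ x₀ c l B) t₀ x₀ = jetOp (a t₀ x₀) (σm t₀ x₀) l B := by
  rw [(isTest_quadPoly t₀ x₀ c l B).parOp_eq, jet1_quadPoly, jet2_quadPoly, jetOp, jetOp]
  congr 2
  refine Finset.sum_congr rfl fun k _ => ?_
  simp only [_root_.smul_apply, _root_.add_apply, ContinuousLinearMap.flip_apply, smul_eq_mul]
  ring

lemma sigGrad_quadPoly (t₀ : ℝ) (x₀ : En n) (c : ℝ) (l : ℝ × En n →L[ℝ] ℝ)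
    (B : ℝ × En n →L[ℝ] ℝ × En n →L[ℝ] ℝ) :
    sigGrad σm (quadPoly t₀ x₀ c l B) t₀ x₀ = jetGrad (σm t₀ x₀) l := by
  rw [(isTest_quadPoly t₀ x₀ c l B).sigGrad_eq, jet1_quadPoly]

/-- Squared parabolic distance to `(t₀, x₀)`. -/
def sqDist (t₀ : ℝ) (x₀ : En n) (t : ℝ) (x : En n) : ℝ := (t - t₀)^2 + ‖x - x₀‖^2

lemma isTest_sqDist (t₀ : ℝ) (x₀ : En n) : IsTest (sqDist t₀ x₀) := by
  unfold IsTest sqDist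
  have h : ContDiff ℝ 2 (fun p : ℝ × En n => p.2 - x₀) := by fun_prop
  exact ContDiff.add (by fun_prop) (h.norm_sq ℝ)

lemma sqDist_nonneg (t₀ : ℝ) (x₀ : En n) (t : ℝ) (x : En n) : 0 ≤ sqDist t₀ x₀ t x := by
  unfold sqDist; positivity

lemma sqDist_self (t₀ : ℝ) (x₀ : En n) : sqDist t₀ x₀ t₀ x₀ = 0 := by simp [sqDist]

lemma eq_of_sqDist_eq_zero {t₀ : ℝ} {x₀ : En n} {t : ℝ} {x : En n} (h : sqDist t₀ x₀ t x = 0) :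
    t = t₀ ∧ x = x₀ := by
  unfold sqDist at h
  have h1 := sq_nonneg (t - t₀)
  have h2 := sq_nonneg ‖x - x₀‖
  exact ⟨by nlinarith [pow_eq_zero_iff (n := 2) (by norm_num) |>.1 (by linarith : (t - t₀)^2 = 0)],
    sub_eq_zero.1 (norm_eq_zero.1 (pow_eq_zero_iff (n := 2) (by norm_num) |>.1 (by linarith)))⟩

/-- A penalty vanishing to fourth order at `(t₀, x₀)`. -/
def quartic (t₀ : ℝ) (x₀ : En n) (t : ℝ) (x : En n) : ℝ := sqDist t₀ x₀ t x ^ 2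

lemma isTest_quartic (t₀ : ℝ) (x₀ : En n) : IsTest (quartic t₀ x₀) :=
  ContDiff.pow (isTest_sqDist t₀ x₀) 2

lemma quartic_nonneg (t₀ : ℝ) (x₀ : En n) (t : ℝ) (x : En n) : 0 ≤ quartic t₀ x₀ t x :=
  sq_nonneg _

lemma quartic_self (t₀ : ℝ) (x₀ : En n) : quartic t₀ x₀ t₀ x₀ = 0 := by simp [quartic, sqDist_self]

lemma eq_of_quartic_nonpos {t₀ : ℝ} {x₀ : En n} {t : ℝ} {x : En n} (h : quartic t₀ x₀ t x ≤ 0) :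
    t = t₀ ∧ x = x₀ :=
  eq_of_sqDist_eq_zero (pow_eq_zero_iff (n := 2) (by norm_num) |>.1
    (le_antisymm h (quartic_nonneg _ _ _ _)))

lemma quartic_jet {t : ℝ} (ht : t ∈ Ico 0 T) (x : En n) :
    parOp a σm (quartic t x) t x = 0 ∧ sigGrad σm (quartic t x) t x = 0 := by
  have h1 := (isTest_quartic t x).parOp_nonneg_of_isLocalMinOn (a := a) (σm := σm) ht (x := x)
    (Eventually.of_forall fun p => by
      change quartic t x t x ≤ _
      rw [quartic_self]; exact quartic_nonneg _ _ _ _)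
  have h2 : ∀ δ > 0, parOp a σm (quartic t x) t x ≤ δ * parOp a σm (sqDist t x) t x := by
    intro δ hδ
    have h3 := ((isTest_sqDist t x).const_mul δ).sub (isTest_quartic t x)
    have h4 := h3.parOp_nonneg_of_isLocalMinOn (a := a) (σm := σm) ht (x := x) (by
      have hc : Tendsto (fun p : ℝ × En n => sqDist t x p.1 p.2) (𝓝[Strip n T] (t, x)) (𝓝 0) := by
        have := (isTest_sqDist t x).continuous.tendsto (t, x)
        simp only [sqDist_self] at this
        exact this.mono_left nhdsWithin_le_nhds
      filter_upwards [hc.eventually (gt_mem_nhds hδ)] with p hp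
      rw [sqDist_self, quartic_self]
      have := sqDist_nonneg t x p.1 p.2
      unfold quartic
      nlinarith)
    rw [((isTest_sqDist t x).const_mul δ).parOp_sub (isTest_quartic t x),
      (isTest_sqDist t x).parOp_const_mul] at h4
    linarith [h4.1]
  refine ⟨le_antisymm ?_ h1.1, h1.2⟩
  have ht : Tendsto (fun δ : ℝ => δ * parOp a σm (sqDist t x) t x) (𝓝[>] 0) (𝓝 0) := by
    have : Tendsto (fun δ : ℝ => δ * parOp a σm (sqDist t x) t x) (𝓝 0)
        (𝓝 (0 * parOp a σm (sqDist t x) t x)) := (continuous_id.mul continuous_const).tendsto 0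
    rw [zero_mul] at this
    exact this.mono_left nhdsWithin_le_nhds
  exact ge_of_tendsto ht (eventually_nhdsWithin_of_forall fun δ hδ => h2 δ hδ)

end ParabolicTests

section Weights

variable {n d : ℕ}

/-- The `m`-th power of the positive part. -/
def posPow (m : ℕ) (y : ℝ) : ℝ := (max y 0) ^ m

lemma posPow_nonneg (m : ℕ) (y : ℝ) : 0 ≤ posPow m y := pow_nonneg (le_max_right _ _) _

lemma continuous_posPow (m : ℕ) : Continuous (posPow m) := by
  unfold posPow; fun_prop

lemma posPow_hasDerivAt (m : ℕ) (y : ℝ) :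
    HasDerivAt (posPow (m + 2)) ((m + 2) * posPow (m + 1) y) y := by
  have hne : ∀ y : ℝ, y ≠ 0 → HasDerivAt (posPow (m + 2)) ((m + 2) * posPow (m + 1) y) y := by
    intro y hy
    rcases lt_or_gt_of_ne hy with h | h
    · have : posPow (m + 2) =ᶠ[𝓝 y] fun _ => 0 := by
        filter_upwards [gt_mem_nhds h] with z hz
        simp [posPow, max_eq_right hz.le]
      refine HasDerivAt.congr_of_eventuallyEq ?_ this
      have e : (m + 2) * posPow (m + 1) y = 0 := by simp [posPow, max_eq_right h.le]
      rw [e]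
      exact hasDerivAt_const _ _
    · have : posPow (m + 2) =ᶠ[𝓝 y] fun z => z ^ (m + 2) := by
        filter_upwards [lt_mem_nhds h] with z hz
        simp [posPow, max_eq_left hz.le]
      refine HasDerivAt.congr_of_eventuallyEq ?_ this
      refine (hasDerivAt_pow (m + 2) y).congr_deriv ?_
      simp [posPow, max_eq_left h.le]
  by_cases hy : y = 0
  · subst hy
    exact hasDerivAt_of_hasDerivAt_of_ne (x := 0) (g := fun y => (m + 2) * posPow (m + 1) y)
      hne (continuous_posPow _).continuousAt
      (continuous_const.mul (continuous_posPow _)).continuousAt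
  · exact hne y hy

lemma contDiff_posPow_one (m : ℕ) : ContDiff ℝ 1 (posPow (m + 2)) := by
  rw [contDiff_one_iff_deriv]
  refine ⟨fun y => (posPow_hasDerivAt m y).differentiableAt, ?_⟩
  have : deriv (posPow (m + 2)) = fun y => (m + 2) * posPow (m + 1) y :=
    funext fun y => (posPow_hasDerivAt m y).deriv
  rw [this]
  exact continuous_const.mul (continuous_posPow _)

lemma contDiff_posPow_two (m : ℕ) : ContDiff ℝ 2 (posPow (m + 3)) := by
  have h : deriv (posPow (m + 3)) = fun y => ((m + 1 : ℕ) + 2) * posPow (m + 2) y :=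
    funext fun y => (posPow_hasDerivAt (m + 1) y).deriv
  rw [show (2 : WithTop ℕ∞) = 1 + 1 by norm_num, contDiff_succ_iff_deriv]
  refine ⟨fun y => (posPow_hasDerivAt (m + 1) y).differentiableAt, by simp, ?_⟩
  rw [h]
  exact contDiff_const.mul (contDiff_posPow_one m)

/-- Radial polynomial weight, constant on the ball of radius `R`. -/
def wt (m : ℕ) (R : ℝ) (x : En n) : ℝ := 1 + posPow m (‖x‖^2 - R^2)

lemma one_le_wt (m : ℕ) (R : ℝ) (x : En n) : 1 ≤ wt m R x := by
  have := posPow_nonneg m (‖x‖^2 - R^2)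
  unfold wt; linarith

lemma wt_pos (m : ℕ) (R : ℝ) (x : En n) : 0 < wt m R x := one_pos.trans_le (one_le_wt m R x)

lemma contDiff_wt (m : ℕ) (R : ℝ) : ContDiff ℝ 2 (wt (n := n) (m + 3) R) := by
  unfold wt
  refine contDiff_const.add ((contDiff_posPow_two m).comp ?_)
  exact (contDiff_id.norm_sq ℝ).sub contDiff_const

lemma wt_eq_one {m : ℕ} (hm : m ≠ 0) {R : ℝ} {x : En n} (hx : ‖x‖ ≤ R) : wt m R x = 1 := by
  have : ‖x‖^2 - R^2 ≤ 0 := by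
    have : ‖x‖^2 ≤ R^2 := by gcongr
    linarith
  simp [wt, posPow, max_eq_right this, hm]

lemma wt_mono (m : ℕ) {R : ℝ} (_hR : 0 ≤ R) {x y : En n} (h : ‖y‖ ≤ max R ‖x‖) :
    wt m R y ≤ wt m R x := by
  unfold wt posPow
  gcongr 1 + ?_ ^ m
  refine max_le ?_ (le_max_right _ _)
  rcases le_max_iff.1 h with h | h
  · refine le_trans ?_ (le_max_right _ _)
    have : ‖y‖^2 ≤ R^2 := by gcongr
    linarith
  · refine le_trans ?_ (le_max_left _ _)
    gcongr

lemma pow_mul_one_add_le {Y : ℝ} (hY : 0 ≤ Y) (j i : ℕ) :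
    Y ^ j * (1 + Y) ^ i ≤ 2 ^ i * (1 + Y ^ (j + i)) := by
  rcases le_total Y 1 with h | h
  · have h1 : Y ^ j ≤ 1 := pow_le_one₀ hY h
    have h2 : (1 + Y) ^ i ≤ 2 ^ i := by gcongr; linarith
    have h3 : Y ^ j * (1 + Y) ^ i ≤ 1 * 2 ^ i := by gcongr
    have h4 : 0 ≤ (2:ℝ) ^ i * Y ^ (j + i) := by positivity
    linarith
  · have h2 : (1 + Y) ^ i ≤ (2 * Y) ^ i := by gcongr; linarith
    calc Y ^ j * (1 + Y) ^ i ≤ Y ^ j * (2 * Y) ^ i := by gcongr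
      _ = 2 ^ i * Y ^ (j + i) := by rw [mul_pow, pow_add]; ring
      _ ≤ 2 ^ i * (1 + Y ^ (j + i)) := by gcongr; linarith

lemma fderiv_wt (m : ℕ) (R : ℝ) (x : En n) :
    HasFDerivAt (wt (m + 3) R)
      ((2 * ((m:ℝ) + 3) * posPow (m + 2) (‖x‖^2 - R^2)) • innerSL ℝ x) x := by
  have h1 : HasFDerivAt (fun x : En n => ‖x‖^2 - R^2) (2 • innerSL ℝ x) x :=
    ((hasStrictFDerivAt_norm_sq x).hasFDerivAt).sub_const _
  have h2 := ((posPow_hasDerivAt (m + 1) (‖x‖^2 - R^2)).comp_hasFDerivAt x h1).const_add 1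
  refine h2.congr_fderiv ?_
  ext v
  simp
  ring

lemma fderiv_fderiv_wt (m : ℕ) (R : ℝ) (x v : En n) :
    fderiv ℝ (fderiv ℝ (wt (m + 3) R)) x v v =
      4 * (m + 3) * (m + 2) * posPow (m + 1) (‖x‖^2 - R^2) * (inner ℝ x v)^2
        + 2 * (m + 3) * posPow (m + 2) (‖x‖^2 - R^2) * ‖v‖^2 := by
  have h : fderiv ℝ (wt (n := n) (m + 3) R) = fun x =>
      (2 * ((m:ℝ) + 3) * posPow (m + 2) (‖x‖^2 - R^2)) • innerSL ℝ x :=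
    funext fun x => (fderiv_wt m R x).fderiv
  have h1 : HasFDerivAt (fun x : En n => ‖x‖^2 - R^2) (2 • innerSL ℝ x) x :=
    ((hasStrictFDerivAt_norm_sq x).hasFDerivAt).sub_const _
  have h2 := (((posPow_hasDerivAt m (‖x‖^2 - R^2)).comp_hasFDerivAt x h1).const_mul
    (2 * ((m:ℝ) + 3))).smul (innerSL ℝ (E := En n)).hasFDerivAt
  rw [h]
  refine (congrArg (fun L => L v v) h2.fderiv).trans ?_
  have e1 : innerSL ℝ v v = ‖v‖^2 := real_inner_self_eq_norm_sq v
  have e2 : innerSL ℝ x v = inner ℝ x v := rfl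
  simp [e1, e2]
  ring

lemma norm_colVec_le (s : Matrix (Fin n) (Fin d) ℝ) (k : Fin d) : ‖colVec s k‖ ≤ frob s := by
  rw [EuclideanSpace.norm_eq, frob]
  apply Real.sqrt_le_sqrt
  refine Finset.sum_le_sum fun i _ => ?_
  simp only [colVec, Real.norm_eq_abs, sq_abs]
  exact Finset.single_le_sum (f := fun j => (s i j)^2) (fun j _ => sq_nonneg _) (Finset.mem_univ k)

/-- Exponential-in-time, polynomial-in-space weight. -/
def expWt (T : ℝ) (m : ℕ) (R c t : ℝ) (x : En n) : ℝ := Real.exp (c * (T - t)) * wt m R x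

lemma expWt_pos (T : ℝ) (m : ℕ) (R c t : ℝ) (x : En n) : 0 < expWt T m R c t x :=
  mul_pos (Real.exp_pos _) (wt_pos m R x)

lemma wt_le_expWt {T : ℝ} (m : ℕ) (R : ℝ) {c t : ℝ} (hc : 0 ≤ c) (ht : t ≤ T) (x : En n) :
    wt m R x ≤ expWt T m R c t x := by
  have : 1 ≤ Real.exp (c * (T - t)) :=
    Real.one_le_exp (mul_nonneg hc (by linarith))
  unfold expWt
  nlinarith [wt_pos m R x]

lemma expWt_mono (T : ℝ) (m : ℕ) {R : ℝ} (hR : 0 ≤ R) (c t : ℝ) {x y : En n}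
    (h : ‖y‖ ≤ max R ‖x‖) : expWt T m R c t y ≤ expWt T m R c t x := by
  unfold expWt
  gcongr
  exact wt_mono m hR h

lemma isTest_expWt (T : ℝ) (m : ℕ) (R c : ℝ) : IsTest (expWt (n := n) T (m + 3) R c) := by
  unfold IsTest expWt
  refine ContDiff.mul (by fun_prop) ((contDiff_wt m R).comp contDiff_snd)

lemma one_add_norm_sq_le (R : ℝ) (x : En n) :
    (1 + ‖x‖)^2 ≤ 2 * (1 + R^2) * (1 + max (‖x‖^2 - R^2) 0) := by
  have h1 := le_max_left (‖x‖^2 - R^2) 0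
  have h2 := le_max_right (‖x‖^2 - R^2) 0
  nlinarith [sq_nonneg (1 - ‖x‖), mul_nonneg (sq_nonneg R) h2]

/-- Growth estimates for the generator on the weights. -/
lemma exists_expWt_bound (a : ℝ → En n → En n) (σm : ℝ → En n → Matrix (Fin n) (Fin d) ℝ)
    {T Ca : ℝ} (hCa : 0 < Ca)
    (hg : ∀ t ∈ Icc (0:ℝ) T, ∀ x : En n, ‖a t x‖ + frob (σm t x) ≤ Ca * (1 + ‖x‖))
    (m : ℕ) (R : ℝ) : ∃ C₀ > 0, ∀ c, ∀ t ∈ Icc (0:ℝ) T, ∀ x : En n,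
      |parOp a σm (expWt T (m + 3) R c) t x + c * expWt T (m + 3) R c t x|
        ≤ C₀ * expWt T (m + 3) R c t x ∧
      ‖sigGrad σm (expWt T (m + 3) R c) t x‖ ≤ C₀ * expWt T (m + 3) R c t x := by
  set A : ℝ := 2 * (m + 3) * Ca * (2 * (1 + R^2)) * 2 with hA
  set A₂ : ℝ := 4 * (m + 3) * (m + 2) * (Ca^2 * (2 * (1 + R^2))^2) * 4 with hA₂
  set A₃ : ℝ := 2 * (m + 3) * (Ca^2 * (2 * (1 + R^2))) * 2 with hA₃
  have hA0 : 0 < A := by positivity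
  have hA20 : 0 < A₂ := by positivity
  have hA30 : 0 < A₃ := by positivity
  have key1 : ∀ x v : En n, ‖v‖ ≤ Ca * (1 + ‖x‖) →
      |fderiv ℝ (wt (m + 3) R) x v| ≤ A * wt (m + 3) R x := by
    intro x v hv
    rw [(fderiv_wt m R x).fderiv]
    simp only [_root_.smul_apply, innerSL_apply_apply, smul_eq_mul]
    have hp := posPow_nonneg (m + 2) (‖x‖^2 - R^2)
    rw [abs_mul, abs_of_nonneg (by positivity)]
    have h1 : |inner ℝ x v| ≤ Ca * (2 * (1 + R^2) * (1 + max (‖x‖^2 - R^2) 0)) := by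
      refine (abs_real_inner_le_norm x v).trans ?_
      have h2 := one_add_norm_sq_le R x
      calc ‖x‖ * ‖v‖ ≤ (1 + ‖x‖) * (Ca * (1 + ‖x‖)) := by gcongr; linarith
        _ = Ca * (1 + ‖x‖)^2 := by ring
        _ ≤ _ := by gcongr
    have h3 := pow_mul_one_add_le (le_max_right (‖x‖^2 - R^2) 0) (m + 2) 1
    calc 2 * ((m:ℝ) + 3) * posPow (m + 2) (‖x‖^2 - R^2) * |inner ℝ x v|
        ≤ 2 * ((m:ℝ) + 3) * posPow (m + 2) (‖x‖^2 - R^2)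
          * (Ca * (2 * (1 + R^2) * (1 + max (‖x‖^2 - R^2) 0))) := by gcongr
      _ = 2 * ((m:ℝ) + 3) * Ca * (2 * (1 + R^2))
          * (max (‖x‖^2 - R^2) 0 ^ (m + 2) * (1 + max (‖x‖^2 - R^2) 0)^1) := by
          unfold posPow; ring
      _ ≤ 2 * ((m:ℝ) + 3) * Ca * (2 * (1 + R^2))
          * (2 ^ 1 * (1 + max (‖x‖^2 - R^2) 0 ^ (m + 2 + 1))) := by gcongr
      _ = A * wt (m + 3) R x := by rw [hA]; unfold wt posPow; ring
  have key2 : ∀ x v : En n, ‖v‖ ≤ Ca * (1 + ‖x‖) →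
      |fderiv ℝ (fderiv ℝ (wt (m + 3) R)) x v v| ≤ (A₂ + A₃) * wt (m + 3) R x := by
    intro x v hv
    rw [fderiv_fderiv_wt]
    have hp := posPow_nonneg (m + 2) (‖x‖^2 - R^2)
    have hp1 := posPow_nonneg (m + 1) (‖x‖^2 - R^2)
    have hY := le_max_right (‖x‖^2 - R^2) 0
    rw [abs_of_nonneg (by positivity)]
    have h2 := one_add_norm_sq_le R x
    have hv2 : ‖v‖^2 ≤ Ca^2 * (2 * (1 + R^2) * (1 + max (‖x‖^2 - R^2) 0)) :=
      calc ‖v‖^2 ≤ (Ca * (1 + ‖x‖))^2 := by gcongr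
        _ = Ca^2 * (1 + ‖x‖)^2 := by ring
        _ ≤ _ := by gcongr
    have h1 : (inner ℝ x v)^2 ≤ Ca^2 * (2 * (1 + R^2) * (1 + max (‖x‖^2 - R^2) 0))^2 := by
      have h4 := abs_real_inner_le_norm x v
      have h5 : (inner ℝ x v)^2 ≤ (‖x‖ * ‖v‖)^2 := by
        rw [← sq_abs]; gcongr
      calc (inner ℝ x v)^2 ≤ (‖x‖ * ‖v‖)^2 := h5
        _ ≤ ((1 + ‖x‖) * (Ca * (1 + ‖x‖)))^2 := by gcongr; linarith
        _ = Ca^2 * ((1 + ‖x‖)^2)^2 := by ring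
        _ ≤ _ := by gcongr
    have h3 := pow_mul_one_add_le hY (m + 1) 2
    have h6 := pow_mul_one_add_le hY (m + 2) 1
    have e1 : 4 * ((m:ℝ) + 3) * (m + 2) * posPow (m + 1) (‖x‖^2 - R^2) * (inner ℝ x v)^2
        ≤ A₂ * wt (m + 3) R x :=
      calc _ ≤ 4 * ((m:ℝ) + 3) * (m + 2) * posPow (m + 1) (‖x‖^2 - R^2)
            * (Ca^2 * (2 * (1 + R^2) * (1 + max (‖x‖^2 - R^2) 0))^2) := by gcongr
        _ = 4 * ((m:ℝ) + 3) * (m + 2) * (Ca^2 * (2 * (1 + R^2))^2)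
            * (max (‖x‖^2 - R^2) 0 ^ (m + 1) * (1 + max (‖x‖^2 - R^2) 0)^2) := by
            unfold posPow; ring
        _ ≤ 4 * ((m:ℝ) + 3) * (m + 2) * (Ca^2 * (2 * (1 + R^2))^2)
            * (2 ^ 2 * (1 + max (‖x‖^2 - R^2) 0 ^ (m + 1 + 2))) := by gcongr
        _ = A₂ * wt (m + 3) R x := by rw [hA₂]; unfold wt posPow; ring
    have e2 : 2 * ((m:ℝ) + 3) * posPow (m + 2) (‖x‖^2 - R^2) * ‖v‖^2 ≤ A₃ * wt (m + 3) R x :=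
      calc _ ≤ 2 * ((m:ℝ) + 3) * posPow (m + 2) (‖x‖^2 - R^2)
            * (Ca^2 * (2 * (1 + R^2) * (1 + max (‖x‖^2 - R^2) 0))) := by gcongr
        _ = 2 * ((m:ℝ) + 3) * (Ca^2 * (2 * (1 + R^2)))
            * (max (‖x‖^2 - R^2) 0 ^ (m + 2) * (1 + max (‖x‖^2 - R^2) 0)^1) := by
            unfold posPow; ring
        _ ≤ 2 * ((m:ℝ) + 3) * (Ca^2 * (2 * (1 + R^2)))
            * (2 ^ 1 * (1 + max (‖x‖^2 - R^2) 0 ^ (m + 2 + 1))) := by gcongr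
        _ = A₃ * wt (m + 3) R x := by rw [hA₃]; unfold wt posPow; ring
    linarith
  refine ⟨A + d * A + d * (A₂ + A₃), by positivity, fun c t ht x => ?_⟩
  set E := Real.exp (c * (T - t)) with hE
  have hE0 : 0 < E := Real.exp_pos _
  have hslice : expWt (n := n) T (m + 3) R c t = fun x => E * wt (m + 3) R x := rfl
  have hw := (contDiff_wt (n := n) m R)
  have hdw : Differentiable ℝ (wt (n := n) (m + 3) R) := hw.differentiable (by norm_num)
  have hdw2 : Differentiable ℝ (fderiv ℝ (wt (n := n) (m + 3) R)) :=
    (hw.fderiv_right (m := 1) (by norm_num)).differentiable (by norm_num)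
  have f1 : fderiv ℝ (expWt (n := n) T (m + 3) R c t) =
      fun x => E • fderiv ℝ (wt (m + 3) R) x := by
    rw [hslice]
    exact funext fun x => fderiv_const_mul (hdw x) E
  have f2 : fderiv ℝ (fderiv ℝ (expWt (n := n) T (m + 3) R c t)) x =
      E • fderiv ℝ (fderiv ℝ (wt (m + 3) R)) x := by
    rw [f1]
    exact fderiv_const_smul (hdw2 x) E
  have hptd : ptd (expWt T (m + 3) R c) t x = -c * expWt T (m + 3) R c t x := by
    have h1 : HasDerivAt (fun s => c * (T - s)) (-c) t := by
      simpa using ((hasDerivAt_id t).const_sub T).const_mul c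
    have h2 := (h1.exp.mul_const (wt (m + 3) R x)).deriv
    unfold ptd expWt
    rw [h2]; ring
  have hw0 := wt_pos (m + 3) R x
  have ha : ‖a t x‖ ≤ Ca * (1 + ‖x‖) := by
    have : 0 ≤ frob (σm t x) := Real.sqrt_nonneg _
    linarith [hg t ht x]
  have hs : ∀ k, ‖colVec (σm t x) k‖ ≤ Ca * (1 + ‖x‖) := fun k => by
    have := norm_colVec_le (σm t x) k
    linarith [hg t ht x, norm_nonneg (a t x)]
  have heW : expWt T (m + 3) R c t x = E * wt (m + 3) R x := rfl
  constructor
  · rw [parOp, genL_eq_fderiv ((isTest_expWt T m R c).slice t), hptd, f2, f1]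
    simp only [_root_.smul_apply, smul_eq_mul, ← Finset.mul_sum]
    have g1 := key1 x _ ha
    have g2 : |∑ k, fderiv ℝ (fderiv ℝ (wt (m + 3) R)) x (colVec (σm t x) k) (colVec (σm t x) k)|
        ≤ d * ((A₂ + A₃) * wt (m + 3) R x) := by
      refine (Finset.abs_sum_le_sum_abs _ _).trans ?_
      refine (Finset.sum_le_sum fun k _ => key2 x _ (hs k)).trans ?_
      simp
    set S := ∑ k, fderiv ℝ (fderiv ℝ (wt (m + 3) R)) x (colVec (σm t x) k) (colVec (σm t x) k)
    rw [show ∀ q F : ℝ, -c * q + (E * F + 1/2 * (E * S)) + c * q = E * (F + 1/2 * S) from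
      fun q F => by ring, abs_mul, abs_of_pos hE0, heW, mul_left_comm]
    gcongr
    refine (abs_add_le _ _).trans ?_
    rw [abs_mul, abs_of_pos (by norm_num : (0:ℝ) < 1/2)]
    have : 0 ≤ (d:ℝ) * A * wt (m + 3) R x := by positivity
    have : 0 ≤ (d:ℝ) * (A₂ + A₃) * wt (m + 3) R x := by positivity
    nlinarith
  · have hk : ∀ k, |sigGrad σm (expWt T (m + 3) R c) t x k| ≤ A * expWt T (m + 3) R c t x := by
      intro k
      rw [sigGrad_apply, f1, heW]
      simp only [_root_.smul_apply, smul_eq_mul]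
      rw [abs_mul, abs_of_pos hE0, mul_left_comm]
      gcongr
      exact key1 x _ (hs k)
    have h1 : ‖sigGrad σm (expWt T (m + 3) R c) t x‖ ≤ ∑ k : Fin d, A * expWt T (m + 3) R c t x := by
      conv_lhs => rw [← sum_smul_single (sigGrad σm (expWt T (m + 3) R c) t x)]
      refine (norm_sum_le _ _).trans (Finset.sum_le_sum fun k _ => ?_)
      rw [norm_smul, EuclideanSpace.single, PiLp.norm_single, norm_one, mul_one]
      exact hk k
    simp only [Finset.sum_const, Finset.card_univ, Fintype.card_fin, nsmul_eq_mul] at h1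
    refine h1.trans ?_
    have := (expWt_pos T (m + 3) R c t x).le
    have : 0 ≤ A * expWt T (m + 3) R c t x := by positivity
    have : 0 ≤ (d:ℝ) * (A₂ + A₃) * expWt T (m + 3) R c t x := by positivity
    nlinarith

lemma exists_growth_le_wt {ρ : ℝ} (hρ : 0 ≤ ρ) {m : ℕ} (hm : ρ ≤ 2 * m) (R : ℝ) :
    ∃ C > 0, ∀ x : En n, 1 + ‖x‖ ^ ρ ≤ C * wt m R x := by
  refine ⟨2 * ((2 * (1 + R^2)) ^ m * 2 ^ m), by positivity, fun x => ?_⟩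
  have hx := norm_nonneg x
  have h1 : ‖x‖ ^ ρ ≤ (1 + ‖x‖) ^ ρ := Real.rpow_le_rpow hx (by linarith) hρ
  have h2 : (1:ℝ) ≤ (1 + ‖x‖) ^ ρ := Real.one_le_rpow (by linarith) hρ
  have h3 : (1 + ‖x‖) ^ ρ ≤ (1 + ‖x‖) ^ ((2 * m : ℕ) : ℝ) :=
    Real.rpow_le_rpow_of_exponent_le (by linarith) (by push_cast; exact hm)
  rw [Real.rpow_natCast, pow_mul] at h3
  have h4 : ((1 + ‖x‖)^2)^m ≤ (2 * (1 + R^2)) ^ m * (2 ^ m * wt m R x) := by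
    calc ((1 + ‖x‖)^2)^m ≤ (2 * (1 + R^2) * (1 + max (‖x‖^2 - R^2) 0))^m := by
          gcongr; exact one_add_norm_sq_le R x
      _ = (2 * (1 + R^2)) ^ m * (max (‖x‖^2 - R^2) 0 ^ 0 * (1 + max (‖x‖^2 - R^2) 0)^m) := by
          rw [mul_pow, pow_zero, one_mul]
      _ ≤ _ := by
          refine mul_le_mul_of_nonneg_left ?_ (by positivity)
          refine (pow_mul_one_add_le (le_max_right _ _) 0 m).trans ?_
          rw [zero_add]
          rfl
  linarith

lemma wt_le_one_add (m : ℕ) (R : ℝ) (x : En n) : wt m R x ≤ 1 + ‖x‖ ^ (2 * m) := by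
  unfold wt posPow
  rw [pow_mul]
  gcongr
  exact max_le (by nlinarith [sq_nonneg R]) (by positivity)

lemma exists_mul_wt_le (m : ℕ) (R C : ℝ) (hC : 0 ≤ C) {ε : ℝ} (hε : 0 < ε) :
    ∃ r > 0, ∀ x : En n, r ≤ ‖x‖ → C * wt m R x ≤ ε * wt (m + 1) R x := by
  refine ⟨R^2 + 2 * C / ε + 1, by positivity, fun x hx => ?_⟩
  have h0 : 0 ≤ 2 * C / ε := by positivity
  have h1 : 2 * C / ε + 1 ≤ max (‖x‖^2 - R^2) 0 := by
    refine le_trans ?_ (le_max_left _ _)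
    nlinarith [sq_nonneg R]
  unfold wt posPow
  set Y := max (‖x‖^2 - R^2) 0
  have h2 : 1 ≤ Y ^ m := one_le_pow₀ (by linarith)
  have h3 : 2 * C ≤ ε * Y := by
    rw [div_add_one hε.ne', div_le_iff₀ hε] at h1
    nlinarith
  calc C * (1 + Y^m) ≤ C * (Y^m + Y^m) := by gcongr
    _ = (2 * C) * Y^m := by ring
    _ ≤ (ε * Y) * Y^m := by gcongr
    _ = ε * Y^(m+1) := by ring
    _ ≤ ε * (1 + Y^(m+1)) := by gcongr; linarith

end Weights

section Data

variable {n d : ℕ} {U : Type}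

/-- The data of a quasi-variational inequality with its standing assumptions. -/
structure QVIData (n d : ℕ) (U : Type) [MetricSpace U] where
  /-- time horizon -/
  T : ℝ
  /-- jump map -/
  Γ : ℝ → En n → U → En n
  /-- intervention cost -/
  ℓ : ℝ → En n → U → ℝ
  /-- drift -/
  a : ℝ → En n → En n
  /-- diffusion -/
  σ : ℝ → En n → Matrix (Fin n) (Fin d) ℝ
  /-- radius in the bound on jumps -/
  K : ℝ
  /-- lower bound of the cost -/
  δ : ℝ
  /-- linear growth constant -/
  Ca : ℝ
  /-- Lipschitz constant -/
  ka : ℝ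
  hT : 0 < T
  hK : 0 < K
  hδ : 0 < δ
  hCa : 0 < Ca
  hka : 0 < ka
  hΓc : ContinuousOn (fun p : ℝ × En n × U => Γ p.1 p.2.1 p.2.2)
      (Icc 0 T ×ˢ (univ : Set (En n × U)))
  hΓb : ∀ t ∈ Icc (0:ℝ) T, ∀ (x : En n) (b : U), ‖Γ t x b‖ ≤ max K ‖x‖
  hℓc : ContinuousOn (fun p : ℝ × En n × U => ℓ p.1 p.2.1 p.2.2)
      (Icc 0 T ×ˢ (univ : Set (En n × U)))
  hℓlb : ∀ t ∈ Icc (0:ℝ) T, ∀ (x : En n) (b : U), δ ≤ ℓ t x b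
  hac : ContinuousOn (fun p : ℝ × En n => a p.1 p.2) (Strip n T)
  hσc : ContinuousOn (fun p : ℝ × En n => σ p.1 p.2) (Strip n T)
  haσg : ∀ t ∈ Icc (0:ℝ) T, ∀ x : En n, ‖a t x‖ + frob (σ t x) ≤ Ca * (1 + ‖x‖)
  haσLip : ∀ t ∈ Icc (0:ℝ) T, ∀ x x' : En n,
      ‖a t x - a t x'‖ + frob (σ t x - σ t x') ≤ ka * ‖x - x'‖

/-- Local drivers: continuous in `(t,x)` uniformly in `z`, and Lipschitz in `z`. -/
structure IsDriver (T k : ℝ) (g : ℝ → En n → Ed d → ℝ) : Prop where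
  cont : ∀ ε > (0:ℝ), ∀ p ∈ Strip n T, ∃ δ' > (0:ℝ), ∀ q ∈ Strip n T, dist q p ≤ δ' →
    ∀ z : Ed d, |g q.1 q.2 z - g p.1 p.2 z| ≤ ε
  lip : ∀ t ∈ Icc (0:ℝ) T, ∀ x : En n, ∀ z z' : Ed d, |g t x z' - g t x z| ≤ k * ‖z' - z‖

/-- Growth of order `wt m`. -/
def HasGrowth (T : ℝ) (m : ℕ) (R : ℝ) (u : ℝ → En n → ℝ) : Prop :=
  ∃ C, ∀ t ∈ Icc (0:ℝ) T, ∀ x : En n, |u t x| ≤ C * wt m R x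

namespace QVIData

variable [MetricSpace U] (𝒟 : QVIData n d U)

/-- The parabolic operator `∂_t + L`. -/
def P (φ : ℝ → En n → ℝ) (t : ℝ) (x : En n) : ℝ := parOp 𝒟.a 𝒟.σ φ t x

/-- `σᵀ∇φ`. -/
def G (φ : ℝ → En n → ℝ) (t : ℝ) (x : En n) : Ed d := sigGrad 𝒟.σ φ t x

variable {𝒟} {g : ℝ → En n → Ed d → ℝ} {ψ : En n → ℝ} {u v : ℝ → En n → ℝ}

lemma mem_strip {t : ℝ} (ht : t ∈ Icc 0 𝒟.T) (x : En n) : (t, x) ∈ Strip n 𝒟.T := ⟨ht, mem_univ x⟩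

lemma wt_Γ_le (m : ℕ) {t : ℝ} (ht : t ∈ Icc 0 𝒟.T) (x : En n) (b : U) :
    wt m 𝒟.K (𝒟.Γ t x b) ≤ wt m 𝒟.K x := wt_mono m 𝒟.hK.le (𝒟.hΓb t ht x b)

lemma bddAbove_M {m : ℕ} (hu : HasGrowth 𝒟.T m 𝒟.K u) {t : ℝ} (ht : t ∈ Icc 0 𝒟.T) (x : En n) :
    BddAbove (range fun b : U => u t (𝒟.Γ t x b) - 𝒟.ℓ t x b) := by
  obtain ⟨C, hC⟩ := hu
  have hC0 : 0 ≤ C := by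
    have h1 := (abs_nonneg _).trans (hC t ht 0)
    exact nonneg_of_mul_nonneg_left h1 (wt_pos _ _ _)
  refine ⟨C * wt m 𝒟.K x, ?_⟩
  rintro _ ⟨b, rfl⟩
  have h1 := (le_abs_self _).trans (hC t ht (𝒟.Γ t x b))
  have h2 := mul_le_mul_of_nonneg_left (wt_Γ_le (𝒟 := 𝒟) m ht x b) hC0
  have h3 := 𝒟.hℓlb t ht x b
  have := 𝒟.hδ
  dsimp only
  linarith

lemma tendsto_Γ {p : ℝ × En n} (hp : p ∈ Strip n 𝒟.T) (b : U) :
    Tendsto (fun q : (ℝ × En n) × U => ((q.1.1, 𝒟.Γ q.1.1 q.1.2 q.2) : ℝ × En n))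
      (𝓝[Strip n 𝒟.T] p ×ˢ 𝓝 b) (𝓝[Strip n 𝒟.T] (p.1, 𝒟.Γ p.1 p.2 b)) ∧
    Tendsto (fun q : (ℝ × En n) × U => 𝒟.ℓ q.1.1 q.1.2 q.2)
      (𝓝[Strip n 𝒟.T] p ×ˢ 𝓝 b) (𝓝 (𝒟.ℓ p.1 p.2 b)) := by
  have hmem : ((p.1, p.2, b) : ℝ × En n × U) ∈ Icc 0 𝒟.T ×ˢ (univ : Set (En n × U)) :=
    ⟨hp.1, mem_univ _⟩
  have hmap : Tendsto (fun q : (ℝ × En n) × U => ((q.1.1, q.1.2, q.2) : ℝ × En n × U))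
      (𝓝[Strip n 𝒟.T] p ×ˢ 𝓝 b)
      (𝓝[Icc 0 𝒟.T ×ˢ (univ : Set (En n × U))] (p.1, p.2, b)) := by
    refine tendsto_nhdsWithin_of_tendsto_nhds_of_eventually_within _ ?_ ?_
    · have hc : Continuous (fun q : (ℝ × En n) × U => ((q.1.1, q.1.2, q.2) : ℝ × En n × U)) := by
        fun_prop
      have := hc.tendsto (p, b)
      rw [nhds_prod_eq] at this
      exact this.mono_left (Filter.prod_mono nhdsWithin_le_nhds le_rfl)
    · have : ∀ᶠ q : ℝ × En n in 𝓝[Strip n 𝒟.T] p, q ∈ Strip n 𝒟.T := self_mem_nhdsWithin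
      filter_upwards [this.prod_inl (𝓝 b)] with q hq
      exact ⟨hq.1, mem_univ _⟩
  constructor
  · refine tendsto_nhdsWithin_of_tendsto_nhds_of_eventually_within _ ?_ ?_
    · refine Tendsto.prodMk_nhds ?_ ((𝒟.hΓc _ hmem).tendsto.comp hmap)
      exact (continuous_fst.tendsto p).comp (tendsto_fst.mono_right nhdsWithin_le_nhds)
    · have : ∀ᶠ q : ℝ × En n in 𝓝[Strip n 𝒟.T] p, q ∈ Strip n 𝒟.T := self_mem_nhdsWithin
      filter_upwards [this.prod_inl (𝓝 b)] with q hq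
      exact ⟨hq.1, mem_univ _⟩
  · exact (𝒟.hℓc _ hmem).tendsto.comp hmap

lemma eventually_jump_lt
    (hl : UpperSemicontinuousOn (fun p : ℝ × En n => u p.1 p.2) (Strip n 𝒟.T))
    {p : ℝ × En n} (hp : p ∈ Strip n 𝒟.T) {b : U} {c : ℝ}
    (h : u p.1 (𝒟.Γ p.1 p.2 b) - 𝒟.ℓ p.1 p.2 b < c) :
    ∀ᶠ q : (ℝ × En n) × U in 𝓝[Strip n 𝒟.T] p ×ˢ 𝓝 b,
      u q.1.1 (𝒟.Γ q.1.1 q.1.2 q.2) - 𝒟.ℓ q.1.1 q.1.2 q.2 < c := by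
  obtain ⟨h1, h2⟩ := tendsto_Γ (𝒟 := 𝒟) hp b
  set ε := (c - (u p.1 (𝒟.Γ p.1 p.2 b) - 𝒟.ℓ p.1 p.2 b)) / 2 with hε
  have hmem : ((p.1, 𝒟.Γ p.1 p.2 b) : ℝ × En n) ∈ Strip n 𝒟.T := ⟨hp.1, mem_univ _⟩
  have e1 := h1.eventually
    (hl _ hmem (u p.1 (𝒟.Γ p.1 p.2 b) + ε) (by dsimp only; linarith))
  have e2 := h2.eventually (lt_mem_nhds (show 𝒟.ℓ p.1 p.2 b - ε < _ by linarith))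
  filter_upwards [e1, e2] with q q1 q2
  linarith

variable [Nonempty U]

variable (𝒟) in

/-- The intervention operator. -/
def M (v : ℝ → En n → ℝ) (t : ℝ) (x : En n) : ℝ := Mop 𝒟.Γ 𝒟.ℓ v t x

variable (𝒟) in
/-- Viscosity subsolutions with a local driver. -/
def Sub (g : ℝ → En n → Ed d → ℝ) (ψ : En n → ℝ) (u : ℝ → En n → ℝ) : Prop :=
  IsSub 𝒟.T 𝒟.Γ 𝒟.ℓ 𝒟.a 𝒟.σ (fun t x _ z => g t x z) ψ u

variable (𝒟) in
/-- Viscosity supersolutions with a local driver. -/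
def Super (g : ℝ → En n → Ed d → ℝ) (ψ : En n → ℝ) (u : ℝ → En n → ℝ) : Prop :=
  IsSuper 𝒟.T 𝒟.Γ 𝒟.ℓ 𝒟.a 𝒟.σ (fun t x _ z => g t x z) ψ u

lemma sub_iff : 𝒟.Sub g ψ u ↔
    UpperSemicontinuousOn (fun p : ℝ × En n => u p.1 p.2) (Strip n 𝒟.T) ∧
    (∀ x : En n, u 𝒟.T x ≤ ψ x) ∧
    ∀ t ∈ Ico (0:ℝ) 𝒟.T, ∀ x : En n, ∀ φ : ℝ → En n → ℝ, IsTest φ → φ t x = u t x →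
      IsLocalMinOn (fun p : ℝ × En n => φ p.1 p.2 - u p.1 p.2) (Strip n 𝒟.T) (t, x) →
      𝒟.M u t x < u t x → 0 ≤ 𝒟.P φ t x + g t x (𝒟.G φ t x) := by
  unfold Sub IsSub
  refine and_congr_right fun _ => and_congr_right fun _ => ?_
  refine forall₅_congr fun t ht x φ hφ => forall₂_congr fun he hm => ?_
  rw [min_le_iff]
  change (u t x - 𝒟.M u t x ≤ 0 ∨ _ - _ - g t x (𝒟.G φ t x) ≤ 0) ↔ _
  have e : 𝒟.P φ t x = ptd φ t x + genL 𝒟.a 𝒟.σ φ t x := rfl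
  constructor
  · rintro (h | h) h'
    · linarith
    · linarith
  · intro h
    by_cases h' : 𝒟.M u t x < u t x
    · right; linarith [h h']
    · left; linarith [not_lt.1 h']

lemma super_iff : 𝒟.Super g ψ v ↔
    LowerSemicontinuousOn (fun p : ℝ × En n => v p.1 p.2) (Strip n 𝒟.T) ∧
    (∀ x : En n, ψ x ≤ v 𝒟.T x) ∧
    ∀ t ∈ Ico (0:ℝ) 𝒟.T, ∀ x : En n, ∀ φ : ℝ → En n → ℝ, IsTest φ → φ t x = v t x →
      IsLocalMaxOn (fun p : ℝ × En n => φ p.1 p.2 - v p.1 p.2) (Strip n 𝒟.T) (t, x) →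
      𝒟.M v t x ≤ v t x ∧ 𝒟.P φ t x + g t x (𝒟.G φ t x) ≤ 0 := by
  unfold Super IsSuper
  refine and_congr_right fun _ => and_congr_right fun _ => ?_
  refine forall₅_congr fun t ht x φ hφ => forall₂_congr fun he hm => ?_
  rw [le_min_iff]
  change (0 ≤ v t x - 𝒟.M v t x ∧ 0 ≤ _ - _ - g t x (𝒟.G φ t x)) ↔ _
  have e : 𝒟.P φ t x = ptd φ t x + genL 𝒟.a 𝒟.σ φ t x := rfl
  refine and_congr ?_ ?_ <;> constructor <;> intro h <;> linarith

lemma Sub.usc (h : 𝒟.Sub g ψ u) :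
    UpperSemicontinuousOn (fun p : ℝ × En n => u p.1 p.2) (Strip n 𝒟.T) := h.1

lemma Super.lsc (h : 𝒟.Super g ψ v) :
    LowerSemicontinuousOn (fun p : ℝ × En n => v p.1 p.2) (Strip n 𝒟.T) := h.1

lemma Sub.terminal (h : 𝒟.Sub g ψ u) (x : En n) : u 𝒟.T x ≤ ψ x := h.2.1 x

lemma Super.terminal (h : 𝒟.Super g ψ v) (x : En n) : ψ x ≤ v 𝒟.T x := h.2.1 x

lemma Sub.le_of_jet (h : 𝒟.Sub g ψ u) {t : ℝ} (ht : t ∈ Ico 0 𝒟.T) {x : En n}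
    {φ : ℝ → En n → ℝ} (hφ : IsTest φ) (l : ℝ × En n →L[ℝ] ℝ)
    (B : ℝ × En n →L[ℝ] ℝ × En n →L[ℝ] ℝ)
    (hm : ∀ᶠ p in 𝓝[Strip n 𝒟.T] (t, x), u p.1 p.2 - φ p.1 p.2 ≤ u t x - φ t x
      + l (p - (t, x)) + 1/2 * B (p - (t, x)) (p - (t, x)))
    (hM : 𝒟.M u t x < u t x) :
    0 ≤ 𝒟.P φ t x + jetOp (𝒟.a t x) (𝒟.σ t x) l B
      + g t x (𝒟.G φ t x + jetGrad (𝒟.σ t x) l) := by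
  have hq := isTest_quadPoly t x (u t x - φ t x) l B
  have key := (sub_iff.1 h).2.2 t ht x _ (hφ.add hq) (by simp [quadPoly]) ?_ hM
  · rw [P, G, hφ.parOp_add hq, hφ.sigGrad_add hq, parOp_quadPoly, sigGrad_quadPoly] at key
    exact key
  · filter_upwards [hm] with p hp
    simp only [quadPoly]
    simp
    simp at hp
    linarith

lemma Super.le_of_jet (h : 𝒟.Super g ψ v) {t : ℝ} (ht : t ∈ Ico 0 𝒟.T) {x : En n}
    {φ : ℝ → En n → ℝ} (hφ : IsTest φ) (l : ℝ × En n →L[ℝ] ℝ)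
    (B : ℝ × En n →L[ℝ] ℝ × En n →L[ℝ] ℝ)
    (hm : ∀ᶠ p in 𝓝[Strip n 𝒟.T] (t, x), v t x - φ t x
      + l (p - (t, x)) + 1/2 * B (p - (t, x)) (p - (t, x)) ≤ v p.1 p.2 - φ p.1 p.2) :
    𝒟.M v t x ≤ v t x ∧ 𝒟.P φ t x + jetOp (𝒟.a t x) (𝒟.σ t x) l B
      + g t x (𝒟.G φ t x + jetGrad (𝒟.σ t x) l) ≤ 0 := by
  have hq := isTest_quadPoly t x (v t x - φ t x) l B
  have key := (super_iff.1 h).2.2 t ht x _ (hφ.add hq) (by simp [quadPoly]) ?_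
  · rw [P, G, hφ.parOp_add hq, hφ.sigGrad_add hq, parOp_quadPoly, sigGrad_quadPoly] at key
    exact key
  · filter_upwards [hm] with p hp
    simp only [quadPoly]
    simp
    simp at hp
    linarith

lemma Sub.le_of_test (h : 𝒟.Sub g ψ u) {t : ℝ} (ht : t ∈ Ico 0 𝒟.T) {x : En n}
    {φ : ℝ → En n → ℝ} (hφ : IsTest φ)
    (hm : ∀ᶠ p in 𝓝[Strip n 𝒟.T] (t, x), u p.1 p.2 - φ p.1 p.2 ≤ u t x - φ t x)
    (hM : 𝒟.M u t x < u t x) : 0 ≤ 𝒟.P φ t x + g t x (𝒟.G φ t x) := by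
  simpa [jetOp, jetGrad, ← Pi.zero_def] using h.le_of_jet ht hφ 0 0 (by simpa using hm) hM

lemma Super.le_of_test (h : 𝒟.Super g ψ v) {t : ℝ} (ht : t ∈ Ico 0 𝒟.T) {x : En n}
    {φ : ℝ → En n → ℝ} (hφ : IsTest φ)
    (hm : ∀ᶠ p in 𝓝[Strip n 𝒟.T] (t, x), v t x - φ t x ≤ v p.1 p.2 - φ p.1 p.2) :
    𝒟.M v t x ≤ v t x ∧ 𝒟.P φ t x + g t x (𝒟.G φ t x) ≤ 0 := by
  simpa [jetOp, jetGrad, ← Pi.zero_def] using h.le_of_jet ht hφ 0 0 (by simpa using hm)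

/-! Properties of the intervention operator. -/

lemma le_M {m : ℕ} (hu : HasGrowth 𝒟.T m 𝒟.K u) {t : ℝ} (ht : t ∈ Icc 0 𝒟.T) (x : En n) (b : U) :
    u t (𝒟.Γ t x b) - 𝒟.ℓ t x b ≤ 𝒟.M u t x :=
  le_ciSup (bddAbove_M hu ht x) b

lemma M_le {t : ℝ} {x : En n} {c : ℝ} (h : ∀ b, u t (𝒟.Γ t x b) - 𝒟.ℓ t x b ≤ c) :
    𝒟.M u t x ≤ c := ciSup_le h

lemma exists_of_lt_M {t : ℝ} {x : En n} {c : ℝ} (h : c < 𝒟.M u t x) :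
    ∃ b, c < u t (𝒟.Γ t x b) - 𝒟.ℓ t x b := exists_lt_of_lt_ciSup h

lemma M_mono {m : ℕ} (hv : HasGrowth 𝒟.T m 𝒟.K v) {t : ℝ} (ht : t ∈ Icc 0 𝒟.T) (x : En n)
    (h : ∀ y, u t y ≤ v t y) : 𝒟.M u t x ≤ 𝒟.M v t x :=
  M_le fun b => (sub_le_sub_right (h _) _).trans (le_M hv ht x b)

lemma lsc_M {m : ℕ} (hv : HasGrowth 𝒟.T m 𝒟.K v)
    (hl : LowerSemicontinuousOn (fun p : ℝ × En n => v p.1 p.2) (Strip n 𝒟.T)) :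
    LowerSemicontinuousOn (fun p : ℝ × En n => 𝒟.M v p.1 p.2) (Strip n 𝒟.T) := by
  intro p hp c hc
  obtain ⟨b, hb⟩ := exists_of_lt_M hc
  have hpure : Tendsto (fun q : ℝ × En n => (q, b)) (𝓝[Strip n 𝒟.T] p)
      (𝓝[Strip n 𝒟.T] p ×ˢ 𝓝 b) := tendsto_id.prodMk (tendsto_const_nhds)
  obtain ⟨h1, h2⟩ := tendsto_Γ (𝒟 := 𝒟) hp b
  set ε := (v p.1 (𝒟.Γ p.1 p.2 b) - 𝒟.ℓ p.1 p.2 b - c) / 2 with hε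
  have hmem : ((p.1, 𝒟.Γ p.1 p.2 b) : ℝ × En n) ∈ Strip n 𝒟.T := ⟨hp.1, mem_univ _⟩
  have e1 := (h1.comp hpure).eventually
    (hl _ hmem (v p.1 (𝒟.Γ p.1 p.2 b) - ε) (by dsimp only; linarith))
  have e2 := (h2.comp hpure).eventually (gt_mem_nhds (show _ < 𝒟.ℓ p.1 p.2 b + ε by linarith))
  have e3 : ∀ᶠ q : ℝ × En n in 𝓝[Strip n 𝒟.T] p, q ∈ Strip n 𝒟.T := self_mem_nhdsWithin
  filter_upwards [e1, e2, e3] with q q1 q2 q3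
  have := le_M hv q3.1 q.2 b
  dsimp at q1 q2
  linarith

lemma exists_max_M [CompactSpace U]
    (hl : UpperSemicontinuousOn (fun p : ℝ × En n => u p.1 p.2) (Strip n 𝒟.T))
    {t : ℝ} (ht : t ∈ Icc 0 𝒟.T) (x : En n) :
    ∃ b, 𝒟.M u t x = u t (𝒟.Γ t x b) - 𝒟.ℓ t x b ∧
      ∀ b', u t (𝒟.Γ t x b') - 𝒟.ℓ t x b' ≤ u t (𝒟.Γ t x b) - 𝒟.ℓ t x b := by
  have hmem : ((t, x) : ℝ × En n) ∈ Strip n 𝒟.T := ⟨ht, mem_univ _⟩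
  have husc : UpperSemicontinuousOn (fun b : U => u t (𝒟.Γ t x b) - 𝒟.ℓ t x b) univ := by
    intro b _ c hc
    have := eventually_jump_lt hl hmem hc
    have hpure : Tendsto (fun b : U => (((t, x) : ℝ × En n), b)) (𝓝[univ] b)
        (𝓝[Strip n 𝒟.T] (t, x) ×ˢ 𝓝 b) := by
      refine Tendsto.prodMk ?_ (tendsto_id.mono_left nhdsWithin_le_nhds)
      exact tendsto_nhdsWithin_of_tendsto_nhds_of_eventually_within _ tendsto_const_nhds
        (Eventually.of_forall fun _ => hmem)
    exact hpure.eventually this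
  obtain ⟨b, -, hb⟩ := husc.exists_isMaxOn univ_nonempty isCompact_univ
  refine ⟨b, le_antisymm (M_le fun b' => hb (mem_univ b')) ?_, fun b' => hb (mem_univ b')⟩
  exact le_ciSup (f := fun b : U => u t (𝒟.Γ t x b) - 𝒟.ℓ t x b)
    ⟨_, by rintro _ ⟨b', rfl⟩; exact hb (mem_univ b')⟩ b

lemma usc_M [CompactSpace U]
    (hl : UpperSemicontinuousOn (fun p : ℝ × En n => u p.1 p.2) (Strip n 𝒟.T)) :
    UpperSemicontinuousOn (fun p : ℝ × En n => 𝒟.M u p.1 p.2) (Strip n 𝒟.T) := by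
  intro p hp c hc
  obtain ⟨b, hb, hb'⟩ := exists_max_M hl hp.1 p.2
  have h1 : ∀ b' ∈ (univ : Set U), {q : (ℝ × En n) × U |
      u q.1.1 (𝒟.Γ q.1.1 q.1.2 q.2) - 𝒟.ℓ q.1.1 q.1.2 q.2 < c} ∈ 𝓝[Strip n 𝒟.T] p ×ˢ 𝓝 b' :=
    fun b' _ => eventually_jump_lt hl hp ((hb' b').trans_lt (hb ▸ hc))
  have h2 := isCompact_univ.mem_prod_nhdsSet_of_forall h1
  rw [nhdsSet_univ, mem_prod_top] at h2
  filter_upwards [h2, self_mem_nhdsWithin] with q hq hq'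
  obtain ⟨b', hb', -⟩ := exists_max_M hl (x := q.2) hq'.1
  exact hb'.trans_lt (hq b')

lemma dist_sq_le_sqDist (p q : ℝ × En n) : dist p q ^ 2 ≤ sqDist q.1 q.2 p.1 p.2 := by
  rw [Prod.dist_eq, sqDist, Real.dist_eq, dist_eq_norm]
  rcases le_total |p.1 - q.1| ‖p.2 - q.2‖ with h | h
  · rw [max_eq_right h]; nlinarith [sq_nonneg (p.1 - q.1)]
  · rw [max_eq_left h, sq_abs]; nlinarith [sq_nonneg ‖p.2 - q.2‖]

lemma isCompact_strip_inter (T : ℝ) (p : ℝ × En n) (r : ℝ) :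
    IsCompact (Strip n T ∩ Metric.closedBall p r) :=
  (isCompact_closedBall p r).inter_left (isClosed_Icc.prod isClosed_univ)

lemma nhdsWithin_strip_inter {T : ℝ} {p q : ℝ × En n} {r : ℝ} (h : dist q p < r) :
    𝓝[Strip n T ∩ Metric.closedBall p r] q = 𝓝[Strip n T] q :=
  nhdsWithin_inter_of_mem' (mem_nhdsWithin_of_mem_nhds
    (Metric.closedBall_mem_nhds_of_mem (Metric.mem_ball.2 h)))

lemma Super.M_le {m : ℕ} (h : 𝒟.Super g ψ v) (hv : HasGrowth 𝒟.T m 𝒟.K v) {t : ℝ}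
    (ht : t ∈ Ico 0 𝒟.T) (x : En n) : 𝒟.M v t x ≤ v t x := by
  by_contra! hlt
  have hmem : ((t, x) : ℝ × En n) ∈ Strip n 𝒟.T := ⟨⟨ht.1, ht.2.le⟩, mem_univ _⟩
  have e1 := lsc_M hv h.lsc _ hmem _ hlt
  have e2 := h.lsc _ hmem (v t x - 1) (by simp)
  have e3 : ∀ᶠ q : ℝ × En n in 𝓝[Strip n 𝒟.T] (t, x), q.1 < 𝒟.T :=
    (continuous_fst.continuousAt.eventually (gt_mem_nhds ht.2)).filter_mono nhdsWithin_le_nhds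
  obtain ⟨r, hr, hball⟩ := (nhdsWithin_hasBasis Metric.nhds_basis_closedBall _).eventually_iff.1
    ((e1.and e2).and e3)
  set j : ℝ := 2 / r^2 with hj
  have hlsc : LowerSemicontinuousOn
      (fun p : ℝ × En n => v p.1 p.2 + j * sqDist t x p.1 p.2)
      (Strip n 𝒟.T ∩ Metric.closedBall (t, x) r) := by
    refine (h.lsc.mono inter_subset_left).add ?_
    exact ((isTest_sqDist t x).continuous.const_mul j).continuousOn.lowerSemicontinuousOn
  have hmem' : ((t, x) : ℝ × En n) ∈ Strip n 𝒟.T ∩ Metric.closedBall (t, x) r :=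
    ⟨hmem, Metric.mem_closedBall_self hr.le⟩
  obtain ⟨p, hp, hmin⟩ := hlsc.exists_isMinOn ⟨_, hmem'⟩ (isCompact_strip_inter _ _ _)
  have h1 := isMinOn_iff.1 hmin (t, x) hmem'
  simp only [sqDist_self, mul_zero, add_zero] at h1
  obtain ⟨⟨h2, h3⟩, h4⟩ := hball ⟨hp.2, hp.1⟩
  dsimp only at h2 h3
  have hj0 : 0 < j := by positivity
  have h5 := dist_sq_le_sqDist p (t, x)
  have h6 : dist p (t, x) < r := by
    have : j * dist p (t, x) ^ 2 < 1 := by nlinarith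
    rw [hj, div_mul_eq_mul_div, div_lt_one (by positivity)] at this
    exact lt_of_pow_lt_pow_left₀ 2 hr.le (by nlinarith [sq_nonneg (dist p (t, x))])
  have hφ := (isTest_sqDist (n := n) t x).const_mul (-j)
  have key := (h.le_of_test (t := p.1) (x := p.2) ⟨hp.1.1.1, h4⟩ hφ ?_).1
  · have := mul_nonneg hj0.le (sqDist_nonneg t x p.1 p.2)
    linarith
  · rw [← nhdsWithin_strip_inter h6]
    filter_upwards [self_mem_nhdsWithin] with q hq
    have := isMinOn_iff.1 hmin q hq
    linarith

end QVIData

end Data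

section Doubling

open scoped RealInnerProductSpace

variable {n d : ℕ}

lemma exists_scaled_jets {H : Type*} [NormedAddCommGroup H] [InnerProductSpace ℝ H]
    [FiniteDimensional ℝ H] {E : Type*} [NormedAddCommGroup E] [NormedSpace ℝ E] (J : E ≃L[ℝ] H)
    {K : Set E} (hK : IsCompact K) {F G : E → ℝ} (hF : UpperSemicontinuousOn F K)
    (hG : LowerSemicontinuousOn G K) {p q : E} (hp : p ∈ K) (hq : q ∈ K)
    (hmax : ∀ p' ∈ K, ∀ q' ∈ K,
      F p' - G q' - 1/6 * ‖J p' - J q'‖^2 ≤ F p - G q - 1/6 * ‖J p - J q‖^2)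
    {η : ℝ} (hη : 0 < η) :
    ∃ p' ∈ K, ∃ q' ∈ K, ∃ (l₁ l₂ : E →L[ℝ] ℝ) (B₁ B₂ : E →L[ℝ] E →L[ℝ] ℝ),
      dist (J p') (J p) < η ∧ dist (J q') (J q) < η ∧ |F p' - F p| < η ∧ |G q' - G q| < η ∧
      (∀ w, |l₁ w - 1/3 * ⟪J p - J q, J w⟫| ≤ η * ‖J w‖) ∧
      (∀ w, |l₂ w - 1/3 * ⟪J p - J q, J w⟫| ≤ η * ‖J w‖) ∧
      (∀ᶠ P in 𝓝[K] p', F P ≤ F p' + l₁ (P - p') + 1/2 * B₁ (P - p') (P - p')) ∧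
      (∀ᶠ P in 𝓝[K] q', G q' + l₂ (P - q') + 1/2 * B₂ (P - q') (P - q') ≤ G P) ∧
      ∀ ξ ζ, B₁ ξ ξ - B₂ ζ ζ ≤ ‖J ξ - J ζ‖^2 + 3 * η * (‖J ξ‖^2 + ‖J ζ‖^2) := by
  have hK' : IsCompact (J '' K) := hK.image J.continuous
  have htend : ∀ x, Tendsto J.symm (𝓝[J '' K] (J x)) (𝓝[K] x) := by
    intro x
    refine tendsto_nhdsWithin_of_tendsto_nhds_of_eventually_within _ ?_ ?_
    · have := J.symm.continuous.tendsto (J x)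
      rw [J.symm_apply_apply] at this
      exact this.mono_left nhdsWithin_le_nhds
    · filter_upwards [self_mem_nhdsWithin] with y hy
      obtain ⟨x', hx', rfl⟩ := hy
      simpa using hx'
  have htend' : ∀ x, Tendsto J (𝓝[K] x) (𝓝[J '' K] (J x)) := fun x =>
    tendsto_nhdsWithin_of_tendsto_nhds_of_eventually_within _
      ((J.continuous.tendsto x).mono_left nhdsWithin_le_nhds)
      (by filter_upwards [self_mem_nhdsWithin] with y hy using mem_image_of_mem _ hy)
  have hF' : UpperSemicontinuousOn (fun R => F (J.symm R)) (J '' K) := by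
    rintro _ ⟨x, hx, rfl⟩ c hc
    simp only [J.symm_apply_apply] at hc
    exact (htend x).eventually (hF x hx c hc)
  have hG' : UpperSemicontinuousOn (fun R => -G (J.symm R)) (J '' K) := by
    rintro _ ⟨x, hx, rfl⟩ c hc
    simp only [J.symm_apply_apply] at hc
    filter_upwards [(htend x).eventually (hG x hx (-c) (by linarith))] with y hy
    linarith
  obtain ⟨_, ⟨p', hp', rfl⟩, _, ⟨q', hq', rfl⟩, g₁, g₂, D₁, D₂, h1, h2, h3, h4, h5, h6, h7, h8, h9⟩ :=
    exists_upper_jets_of_max hK' hK' hF' hG' (mem_image_of_mem J hp) (mem_image_of_mem J hq) (by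
      rintro _ ⟨p', hp', rfl⟩ _ ⟨q', hq', rfl⟩
      simpa [← sub_eq_add_neg] using hmax p' hp' q' hq') hη
  simp only [J.symm_apply_apply] at h3 h4 h7 h8
  set JL : E →L[ℝ] H := (J : E →L[ℝ] H) with hJL
  refine ⟨p', hp', q', hq', (innerSL ℝ g₁).comp JL, -(innerSL ℝ g₂).comp JL,
    (innerSL ℝ).bilinearComp ((D₁ + (2 * η) • ContinuousLinearMap.id ℝ H).comp JL) JL,
    -(innerSL ℝ).bilinearComp ((D₂ + (2 * η) • ContinuousLinearMap.id ℝ H).comp JL) JL,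
    h1, h2, h3, ?_, ?_, ?_, ?_, ?_, ?_⟩
  · rw [← abs_neg]; convert h4 using 2; ring
  · intro w
    have e : (innerSL ℝ g₁).comp JL w - 1/3 * ⟪J p - J q, J w⟫
        = ⟪g₁ - (1/3:ℝ) • (J p - J q), J w⟫ := by
      rw [inner_sub_left g₁, real_inner_smul_left]; rfl
    rw [e]
    exact (abs_real_inner_le_norm _ _).trans (by gcongr)
  · intro w
    have e : (-(innerSL ℝ g₂).comp JL) w - 1/3 * ⟪J p - J q, J w⟫
        = -⟪g₂ + (1/3:ℝ) • (J p - J q), J w⟫ := by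
      rw [inner_add_left g₂, real_inner_smul_left, neg_add]; rfl
    rw [e, abs_neg]
    exact (abs_real_inner_le_norm _ _).trans (by gcongr)
  · filter_upwards [(htend' p').eventually h7] with P hP
    rw [J.symm_apply_apply, ← map_sub] at hP
    simp only [ContinuousLinearMap.bilinearComp_apply, ContinuousLinearMap.comp_apply,
      _root_.add_apply, _root_.smul_apply, innerSL_apply_apply, ContinuousLinearMap.id_apply,
      inner_add_left, real_inner_smul_left, real_inner_self_eq_norm_sq]
    simp only [hJL, ContinuousLinearEquiv.coe_coe]
    linarith
  · filter_upwards [(htend' q').eventually h8] with P hP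
    rw [J.symm_apply_apply, ← map_sub] at hP
    simp only [ContinuousLinearMap.bilinearComp_apply, ContinuousLinearMap.comp_apply,
      _root_.add_apply, _root_.smul_apply, _root_.neg_apply, innerSL_apply_apply,
      ContinuousLinearMap.id_apply,
      inner_add_left, real_inner_smul_left, real_inner_self_eq_norm_sq]
    simp only [hJL, ContinuousLinearEquiv.coe_coe]
    linarith
  · intro ξ ζ
    have := h9 (J ξ) (J ζ)
    simp only [ContinuousLinearMap.bilinearComp_apply, ContinuousLinearMap.comp_apply,
      _root_.add_apply, _root_.smul_apply, _root_.neg_apply, innerSL_apply_apply,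
      ContinuousLinearMap.id_apply,
      inner_add_left, real_inner_smul_left, real_inner_self_eq_norm_sq]
    simp only [hJL, ContinuousLinearEquiv.coe_coe]
    linarith

/-- Near-optimal pairs for the doubled functional concentrate at a strict maximum. -/
lemma exists_doubling_radius {X : Type*} [MetricSpace X] {K : Set X} (hK : IsCompact K)
    {F G : X → ℝ} (hF : UpperSemicontinuousOn F K) (hG : LowerSemicontinuousOn G K) {z : X}
    (hz : z ∈ K) (hmax : ∀ p ∈ K, F z - G z ≤ F p - G p → p = z) {ε : ℝ} (hε : 0 < ε) :
    ∃ η > 0, ∀ p ∈ K, ∀ q ∈ K, dist p q ≤ η → F z - G z ≤ F p - G q →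
      dist p z < ε ∧ dist q z < ε ∧ |F p - F z| < ε ∧ |G q - G z| < ε ∧
      F p - G q < F z - G z + ε := by
  have e1 := hF z hz (F z + ε / 2) (by linarith)
  have e2 := hG z hz (G z - ε / 2) (by linarith)
  obtain ⟨ρ, hρ, hball⟩ := (nhdsWithin_hasBasis Metric.nhds_basis_ball _).eventually_iff.1
    (e1.and e2)
  set ρ' := min ρ ε with hρ'
  have hρ'0 : 0 < ρ' := lt_min hρ hε
  have hH : UpperSemicontinuousOn (fun x : X × X => F x.1 - G x.2) (K ×ˢ K) := by
    intro x hx c hc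
    set γ := (c - (F x.1 - G x.2)) / 2 with hγ
    have t1 : Tendsto Prod.fst (𝓝[K ×ˢ K] x) (𝓝[K] x.1) := by
      rw [nhdsWithin_prod_eq]; exact tendsto_fst
    have t2 : Tendsto Prod.snd (𝓝[K ×ˢ K] x) (𝓝[K] x.2) := by
      rw [nhdsWithin_prod_eq]; exact tendsto_snd
    dsimp only at hc
    filter_upwards [t1.eventually (hF x.1 hx.1 (F x.1 + γ) (by linarith)),
      t2.eventually (hG x.2 hx.2 (G x.2 - γ) (by linarith))] with y h1 h2
    linarith
  have hA : IsCompact ((K ×ˢ K ∩ (fun x : X × X => F x.1 - G x.2) ⁻¹' Ici (F z - G z)) ∩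
      {x | ρ' / 2 ≤ dist x.1 z}) :=
    (hH.isCompact_inter_preimage_Ici (hK.prod hK) _).inter_right
      (isClosed_le continuous_const (by fun_prop))
  obtain ⟨η, hη, hηA⟩ : ∃ η > 0, ∀ x ∈ (K ×ˢ K ∩ (fun x : X × X => F x.1 - G x.2) ⁻¹'
      Ici (F z - G z)) ∩ {x | ρ' / 2 ≤ dist x.1 z}, η < dist x.1 x.2 := by
    rcases Set.eq_empty_or_nonempty ((K ×ˢ K ∩ (fun x : X × X => F x.1 - G x.2) ⁻¹'
      Ici (F z - G z)) ∩ {x | ρ' / 2 ≤ dist x.1 z}) with h | h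
    · exact ⟨1, one_pos, by simp [h]⟩
    · obtain ⟨x, hx, hmin⟩ := hA.exists_isMinOn h
        (f := fun x : X × X => dist x.1 x.2) (by fun_prop)
      have hpos : 0 < dist x.1 x.2 := by
        rw [dist_pos]
        intro he
        have h1 := hx.1.2
        simp only [mem_preimage, mem_Ici, ← he] at h1
        have h2 := hmax x.1 hx.1.1.1 h1
        have h3 : ρ' / 2 ≤ dist x.1 z := hx.2
        rw [h2, dist_self] at h3
        linarith
      refine ⟨dist x.1 x.2 / 2, by positivity, fun y hy => ?_⟩
      have := isMinOn_iff.1 hmin y hy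
      linarith
  refine ⟨min η (ρ' / 3), by positivity, fun p hp q hq hd hle => ?_⟩
  have h1 : dist p z < ρ' / 2 := by
    by_contra! h
    have := hηA (p, q) ⟨⟨⟨hp, hq⟩, hle⟩, h⟩
    have := hd.trans (min_le_left _ _)
    linarith
  have h2 : dist q z < ρ' := by
    have := dist_triangle_left q z p
    have := hd.trans (min_le_right _ _)
    linarith
  have hr1 : ρ' ≤ ρ := min_le_left _ _
  have hr2 : ρ' ≤ ε := min_le_right _ _
  have h3 := (hball (x := p) ⟨by rw [Metric.mem_ball]; linarith, hp⟩).1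
  have h4 := (hball (x := q) ⟨by rw [Metric.mem_ball]; linarith, hq⟩).2
  refine ⟨by linarith, by linarith, ?_, ?_, by linarith⟩ <;>
  · rw [abs_lt]; constructor <;> linarith

/-- The weighted Euclidean structure on space-time. -/
lemma exists_weighted_equiv {α β : ℝ} (hα : 0 < α) (hβ : 0 < β) :
    ∃ J : (ℝ × En n) ≃L[ℝ] WithLp 2 (ℝ × En n), ∀ w w' : ℝ × En n,
      ⟪J w, J w'⟫ = β * (w.1 * w'.1) + α * ⟪w.2, w'.2⟫ := by
  refine ⟨(((LinearEquiv.smulOfNeZero ℝ ℝ (√β) (by positivity)).prodCongr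
    (LinearEquiv.smulOfNeZero ℝ (En n) (√α) (by positivity))).trans
    (WithLp.linearEquiv 2 ℝ (ℝ × En n)).symm).toContinuousLinearEquiv, fun w w' => ?_⟩
  simp [WithLp.prod_inner_apply, real_inner_smul_left, real_inner_smul_right]
  have h1 := Real.mul_self_sqrt hα.le
  have h2 := Real.mul_self_sqrt hβ.le
  linear_combination (w'.1 * w.1) * h2 + inner ℝ w.2 w'.2 * h1

lemma exists_doubled_jets_aux {K : Set (ℝ × En n)} (hK : IsCompact K) {F G : ℝ × En n → ℝ}
    (hF : UpperSemicontinuousOn F K) (hG : LowerSemicontinuousOn G K) {z : ℝ × En n}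
    (hz : z ∈ K) (hmax : ∀ p ∈ K, F z - G z ≤ F p - G p → p = z) {ε : ℝ} (hε : 0 < ε) :
    ∃ α, 1 ≤ α ∧ 1 / ε ≤ α ∧ ∀ ω > 0, ∀ e > 0, ∃ p ∈ K, ∃ q ∈ K, ∃ (ξ : En n) (b : ℝ)
      (l₁ l₂ : ℝ × En n →L[ℝ] ℝ) (B₁ B₂ : ℝ × En n →L[ℝ] ℝ × En n →L[ℝ] ℝ),
      dist p z < ε + e ∧ dist q z < ε + e ∧ |F p - F z| < ε + e ∧ |G q - G z| < ε + e ∧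
      |p.1 - q.1| ≤ ω ∧ ‖p.2 - q.2‖ ≤ ‖ξ‖ + e ∧ ‖ξ‖ ≤ ε ∧ α * ‖ξ‖^2 ≤ 6 * ε ∧
      (∀ᶠ P in 𝓝[K] p, F P ≤ F p + l₁ (P - p) + 1/2 * B₁ (P - p) (P - p)) ∧
      (∀ᶠ P in 𝓝[K] q, G q + l₂ (P - q) + 1/2 * B₂ (P - q) (P - q) ≤ G P) ∧
      (∀ w, |l₁ w - 1/3 * (b * w.1 + α * ⟪ξ, w.2⟫)| ≤ e * (|w.1| + ‖w.2‖)) ∧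
      (∀ w, |l₂ w - 1/3 * (b * w.1 + α * ⟪ξ, w.2⟫)| ≤ e * (|w.1| + ‖w.2‖)) ∧
      ∀ x y, B₁ (0, x) (0, x) - B₂ (0, y) (0, y) ≤ α * ‖x - y‖^2 + e * (‖x‖^2 + ‖y‖^2) := by
  obtain ⟨η, hη, hrad⟩ := exists_doubling_radius hK hF hG hz hmax hε
  obtain ⟨CF, hCF⟩ := hF.bddAbove_of_isCompact hK
  obtain ⟨CG, hCG⟩ := hG.bddBelow_of_isCompact hK
  set C := |CF - CG - (F z - G z)| + 1 with hC
  have hC0 : 0 < C := by positivity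
  have hCb : ∀ p ∈ K, ∀ q ∈ K, F p - G q - (F z - G z) ≤ C := fun p hp q hq => by
    have h1 : F p ≤ CF := hCF (mem_image_of_mem F hp)
    have h2 : CG ≤ G q := hCG (mem_image_of_mem G hq)
    have := le_abs_self (CF - CG - (F z - G z))
    linarith
  set η₁ := min η ε with hη₁
  have hη₁0 : 0 < η₁ := lt_min hη hε
  set α := max (max 1 (1/ε)) (6 * C / η₁^2) with hα
  have hα1 : 1 ≤ α := (le_max_left _ _).trans (le_max_left _ _)
  have hα3 : 6 * C ≤ α * η₁^2 := by
    rw [← div_le_iff₀ (by positivity)]; exact le_max_right _ _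
  refine ⟨α, hα1, (le_max_right _ _).trans (le_max_left _ _), fun ω hω e he => ?_⟩
  set η₂ := min (ω / 2) η₁ with hη₂
  have hη₂0 : 0 < η₂ := lt_min (by positivity) hη₁0
  set β := max 1 (6 * C / η₂^2) with hβ
  have hβ1 : 1 ≤ β := le_max_left _ _
  have hβ3 : 6 * C ≤ β * η₂^2 := by
    rw [← div_le_iff₀ (by positivity)]; exact le_max_right _ _
  have hα0 : 0 < α := by linarith
  have hβ0 : 0 < β := by linarith
  obtain ⟨J, hJ⟩ := exists_weighted_equiv (n := n) hα0 hβ0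
  have hJn : ∀ w, ‖J w‖^2 = β * w.1^2 + α * ‖w.2‖^2 := fun w => by
    rw [← real_inner_self_eq_norm_sq, hJ, real_inner_self_eq_norm_sq]; ring
  have hJ1 : ∀ w, |w.1| ≤ ‖J w‖ := fun w => by
    refine abs_le_of_sq_le_sq ?_ (norm_nonneg _)
    rw [hJn]
    nlinarith [sq_nonneg w.1, sq_nonneg ‖w.2‖]
  have hJ2 : ∀ w, ‖w.2‖ ≤ ‖J w‖ := fun w => by
    refine (pow_le_pow_iff_left₀ (norm_nonneg _) (norm_nonneg _) two_ne_zero).1 ?_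
    rw [hJn]
    nlinarith [sq_nonneg w.1, sq_nonneg ‖w.2‖]
  have hJ0 : ∀ w, ‖w‖ ≤ ‖J w‖ := fun w => max_le (hJ1 w) (hJ2 w)
  have hJ3 : ∀ w, ‖J w‖ ≤ (α + β) * (|w.1| + ‖w.2‖) := fun w => by
    refine (pow_le_pow_iff_left₀ (norm_nonneg _) (by positivity) two_ne_zero).1 ?_
    rw [hJn, ← sq_abs w.1]
    have h1 : α ≤ (α + β)^2 := by nlinarith
    have h2 : β ≤ (α + β)^2 := by nlinarith
    rw [mul_pow]
    nlinarith [mul_le_mul_of_nonneg_right h2 (sq_nonneg |w.1|),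
      mul_le_mul_of_nonneg_right h1 (sq_nonneg ‖w.2‖), mul_nonneg (abs_nonneg w.1) (norm_nonneg w.2),
      mul_nonneg (sq_nonneg (α+β)) (mul_nonneg (abs_nonneg w.1) (norm_nonneg w.2))]
  have hH : UpperSemicontinuousOn (fun x : (ℝ × En n) × (ℝ × En n) =>
      F x.1 - G x.2 - 1/6 * ‖J x.1 - J x.2‖^2) (K ×ˢ K) := by
    have h1 : UpperSemicontinuousOn (fun x : (ℝ × En n) × (ℝ × En n) => F x.1) (K ×ˢ K) :=
      fun x hx c hc => (show Tendsto Prod.fst (𝓝[K ×ˢ K] x) (𝓝[K] x.1) by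
        rw [nhdsWithin_prod_eq]; exact tendsto_fst).eventually (hF x.1 hx.1 c hc)
    have h2 : UpperSemicontinuousOn (fun x : (ℝ × En n) × (ℝ × En n) => -G x.2) (K ×ˢ K) :=
      fun x hx c hc => ((show Tendsto Prod.snd (𝓝[K ×ˢ K] x) (𝓝[K] x.2) by
        rw [nhdsWithin_prod_eq]; exact tendsto_snd).eventually
        (hG x.2 hx.2 (-c) (by dsimp only at hc; linarith))).mono fun y hy => by
          dsimp only; linarith
    have h3 : Continuous fun x : (ℝ × En n) × (ℝ × En n) => -(1/6 * ‖J x.1 - J x.2‖^2) := by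
      have := J.continuous
      fun_prop
    have := (h1.add h2).add h3.continuousOn.upperSemicontinuousOn
    simpa [sub_eq_add_neg] using this
  have hzK : ((z, z) : (ℝ × En n) × (ℝ × En n)) ∈ K ×ˢ K := ⟨hz, hz⟩
  obtain ⟨⟨p, q⟩, ⟨hp, hq⟩, hpq⟩ := hH.exists_isMaxOn ⟨_, hzK⟩ (hK.prod hK)
  have hpq' : ∀ p' ∈ K, ∀ q' ∈ K,
      F p' - G q' - 1/6 * ‖J p' - J q'‖^2 ≤ F p - G q - 1/6 * ‖J p - J q‖^2 :=
    fun p' hp' q' hq' => isMaxOn_iff.1 hpq (p', q') ⟨hp', hq'⟩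
  have hzz := hpq' z hz z hz
  rw [sub_self, norm_zero, ← map_sub, hJn] at hzz
  have hb := hCb p hp q hq
  have hτ : |(p - q).1| ≤ η₂ := by
    refine abs_le_of_sq_le_sq ?_ hη₂0.le
    refine le_of_mul_le_mul_left ?_ hβ0
    nlinarith [mul_nonneg hα0.le (sq_nonneg ‖(p - q).2‖)]
  have hξ : ‖(p - q).2‖ ≤ η₁ := by
    refine (pow_le_pow_iff_left₀ (norm_nonneg _) hη₁0.le two_ne_zero).1 ?_
    refine le_of_mul_le_mul_left ?_ hα0
    nlinarith [mul_nonneg hβ0.le (sq_nonneg (p - q).1)]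
  have hm1 : η₁ ≤ η := min_le_left _ _
  have hm2 : η₁ ≤ ε := min_le_right _ _
  have hm3 : η₂ ≤ ω / 2 := min_le_left _ _
  have hm4 : η₂ ≤ η₁ := min_le_right _ _
  have hpos1 := mul_nonneg hα0.le (sq_nonneg ‖(p - q).2‖)
  have hpos2 := mul_nonneg hβ0.le (sq_nonneg (p - q).1)
  obtain ⟨r1, r2, r3, r4, r5⟩ := hrad p hp q hq
    (by rw [dist_eq_norm]; exact max_le (hτ.trans (by linarith)) (by linarith)) (by linarith)
  set N := 1 + 3 * (α + β) + 3 * α + 2 + 4 / ω with hN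
  have hN0 : 0 < N := by positivity
  set η₃ := min e (e / N) with hη₃
  have hη₃0 : 0 < η₃ := by positivity
  have hNe : η₃ * N ≤ e := by
    rw [← le_div_iff₀ hN0]; exact min_le_right _ _
  set η₄ := min η₃ (ω / 4) with hη₄
  have hη₄0 : 0 < η₄ := by positivity
  have h43 : η₄ ≤ η₃ := min_le_left _ _
  have h4ω : η₄ ≤ ω / 4 := min_le_right _ _
  obtain ⟨p', hp', q', hq', l₁, l₂, B₁, B₂, d1, d2, d3, d4, d5, d6, d7, d8, d9⟩ :=
    exists_scaled_jets J hK hF hG hp hq hpq' hη₄0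
  have hη₄e : η₄ * N ≤ e := (mul_le_mul_of_nonneg_right h43 hN0.le).trans hNe
  have hω4 : 0 < 4 / ω := by positivity
  have hle : η₄ ≤ e := h43.trans (min_le_left _ _)
  have hle2 : 2 * η₄ ≤ e := by
    refine le_trans ?_ hη₄e
    rw [mul_comm]; exact mul_le_mul_of_nonneg_left (by linarith) hη₄0.le
  have hαβ : η₄ * (α + β) ≤ e := by
    refine le_trans ?_ hη₄e
    exact mul_le_mul_of_nonneg_left (by linarith) hη₄0.le
  have hα' : 3 * η₄ * α ≤ e := by
    refine le_trans ?_ hη₄e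
    rw [mul_comm 3, mul_assoc]
    exact mul_le_mul_of_nonneg_left (by linarith) hη₄0.le
  have dp : dist p' p < η₄ := by
    refine lt_of_le_of_lt ?_ d1
    rw [dist_eq_norm, dist_eq_norm, ← map_sub]; exact hJ0 _
  have dq : dist q' q < η₄ := by
    refine lt_of_le_of_lt ?_ d2
    rw [dist_eq_norm, dist_eq_norm, ← map_sub]; exact hJ0 _
  have dp1 : |p'.1 - p.1| < η₄ := lt_of_le_of_lt (le_max_left _ _) dp
  have dq1 : |q'.1 - q.1| < η₄ := lt_of_le_of_lt (le_max_left _ _) dq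
  have dp2 : dist p'.2 p.2 < η₄ := lt_of_le_of_lt (le_max_right _ _) dp
  have dq2 : dist q'.2 q.2 < η₄ := lt_of_le_of_lt (le_max_right _ _) dq
  have hin : ∀ w, ⟪J p - J q, J w⟫ = β * (p - q).1 * w.1 + α * ⟪(p - q).2, w.2⟫ := fun w => by
    rw [← map_sub, hJ, mul_assoc]
  have hbd : ∀ w, η₄ * ‖J w‖ ≤ e * (|w.1| + ‖w.2‖) := fun w => by
    calc η₄ * ‖J w‖ ≤ η₄ * ((α + β) * (|w.1| + ‖w.2‖)) :=
          mul_le_mul_of_nonneg_left (hJ3 w) hη₄0.le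
      _ = η₄ * (α + β) * (|w.1| + ‖w.2‖) := by ring
      _ ≤ _ := mul_le_mul_of_nonneg_right hαβ (by positivity)
  refine ⟨p', hp', q', hq', (p - q).2, β * (p - q).1, l₁, l₂, B₁, B₂, ?_, ?_, ?_, ?_, ?_, ?_, by linarith,
    by linarith, d7, d8, ?_, ?_, ?_⟩
  · linarith [dist_triangle p' p z]
  · linarith [dist_triangle q' q z]
  · have := abs_sub_le (F p') (F p) (F z)
    linarith
  · have := abs_sub_le (G q') (G q) (G z)
    linarith
  · have e1 : p'.1 - q'.1 = (p'.1 - p.1) + (p - q).1 - (q'.1 - q.1) := by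
      simp
    rw [e1]
    have h1 := abs_sub ((p'.1 - p.1) + (p - q).1) (q'.1 - q.1)
    have h2 := abs_add_le (p'.1 - p.1) ((p - q).1)
    linarith
  · have h1 := dist_triangle p'.2 p.2 q'.2
    have h2 := dist_triangle_right p.2 q'.2 q.2
    rw [← dist_eq_norm]
    have h3 : dist p.2 q.2 = ‖(p - q).2‖ := by rw [dist_eq_norm]; rfl
    linarith
  · intro w; rw [← hin]; exact (d5 w).trans (hbd w)
  · intro w; rw [← hin]; exact (d6 w).trans (hbd w)
  · intro x y
    have h1 := d9 (0, x) (0, y)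
    rw [← map_sub, hJn, hJn, hJn] at h1
    simp at h1
    have := mul_le_mul_of_nonneg_right hα' (show 0 ≤ ‖x‖^2+‖y‖^2 by positivity)
    linarith

end Doubling

section DoubledJets

open scoped RealInnerProductSpace

variable {n d : ℕ}

lemma frob_eq_norm (M : Matrix (Fin n) (Fin d) ℝ) :
    frob M = ‖(WithLp.toLp 2 (fun ij : Fin n × Fin d => M ij.1 ij.2) :
      EuclideanSpace ℝ (Fin n × Fin d))‖ := by
  rw [EuclideanSpace.norm_eq, frob, Fintype.sum_prod_type]
  simp

lemma frob_nonneg (M : Matrix (Fin n) (Fin d) ℝ) : 0 ≤ frob M := Real.sqrt_nonneg _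

lemma frob_sub_le (M N L : Matrix (Fin n) (Fin d) ℝ) :
    frob (M - L) ≤ frob (M - N) + frob (N - L) := by
  simp only [frob_eq_norm]
  refine le_trans (le_of_eq ?_) (norm_add_le _ _)
  congr 1
  ext ij
  simp

lemma sum_norm_colVec_sq (s : Matrix (Fin n) (Fin d) ℝ) : ∑ k, ‖colVec s k‖^2 = frob s^2 := by
  rw [frob, Real.sq_sqrt (by positivity), Finset.sum_comm]
  refine Finset.sum_congr rfl fun k _ => ?_
  rw [EuclideanSpace.norm_sq_eq]
  simp [colVec]

lemma colVec_sub (s s' : Matrix (Fin n) (Fin d) ℝ) (k : Fin d) :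
    colVec s k - colVec s' k = colVec (s - s') k := by
  ext i; simp [colVec]

lemma jetOp_sub_le {α b e : ℝ} (hα : 0 ≤ α) {ξ : En n} {l₁ l₂ : ℝ × En n →L[ℝ] ℝ}
    {B₁ B₂ : ℝ × En n →L[ℝ] ℝ × En n →L[ℝ] ℝ}
    (h₁ : ∀ w, |l₁ w - 1/3 * (b * w.1 + α * ⟪ξ, w.2⟫)| ≤ e * (|w.1| + ‖w.2‖))
    (h₂ : ∀ w, |l₂ w - 1/3 * (b * w.1 + α * ⟪ξ, w.2⟫)| ≤ e * (|w.1| + ‖w.2‖))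
    (hB : ∀ x y, B₁ (0, x) (0, x) - B₂ (0, y) (0, y) ≤ α * ‖x - y‖^2 + e * (‖x‖^2 + ‖y‖^2))
    (a₁ a₂ : En n) (s₁ s₂ : Matrix (Fin n) (Fin d) ℝ) :
    jetOp a₁ s₁ l₁ B₁ - jetOp a₂ s₂ l₂ B₂ ≤ 1/3 * α * (‖ξ‖ * ‖a₁ - a₂‖) + e * (2 + ‖a₁‖ + ‖a₂‖)
      + 1/2 * (α * frob (s₁ - s₂)^2 + e * (frob s₁^2 + frob s₂^2)) := by
  have k1 := (abs_le.1 (h₁ (1, a₁))).2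
  have k2 := (abs_le.1 (h₂ (1, a₂))).1
  simp only [abs_one] at k1 k2
  have k3 : ⟪ξ, a₁⟫ - ⟪ξ, a₂⟫ ≤ ‖ξ‖ * ‖a₁ - a₂‖ := by
    rw [← inner_sub_right]; exact real_inner_le_norm _ _
  have k4 := mul_le_mul_of_nonneg_left k3 hα
  have k5 : ∑ k, B₁ (0, colVec s₁ k) (0, colVec s₁ k) - ∑ k, B₂ (0, colVec s₂ k) (0, colVec s₂ k)
      ≤ α * frob (s₁ - s₂)^2 + e * (frob s₁^2 + frob s₂^2) := by
    rw [← Finset.sum_sub_distrib, ← sum_norm_colVec_sq, ← sum_norm_colVec_sq, ← sum_norm_colVec_sq,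
      ← Finset.sum_add_distrib, Finset.mul_sum, Finset.mul_sum, ← Finset.sum_add_distrib]
    refine Finset.sum_le_sum fun k _ => ?_
    rw [← colVec_sub]
    exact hB _ _
  unfold jetOp
  linarith

lemma norm_jetGrad_sub_le {α b e : ℝ} (hα : 0 ≤ α) (he : 0 ≤ e) {ξ : En n}
    {l₁ l₂ : ℝ × En n →L[ℝ] ℝ}
    (h₁ : ∀ w, |l₁ w - 1/3 * (b * w.1 + α * ⟪ξ, w.2⟫)| ≤ e * (|w.1| + ‖w.2‖))
    (h₂ : ∀ w, |l₂ w - 1/3 * (b * w.1 + α * ⟪ξ, w.2⟫)| ≤ e * (|w.1| + ‖w.2‖))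
    (s₁ s₂ : Matrix (Fin n) (Fin d) ℝ) :
    ‖jetGrad s₁ l₁ - jetGrad s₂ l₂‖
      ≤ d * (1/3 * α * (‖ξ‖ * frob (s₁ - s₂)) + e * (frob s₁ + frob s₂)) := by
  have hk : ∀ k, |(jetGrad s₁ l₁ - jetGrad s₂ l₂) k|
      ≤ 1/3 * α * (‖ξ‖ * frob (s₁ - s₂)) + e * (frob s₁ + frob s₂) := by
    intro k
    have k1 := h₁ (0, colVec s₁ k)
    have k2 := h₂ (0, colVec s₂ k)
    simp only [abs_zero, zero_add, mul_zero] at k1 k2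
    have m1 := mul_le_mul_of_nonneg_left (norm_colVec_le s₁ k) he
    have m2 := mul_le_mul_of_nonneg_left (norm_colVec_le s₂ k) he
    have k3 : |⟪ξ, colVec s₁ k⟫ - ⟪ξ, colVec s₂ k⟫| ≤ ‖ξ‖ * frob (s₁ - s₂) := by
      rw [← inner_sub_right, colVec_sub]
      exact (abs_real_inner_le_norm _ _).trans
        (mul_le_mul_of_nonneg_left (norm_colVec_le _ _) (norm_nonneg _))
    obtain ⟨p1, p2⟩ := abs_le.1 k3
    have p3 := mul_le_mul_of_nonneg_left p1 hα
    have p4 := mul_le_mul_of_nonneg_left p2 hα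
    obtain ⟨q1, q2⟩ := abs_le.1 k1
    obtain ⟨q3, q4⟩ := abs_le.1 k2
    simp only [jetGrad, PiLp.sub_apply]
    rw [abs_le]
    constructor <;> linarith
  have hc : 0 ≤ 1/3 * α * (‖ξ‖ * frob (s₁ - s₂)) + e * (frob s₁ + frob s₂) := by
    have := frob_nonneg (s₁ - s₂)
    have := frob_nonneg s₁
    have := frob_nonneg s₂
    positivity
  calc ‖jetGrad s₁ l₁ - jetGrad s₂ l₂‖
      ≤ ∑ k, |(jetGrad s₁ l₁ - jetGrad s₂ l₂) k| := by
        conv_lhs => rw [← sum_smul_single (jetGrad s₁ l₁ - jetGrad s₂ l₂)]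
        refine (norm_sum_le _ _).trans (le_of_eq ?_)
        simp [norm_smul]
    _ ≤ ∑ _k : Fin d, (1/3 * α * (‖ξ‖ * frob (s₁ - s₂)) + e * (frob s₁ + frob s₂)) :=
        Finset.sum_le_sum fun k _ => hk k
    _ = _ := by simp; ring

lemma exists_bound_coeff {a : ℝ → En n → En n} {σm : ℝ → En n → Matrix (Fin n) (Fin d) ℝ} {T : ℝ}
    {K : Set (ℝ × En n)} (hK : IsCompact K) (hKS : K ⊆ Strip n T)
    (hac : ContinuousOn (fun p : ℝ × En n => a p.1 p.2) (Strip n T))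
    (hσc : ContinuousOn (fun p : ℝ × En n => σm p.1 p.2) (Strip n T)) :
    (∃ A ≥ 0, ∀ p ∈ K, ‖a p.1 p.2‖ ≤ A ∧ frob (σm p.1 p.2) ≤ A) ∧
    ∀ ε > 0, ∃ ω > 0, ∀ p ∈ K, ∀ q ∈ K, dist p q ≤ ω →
      ‖a p.1 p.2 - a q.1 q.2‖ + frob (σm p.1 p.2 - σm q.1 q.2) ≤ ε := by
  set S : ℝ × En n → EuclideanSpace ℝ (Fin n × Fin d) :=
    fun p => WithLp.toLp 2 (fun ij : Fin n × Fin d => σm p.1 p.2 ij.1 ij.2) with hS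
  have hSc : ContinuousOn S K := by
    have h1 : Continuous fun M : Matrix (Fin n) (Fin d) ℝ =>
        (WithLp.toLp 2 (fun ij : Fin n × Fin d => M ij.1 ij.2) :
          EuclideanSpace ℝ (Fin n × Fin d)) := by
      refine (PiLp.continuous_toLp 2 _).comp ?_
      fun_prop
    exact h1.comp_continuousOn (hσc.mono hKS)
  have hac' := hac.mono hKS
  constructor
  · obtain ⟨A, hA⟩ := hK.exists_bound_of_continuousOn hac'
    obtain ⟨A', hA'⟩ := hK.exists_bound_of_continuousOn hSc
    refine ⟨max 0 (max A A'), le_max_left _ _, fun p hp => ⟨?_, ?_⟩⟩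
    · exact (hA p hp).trans ((le_max_left _ _).trans (le_max_right _ _))
    · rw [frob_eq_norm]
      exact (hA' p hp).trans ((le_max_right _ _).trans (le_max_right _ _))
  · intro ε hε
    obtain ⟨ω₁, h1, h1'⟩ := Metric.uniformContinuousOn_iff_le.1
      (hK.uniformContinuousOn_of_continuous hac') (ε / 2) (by positivity)
    obtain ⟨ω₂, h2, h2'⟩ := Metric.uniformContinuousOn_iff_le.1
      (hK.uniformContinuousOn_of_continuous hSc) (ε / 2) (by positivity)
    refine ⟨min ω₁ ω₂, lt_min h1 h2, fun p hp q hq hd => ?_⟩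
    have e1 := h1' p hp q hq (hd.trans (min_le_left _ _))
    have e2 := h2' p hp q hq (hd.trans (min_le_right _ _))
    have e3 : frob (σm p.1 p.2 - σm q.1 q.2) = dist (S p) (S q) := by
      rw [frob_eq_norm, dist_eq_norm]; congr 1
    rw [e3, ← dist_eq_norm]
    linarith

set_option maxHeartbeats 1000000 in
/-- Almost-ordered parabolic jets of an upper and a lower semicontinuous function near a strict
maximum of their difference. -/
lemma exists_doubled_jets {a : ℝ → En n → En n} {σm : ℝ → En n → Matrix (Fin n) (Fin d) ℝ}
    {T ka : ℝ} (hka : 0 < ka) {K : Set (ℝ × En n)} (hK : IsCompact K) (hKS : K ⊆ Strip n T)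
    (hKr : ∀ p ∈ K, ∀ q ∈ K, (p.1, q.2) ∈ K)
    (hac : ContinuousOn (fun p : ℝ × En n => a p.1 p.2) (Strip n T))
    (hσc : ContinuousOn (fun p : ℝ × En n => σm p.1 p.2) (Strip n T))
    (hLip : ∀ t ∈ Icc (0:ℝ) T, ∀ x x' : En n,
      ‖a t x - a t x'‖ + frob (σm t x - σm t x') ≤ ka * ‖x - x'‖)
    {F G : ℝ × En n → ℝ} (hF : UpperSemicontinuousOn F K) (hG : LowerSemicontinuousOn G K)
    {z : ℝ × En n} (hz : z ∈ K) (hmax : ∀ p ∈ K, F z - G z ≤ F p - G p → p = z)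
    {ε : ℝ} (hε : 0 < ε) :
    ∃ p ∈ K, ∃ q ∈ K, ∃ (l₁ l₂ : ℝ × En n →L[ℝ] ℝ) (B₁ B₂ : ℝ × En n →L[ℝ] ℝ × En n →L[ℝ] ℝ),
      dist p z < ε ∧ dist q z < ε ∧ |F p - F z| < ε ∧ |G q - G z| < ε ∧
      (∀ᶠ P in 𝓝[K] p, F P ≤ F p + l₁ (P - p) + 1/2 * B₁ (P - p) (P - p)) ∧
      (∀ᶠ P in 𝓝[K] q, G q + l₂ (P - q) + 1/2 * B₂ (P - q) (P - q) ≤ G P) ∧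
      jetOp (a p.1 p.2) (σm p.1 p.2) l₁ B₁ - jetOp (a q.1 q.2) (σm q.1 q.2) l₂ B₂ ≤ ε ∧
      ‖jetGrad (σm p.1 p.2) l₁ - jetGrad (σm q.1 q.2) l₂‖ ≤ ε := by
  obtain ⟨⟨A, hA0, hA⟩, huc⟩ := exists_bound_coeff hK hKS hac hσc
  set c := 2 + (6*ka+2) + (9*ka^2+3) + 1 + d * (6*ka+3) with hc
  have hc0 : 0 < c := by positivity
  set ε₁ := min 1 (ε / c) with hε₁
  have hε₁0 : 0 < ε₁ := by positivity
  have hε₁1 : ε₁ ≤ 1 := min_le_left _ _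
  have hcε : c * ε₁ ≤ ε := by
    rw [mul_comm, ← le_div_iff₀ hc0]; exact min_le_right _ _
  obtain ⟨α, hα1, hαε, H⟩ := exists_doubled_jets_aux hK hF hG hz hmax hε₁0
  have hα0 : 0 < α := by linarith
  obtain ⟨ω, hω, hωa⟩ := huc (1 / α) (by positivity)
  set N := 1 + ka * α + (2 + 2 * A + A^2) with hN
  have hN0 : 0 < N := by positivity
  set e := ε₁ / N with he
  have he0 : 0 < e := by positivity
  have heN : e * N = ε₁ := div_mul_cancel₀ _ hN0.ne'
  have he1 : e ≤ ε₁ := by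
    have : 0 ≤ ka * α + (2 + 2 * A + A^2) := by positivity
    have := mul_nonneg he0.le this
    nlinarith
  have he2 : ka * α * e ≤ ε₁ := by
    have : 0 ≤ 1 + (2 + 2 * A + A^2) := by positivity
    have := mul_nonneg he0.le this
    nlinarith
  have he3 : e * (2 + 2 * A + A^2) ≤ ε₁ := by
    have : 0 ≤ 1 + ka * α := by positivity
    have := mul_nonneg he0.le this
    nlinarith
  have he4 : e * (2 * A) ≤ ε₁ := by
    have : 0 ≤ e * (2 + A^2) := by positivity
    nlinarith
  obtain ⟨p, hp, q, hq, ξ, b, l₁, l₂, B₁, B₂, d1, d2, d3, d4, d5, d6, d7, d8, d9, d10, d11, d12,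
    d13⟩ := H ω hω e he0
  have h2ε : 2 * ε₁ ≤ ε := by
    refine le_trans (mul_le_mul_of_nonneg_right ?_ hε₁0.le) hcε
    have : 0 ≤ (6*ka+2) + (9*ka^2+3) + 1 + d * (6*ka+3) := by positivity
    linarith
  have hsplit : ‖a p.1 p.2 - a q.1 q.2‖ + frob (σm p.1 p.2 - σm q.1 q.2)
      ≤ ka * (‖ξ‖ + e) + 1 / α := by
    have t1 := hLip p.1 (hKS hp).1 p.2 q.2
    have t2 := hωa (p.1, q.2) (hKr p hp q hq) q hq (by
      rw [Prod.dist_eq, dist_self, Real.dist_eq]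
      exact max_le d5 hω.le)
    have t3 := frob_sub_le (σm p.1 p.2) (σm p.1 q.2) (σm q.1 q.2)
    have t4 := norm_sub_le_norm_sub_add_norm_sub (a p.1 p.2) (a p.1 q.2) (a q.1 q.2)
    have t5 := mul_le_mul_of_nonneg_left d6 hka.le
    dsimp only at t2
    linarith
  set D := ka * (‖ξ‖ + e) + 1 / α with hD
  have hD0 : 0 ≤ D := by positivity
  have hfr := frob_nonneg (σm p.1 p.2 - σm q.1 q.2)
  have hDa : ‖a p.1 p.2 - a q.1 q.2‖ ≤ D := by linarith
  have hDs : frob (σm p.1 p.2 - σm q.1 q.2) ≤ D := by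
    linarith [norm_nonneg (a p.1 p.2 - a q.1 q.2)]
  have hξ0 := norm_nonneg ξ
  have hαinv : 1 / α ≤ ε₁ := by
    rw [div_le_iff₀ hα0, mul_comm, ← div_le_iff₀ hε₁0]; exact hαε
  have b1 : α * (‖ξ‖ * D) ≤ (6 * ka + 2) * ε₁ := by
    have e1 : α * (‖ξ‖ * D) = ka * (α * ‖ξ‖^2) + ‖ξ‖ * (ka * α * e) + ‖ξ‖ := by
      rw [hD]; field_simp
    have e2 : ka * (α * ‖ξ‖^2) ≤ ka * (6 * ε₁) := mul_le_mul_of_nonneg_left d8 hka.le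
    have e3 : ‖ξ‖ * (ka * α * e) ≤ ε₁ * 1 :=
      mul_le_mul d7 (he2.trans hε₁1) (by positivity) hε₁0.le
    rw [e1]; linarith
  have b2 : α * D^2 ≤ (18 * ka^2 + 6) * ε₁ := by
    have e1 : D^2 ≤ 3 * (ka^2 * ‖ξ‖^2 + ka^2 * e^2 + (1/α)^2) := by
      rw [hD]
      nlinarith [sq_nonneg (ka * ‖ξ‖ - ka * e), sq_nonneg (ka * ‖ξ‖ - 1/α), sq_nonneg (ka * e - 1/α)]
    have e2 := mul_le_mul_of_nonneg_left e1 hα0.le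
    have e3 : α * (3 * (ka^2 * ‖ξ‖^2 + ka^2 * e^2 + (1/α)^2))
        = 3 * (ka^2 * (α * ‖ξ‖^2) + α * (ka * e)^2 + 1/α) := by
      field_simp
    have e4 : ka^2 * (α * ‖ξ‖^2) ≤ ka^2 * (6 * ε₁) := mul_le_mul_of_nonneg_left d8 (sq_nonneg _)
    have e5 : α * (ka * e)^2 ≤ ε₁ := by
      calc α * (ka * e)^2 ≤ α * (α * (ka * e)^2) :=
            mul_le_mul_of_nonneg_left (le_mul_of_one_le_left (sq_nonneg _) hα1) hα0.le
        _ = (ka * α * e)^2 := by ring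
        _ ≤ ε₁^2 := pow_le_pow_left₀ (by positivity) he2 2
        _ ≤ ε₁ := by nlinarith
    rw [e3] at e2
    linarith
  obtain ⟨a1, s1⟩ := hA p hp
  obtain ⟨a2, s2⟩ := hA q hq
  have f1 := frob_nonneg (σm p.1 p.2)
  have f2 := frob_nonneg (σm q.1 q.2)
  refine ⟨p, hp, q, hq, l₁, l₂, B₁, B₂, by linarith, by linarith, by linarith, by linarith, d9, d10,
    ?_, ?_⟩
  · refine (jetOp_sub_le hα0.le d11 d12 d13 _ _ _ _).trans (le_trans ?_ hcε)
    have i1 : α * (‖ξ‖ * ‖a p.1 p.2 - a q.1 q.2‖) ≤ α * (‖ξ‖ * D) := by gcongr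
    have i2 : α * frob (σm p.1 p.2 - σm q.1 q.2)^2 ≤ α * D^2 := by gcongr
    have i3 : e * (2 + ‖a p.1 p.2‖ + ‖a q.1 q.2‖) ≤ e * (2 + A + A) := by gcongr
    have i4 : e * (frob (σm p.1 p.2)^2 + frob (σm q.1 q.2)^2) ≤ e * (A^2 + A^2) := by gcongr
    have i5 : 0 ≤ (d:ℝ) * (6*ka+3) * ε₁ := by positivity
    have i6 : 0 ≤ ka * ε₁ := by positivity
    have : c * ε₁ = 2 * ε₁ + (6*ka+2) * ε₁ + (9*ka^2+3) * ε₁ + ε₁ + d * (6*ka+3) * ε₁ := by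
      rw [hc]; ring
    linarith
  · refine (norm_jetGrad_sub_le hα0.le he0.le d11 d12 _ _).trans (le_trans ?_ hcε)
    have i1 : α * (‖ξ‖ * frob (σm p.1 p.2 - σm q.1 q.2)) ≤ α * (‖ξ‖ * D) := by gcongr
    have i2 : e * (frob (σm p.1 p.2) + frob (σm q.1 q.2)) ≤ e * (2 * A) := by
      have : frob (σm p.1 p.2) + frob (σm q.1 q.2) ≤ 2 * A := by linarith
      gcongr
    have i6 : 0 ≤ ka * ε₁ := by positivity
    have i7 : (d:ℝ) * (1/3 * α * (‖ξ‖ * frob (σm p.1 p.2 - σm q.1 q.2))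
        + e * (frob (σm p.1 p.2) + frob (σm q.1 q.2))) ≤ d * ((6*ka+3) * ε₁) := by
      refine mul_le_mul_of_nonneg_left ?_ (by positivity)
      linarith
    have i8 : 0 ≤ (2 + (6*ka+2) + (9*ka^2+3) + 1) * ε₁ := by positivity
    have : c * ε₁ = (2 + (6*ka+2) + (9*ka^2+3) + 1) * ε₁ + d * ((6*ka+3) * ε₁) := by
      rw [hc]; ring
    linarith

end DoubledJets

section Comparison

variable {n d : ℕ} {U : Type} [MetricSpace U] [CompactSpace U] [Nonempty U] {𝒟 : QVIData n d U}
  {g g₁ g₂ : ℝ → En n → Ed d → ℝ} {ψ : En n → ℝ} {u v W : ℝ → En n → ℝ}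

namespace QVIData

/-- A positive maximum of `u - v - W` can be chosen outside the intervention region of `u`. -/
lemma exists_max_no_jump {m : ℕ} (hu : 𝒟.Sub g₁ ψ u) (hv : 𝒟.Super g₂ ψ v)
    (hvg : HasGrowth 𝒟.T m 𝒟.K v) (hW : IsTest W)
    (hW0 : ∀ t ∈ Icc 0 𝒟.T, ∀ x, 0 ≤ W t x)
    (hWm : ∀ t ∈ Icc 0 𝒟.T, ∀ x y, ‖y‖ ≤ max 𝒟.K ‖x‖ → W t y ≤ W t x)
    {r : ℝ} (hr : ∀ t ∈ Icc 0 𝒟.T, ∀ x, r ≤ ‖x‖ → u t x ≤ v t x + W t x)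
    {t₁ : ℝ} (ht₁ : t₁ ∈ Icc 0 𝒟.T) {x₁ : En n} (h : v t₁ x₁ + W t₁ x₁ < u t₁ x₁) :
    ∃ t ∈ Ico 0 𝒟.T, ∃ x, 𝒟.M u t x < u t x ∧
      ∀ s ∈ Icc 0 𝒟.T, ∀ y, u s y - v s y - W s y ≤ u t x - v t x - W t x := by
  have hT := 𝒟.hT
  set N : ℝ × En n → ℝ := fun p => u p.1 p.2 - v p.1 p.2 - W p.1 p.2 with hN
  have hNusc : UpperSemicontinuousOn N (Strip n 𝒟.T) := by
    have h1 : UpperSemicontinuousOn (fun p : ℝ × En n => -v p.1 p.2) (Strip n 𝒟.T) :=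
      fun p hp c hc => (hv.lsc p hp (-c) (by dsimp only at hc ⊢; linarith)).mono fun y hy => by
        dsimp only at hy ⊢; linarith
    have := (hu.usc.add h1).add (hW.continuous.neg.continuousOn.upperSemicontinuousOn)
    simpa [hN, sub_eq_add_neg] using this
  set A := Strip n 𝒟.T ∩ Metric.closedBall ((0 : ℝ), (0 : En n)) (max 𝒟.T r) with hA
  have hAc : IsCompact A := isCompact_strip_inter _ _ _
  have hmemA : ∀ t ∈ Icc 0 𝒟.T, ∀ x : En n, ‖x‖ ≤ r → (t, x) ∈ A := fun t ht x hx => by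
    refine ⟨mem_strip ht x, ?_⟩
    rw [Metric.mem_closedBall, Prod.dist_eq, Real.dist_eq, sub_zero, dist_zero_right,
      abs_of_nonneg ht.1]
    exact max_le_max ht.2 hx
  have hpos : ∀ t ∈ Icc 0 𝒟.T, ∀ x : En n, 0 < N (t, x) → (t, x) ∈ A := fun t ht x hx => by
    refine hmemA t ht x (le_of_not_ge fun hge => ?_)
    have := hr t ht x hge
    simp only [hN] at hx
    linarith
  have hN1 : 0 < N (t₁, x₁) := by simp only [hN]; linarith
  obtain ⟨p₀, hp₀, hmax⟩ := (hNusc.mono inter_subset_left).exists_isMaxOn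
    ⟨_, hpos t₁ ht₁ x₁ hN1⟩ hAc
  have hμ : 0 < N p₀ := hN1.trans_le (isMaxOn_iff.1 hmax _ (hpos t₁ ht₁ x₁ hN1))
  have hmax' : ∀ s ∈ Icc 0 𝒟.T, ∀ y, N (s, y) ≤ N p₀ := fun s hs y => by
    by_contra! hlt
    exact hlt.not_ge (isMaxOn_iff.1 hmax _ (hpos s hs y (hμ.trans hlt)))
  have hS : IsCompact (A ∩ N ⁻¹' Ici (N p₀)) :=
    (hNusc.mono inter_subset_left).isCompact_inter_preimage_Ici hAc _
  have hp₀S : p₀ ∈ A ∩ N ⁻¹' Ici (N p₀) := ⟨hp₀, mem_preimage.2 (mem_Ici.2 le_rfl)⟩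
  obtain ⟨⟨t, x⟩, hz, hzmax⟩ := (hu.usc.mono
    (inter_subset_left.trans inter_subset_left)).exists_isMaxOn ⟨_, hp₀S⟩ hS
  have ht : t ∈ Icc 0 𝒟.T := hz.1.1.1
  have hNz : N (t, x) = N p₀ := le_antisymm (hmax' t ht x) hz.2
  have htT : t < 𝒟.T := by
    refine lt_of_le_of_ne ht.2 fun he => ?_
    have h1 := hu.terminal x
    have h2 := hv.terminal x
    have h3 := hW0 t ht x
    have h4 : 0 < N (t, x) := hNz ▸ hμ
    simp only [hN, he] at h4 h3
    linarith
  refine ⟨t, ⟨ht.1, htT⟩, x, ?_, fun s hs y => ?_⟩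
  · by_contra! hle
    obtain ⟨b, hb, -⟩ := exists_max_M hu.usc ht x
    have h1 := hv.M_le hvg ⟨ht.1, htT⟩ x
    have h2 := le_M hvg ht x b
    have h3 := hWm t ht x _ (𝒟.hΓb t ht x b)
    have h4 : N p₀ ≤ N (t, 𝒟.Γ t x b) := by
      rw [← hNz]
      simp only [hN]
      linarith
    have h5 := isMaxOn_iff.1 hzmax (t, 𝒟.Γ t x b) ⟨hpos t ht _ (hμ.trans_le h4), h4⟩
    have h6 := 𝒟.hℓlb t ht x b
    have h7 := 𝒟.hδ
    dsimp only at h5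
    linarith
  · have := hmax' s hs y
    rw [← hNz] at this
    exact this

lemma le_add_of_strict {k : ℝ} {m : ℕ} (hg₂ : IsDriver 𝒟.T k g₂)
    (hu : 𝒟.Sub g₁ ψ u) (hv : 𝒟.Super g₂ ψ v) (hvg : HasGrowth 𝒟.T m 𝒟.K v) (hW : IsTest W)
    (hW0 : ∀ t ∈ Icc 0 𝒟.T, ∀ x, 0 ≤ W t x)
    (hWm : ∀ t ∈ Icc 0 𝒟.T, ∀ x y, ‖y‖ ≤ max 𝒟.K ‖x‖ → W t y ≤ W t x)
    {r : ℝ} (hr : ∀ t ∈ Icc 0 𝒟.T, ∀ x, r ≤ ‖x‖ → u t x ≤ v t x + W t x) {γ : ℝ} (hγ : 0 < γ)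
    (hWg : ∀ t ∈ Icc 0 𝒟.T, ∀ x z, g₁ t x (z + 𝒟.G W t x) + 𝒟.P W t x + γ ≤ g₂ t x z) :
    ∀ t ∈ Icc 0 𝒟.T, ∀ x, u t x ≤ v t x + W t x := by
  by_contra! hcon
  obtain ⟨t₁, ht₁, x₁, hlt⟩ := hcon
  obtain ⟨t, ht, x, hM, hmax⟩ := exists_max_no_jump hu hv hvg hW hW0 hWm hr ht₁ hlt
  have hz := mem_strip (𝒟 := 𝒟) (Ico_subset_Icc_self ht) x
  set Q := quartic t x with hQ
  have hQt : IsTest Q := isTest_quartic t x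
  set ε := min (γ / (8 + 4 * |k|)) ((u t x - 𝒟.M u t x) / 4) with hε
  have hε0 : 0 < ε := by
    have : 0 < u t x - 𝒟.M u t x := by linarith
    positivity
  have hε1 : ε * (8 + 4 * |k|) ≤ γ := by
    rw [← le_div_iff₀ (by positivity)]; exact min_le_left _ _
  have hε2 : 4 * ε ≤ u t x - 𝒟.M u t x := by
    have : ε ≤ (u t x - 𝒟.M u t x) / 4 := min_le_right _ _
    linarith
  obtain ⟨hQP, hQG⟩ := quartic_jet (a := 𝒟.a) (σm := 𝒟.σ) ht x
  have c1 : ∀ᶠ p : ℝ × En n in 𝓝[Strip n 𝒟.T] (t, x), 𝒟.P Q p.1 p.2 < ε :=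
    (hQt.continuousOn_parOp 𝒟.hac 𝒟.hσc _ hz).tendsto.eventually
      (gt_mem_nhds (by dsimp only; rw [hQP]; exact hε0))
  have c2 : ∀ᶠ p : ℝ × En n in 𝓝[Strip n 𝒟.T] (t, x), ‖𝒟.G Q p.1 p.2‖ < ε :=
    (hQt.continuousOn_sigGrad (σm := 𝒟.σ) 𝒟.hσc _ hz).norm.tendsto.eventually
      (gt_mem_nhds (by dsimp only; rw [hQG, norm_zero]; exact hε0))
  have c3 : ∀ᶠ p : ℝ × En n in 𝓝[Strip n 𝒟.T] (t, x), 𝒟.M u p.1 p.2 < 𝒟.M u t x + ε :=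
    usc_M hu.usc _ hz _ (by dsimp only; linarith)
  have hWQ := hW.add hQt
  have c4 : ∀ᶠ p : ℝ × En n in 𝓝[Strip n 𝒟.T] (t, x), W t x + Q t x - ε < W p.1 p.2 + Q p.1 p.2 :=
    nhdsWithin_le_nhds (hWQ.continuous.continuousAt.eventually
      (lt_mem_nhds (by dsimp only; linarith)))
  obtain ⟨ω, hω, c5⟩ := hg₂.cont ε hε0 _ hz
  obtain ⟨r₁, hr₁, c6⟩ := (nhdsWithin_hasBasis Metric.nhds_basis_closedBall _).eventually_iff.1
    (((c1.and c2).and c3).and c4)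
  set R := min (min r₁ ω) ((𝒟.T - t) / 2) with hR
  have hR0 : 0 < R := by
    have := sub_pos.2 ht.2
    positivity
  have hR1 : R ≤ r₁ := (min_le_left _ _).trans (min_le_left _ _)
  have hR2 : R ≤ ω := (min_le_left _ _).trans (min_le_right _ _)
  have hR3 : R ≤ (𝒟.T - t) / 2 := min_le_right _ _
  set K := Strip n 𝒟.T ∩ Metric.closedBall (t, x) R with hK
  have hzK : (t, x) ∈ K := ⟨hz, Metric.mem_closedBall_self hR0.le⟩
  have hF : UpperSemicontinuousOn (fun p : ℝ × En n => u p.1 p.2 - (W p.1 p.2 + Q p.1 p.2)) K := by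
    have := (hu.usc.mono (inter_subset_left : K ⊆ _)).add
      (hWQ.continuous.neg.continuousOn.upperSemicontinuousOn)
    simpa [sub_eq_add_neg] using this
  obtain ⟨p, hp, q, hq, l₁, l₂, B₁, B₂, d1, d2, d3, d4, d5, d6, d7, d8⟩ :=
    exists_doubled_jets (a := 𝒟.a) (σm := 𝒟.σ) 𝒟.hka (isCompact_strip_inter _ _ _ : IsCompact K)
      inter_subset_left (fun p hp q hq => ⟨⟨hp.1.1, mem_univ _⟩, by
        have h1 := Metric.mem_closedBall.1 hp.2
        have h2 := Metric.mem_closedBall.1 hq.2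
        rw [Prod.dist_eq] at h1 h2
        rw [Metric.mem_closedBall, Prod.dist_eq]
        exact max_le ((le_max_left _ _).trans h1) ((le_max_right _ _).trans h2)⟩)
      𝒟.hac 𝒟.hσc 𝒟.haσLip hF (hv.lsc.mono inter_subset_left) hzK (by
        rintro ⟨s, y⟩ hp hle
        have h1 := hmax s hp.1.1 y
        dsimp only at hle
        rw [hQ, quartic_self] at hle
        obtain ⟨h2, h3⟩ := eq_of_quartic_nonpos (t₀ := t) (x₀ := x) (t := s) (x := y) (by linarith)
        rw [h2, h3]) (lt_min hε0 hR0)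
  have dε := min_le_left ε R
  have dR := min_le_right ε R
  have hpt : p.1 < 𝒟.T ∧ q.1 < 𝒟.T := by
    have h1 : dist p.1 t ≤ dist p (t, x) := le_max_left _ _
    have h2 : dist q.1 t ≤ dist q (t, x) := le_max_left _ _
    have h3 := (abs_lt.1 (Real.dist_eq p.1 t ▸ h1.trans_lt d1)).2
    have h4 := (abs_lt.1 (Real.dist_eq q.1 t ▸ h2.trans_lt d2)).2
    have := sub_pos.2 ht.2
    constructor <;> linarith
  obtain ⟨⟨⟨k1, k2⟩, k3⟩, k4⟩ := c6 ⟨Metric.closedBall_subset_closedBall hR1 hp.2, hp.1⟩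
  dsimp only at d3
  rw [nhdsWithin_strip_inter (by linarith)] at d5 d6
  have e1 := hu.le_of_jet (t := p.1) (x := p.2) ⟨hp.1.1.1, hpt.1⟩ hWQ l₁ B₁ d5 (by
    have := (abs_lt.1 d3).1
    linarith)
  have e2 := (hv.le_of_jet (t := q.1) (x := q.2) ⟨hq.1.1.1, hpt.2⟩ (isTest_const 0) l₂ B₂
    (by simpa using d6)).2
  rw [P, G, hW.parOp_add hQt, hW.sigGrad_add hQt] at e1
  rw [P, G, parOp_const, sigGrad_const, zero_add, zero_add] at e2
  set z := sigGrad 𝒟.σ Q p.1 p.2 + jetGrad (𝒟.σ p.1 p.2) l₁ with hzdef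
  have e3 := hWg p.1 hp.1.1 p.2 z
  have ez : z + 𝒟.G W p.1 p.2 = sigGrad 𝒟.σ W p.1 p.2 + sigGrad 𝒟.σ Q p.1 p.2
      + jetGrad (𝒟.σ p.1 p.2) l₁ := by
    rw [hzdef, G]; abel
  rw [ez] at e3
  have f1 := (abs_le.1 (c5 p hp.1 (hp.2.trans hR2) z)).2
  have f2 := (abs_le.1 (c5 q hq.1 (hq.2.trans hR2) z)).1
  have f3 := (abs_le.1 (hg₂.lip q.1 hq.1.1 q.2 (jetGrad (𝒟.σ q.1 q.2) l₂) z)).2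
  have f4 : ‖z - jetGrad (𝒟.σ q.1 q.2) l₂‖ ≤ 2 * ε := by
    have : z - jetGrad (𝒟.σ q.1 q.2) l₂ = 𝒟.G Q p.1 p.2
        + (jetGrad (𝒟.σ p.1 p.2) l₁ - jetGrad (𝒟.σ q.1 q.2) l₂) := by
      rw [hzdef, G]; abel
    rw [this]
    refine (norm_add_le _ _).trans ?_
    linarith
  have f5 : k * ‖z - jetGrad (𝒟.σ q.1 q.2) l₂‖ ≤ |k| * (2 * ε) :=
    mul_le_mul (le_abs_self k) f4 (norm_nonneg _) (abs_nonneg _)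
  have f6 : 𝒟.P W p.1 p.2 = parOp 𝒟.a 𝒟.σ W p.1 p.2 := rfl
  have f7 : 𝒟.P Q p.1 p.2 = parOp 𝒟.a 𝒟.σ Q p.1 p.2 := rfl
  have f8 : 0 < |k| * ε ∨ 0 = |k| * ε := (mul_nonneg (abs_nonneg k) hε0.le).lt_or_eq
  rcases f8 with f8 | f8 <;> linarith

variable (𝒟) in
/-- Quantitative comparison principle. -/
theorem exists_comparison (m : ℕ) {k : ℝ} (hk : 0 ≤ k) :
    ∃ C₁ > 0, ∀ (lam κ : ℝ) (g₁ g₂ : ℝ → En n → Ed d → ℝ) (ψ : En n → ℝ) (u v : ℝ → En n → ℝ),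
      0 ≤ κ → IsDriver 𝒟.T k g₂ → 𝒟.Sub g₁ ψ u → 𝒟.Super g₂ ψ v →
      HasGrowth 𝒟.T (m + 3) 𝒟.K u → HasGrowth 𝒟.T (m + 3) 𝒟.K v →
      (∀ t ∈ Icc 0 𝒟.T, ∀ x z,
        g₁ t x z ≤ g₂ t x z + κ * ((lam - C₁) * expWt 𝒟.T (m + 3) 𝒟.K lam t x)) →
      ∀ t ∈ Icc 0 𝒟.T, ∀ x, u t x ≤ v t x + κ * expWt 𝒟.T (m + 3) 𝒟.K lam t x := by
  obtain ⟨C₀, hC₀, H₀⟩ := exists_expWt_bound 𝒟.a 𝒟.σ 𝒟.hCa 𝒟.haσg m 𝒟.K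
  obtain ⟨C₀', hC₀', H₀'⟩ := exists_expWt_bound 𝒟.a 𝒟.σ 𝒟.hCa 𝒟.haσg (m + 1) 𝒟.K
  refine ⟨C₀ * (1 + k), by positivity, fun lam κ g₁ g₂ ψ u v hκ hg₂ hu hv hug hvg hg t ht x => ?_⟩
  set lam' := C₀' * (1 + k) + 1 with hlam'
  set Θ := expWt 𝒟.T (m + 3) 𝒟.K lam (n := n) with hΘ
  set Θ' := expWt 𝒟.T (m + 1 + 3) 𝒟.K lam' (n := n) with hΘ'
  have hΘt : IsTest Θ := isTest_expWt _ _ _ _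
  have hΘt' : IsTest Θ' := isTest_expWt _ _ _ _
  have hlam0 : 0 ≤ lam' := by positivity
  have hΘ'1 : ∀ t ∈ Icc 0 𝒟.T, ∀ x, wt (m + 1 + 3) 𝒟.K x ≤ Θ' t x :=
    fun t ht x => wt_le_expWt _ _ hlam0 ht.2 x
  suffices h : ∀ ε > 0, u t x ≤ v t x + κ * Θ t x + ε * Θ' t x by
    refine le_of_forall_pos_le_add fun ε hε => ?_
    have hpos : 0 < Θ' t x := expWt_pos _ _ _ _ _ _
    have := h (ε / Θ' t x) (by positivity)
    rwa [div_mul_cancel₀ _ hpos.ne'] at this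
  intro ε hε
  have hW := (hΘt.const_mul κ).add (hΘt'.const_mul ε)
  have hvg' := hvg
  obtain ⟨Cu, hCu⟩ := hug
  obtain ⟨Cv, hCv⟩ := hvg'
  obtain ⟨r, -, hr⟩ := exists_mul_wt_le (n := n) (m + 3) 𝒟.K (|Cu| + |Cv|) (by positivity) hε
  have key := le_add_of_strict (γ := ε) hg₂ hu hv hvg hW ?_ ?_ (r := r) ?_ hε ?_ t ht x
  · linarith
  · intro t ht x
    have h1 : 0 < Θ t x := expWt_pos _ _ _ _ _ _
    have h2 : 0 < Θ' t x := expWt_pos _ _ _ _ _ _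
    positivity
  · intro t ht x y hy
    have h1 : Θ t y ≤ Θ t x := expWt_mono _ _ 𝒟.hK.le _ _ hy
    have h2 : Θ' t y ≤ Θ' t x := expWt_mono _ _ 𝒟.hK.le _ _ hy
    exact add_le_add (mul_le_mul_of_nonneg_left h1 hκ) (mul_le_mul_of_nonneg_left h2 hε.le)
  · intro t ht x hx
    have h1 := hr x hx
    have h2 := (abs_le.1 (hCu t ht x)).2
    have h3 := (abs_le.1 (hCv t ht x)).1
    have h4 := mul_le_mul_of_nonneg_left (hΘ'1 t ht x) hε.le
    have h5 : 0 < Θ t x := expWt_pos _ _ _ _ _ _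
    have h6 := mul_nonneg hκ h5.le
    have hw := wt_pos (n := n) (m + 3) 𝒟.K x
    have h7 := mul_le_mul_of_nonneg_right (le_abs_self Cu) hw.le
    have h8 := mul_le_mul_of_nonneg_right (le_abs_self Cv) hw.le
    have e : m + 3 + 1 = m + 1 + 3 := by ring
    rw [e] at h1
    linarith
  · intro t ht x z
    rw [P, G, (hΘt.const_mul κ).parOp_add (hΘt'.const_mul ε), hΘt.parOp_const_mul,
      hΘt'.parOp_const_mul, (hΘt.const_mul κ).sigGrad_add (hΘt'.const_mul ε), hΘt.sigGrad_const_mul,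
      hΘt'.sigGrad_const_mul]
    obtain ⟨a1, a2⟩ := H₀ lam t ht x
    obtain ⟨b1, b2⟩ := H₀' lam' t ht x
    have a1' := mul_le_mul_of_nonneg_left (abs_le.1 a1).2 hκ
    have b1' := mul_le_mul_of_nonneg_left (abs_le.1 b1).2 hε.le
    set G₁ := sigGrad 𝒟.σ Θ t x
    set G₂ := sigGrad 𝒟.σ Θ' t x
    have h1 := hg t ht x (z + (κ • G₁ + ε • G₂))
    have h2 := (abs_le.1 (hg₂.lip t ht x z (z + (κ • G₁ + ε • G₂)))).2
    rw [add_sub_cancel_left] at h2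
    have h3 : ‖κ • G₁ + ε • G₂‖ ≤ κ * (C₀ * Θ t x) + ε * (C₀' * Θ' t x) := by
      refine (norm_add_le _ _).trans ?_
      rw [norm_smul, norm_smul, Real.norm_of_nonneg hκ, Real.norm_of_nonneg hε.le]
      gcongr
    have h4 := mul_le_mul_of_nonneg_left h3 hk
    have h5 : 1 ≤ Θ' t x := (one_le_wt _ _ _).trans (hΘ'1 t ht x)
    have h6 := mul_le_mul_of_nonneg_left h5 hε.le
    have h7 : lam' * Θ' t x = C₀' * (1 + k) * Θ' t x + Θ' t x := by rw [hlam']; ring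
    have h8 : ε * (lam' * Θ' t x) = ε * (C₀' * (1 + k) * Θ' t x + Θ' t x) := by rw [h7]
    linarith

end QVIData

end Comparison

section Barriers

variable {n d : ℕ} {U : Type}

lemma IsDriver.continuousOn {T k : ℝ} {g : ℝ → En n → Ed d → ℝ} (hg : IsDriver T k g)
    {z : ℝ × En n → Ed d} (hz : ContinuousOn z (Strip n T)) :
    ContinuousOn (fun p : ℝ × En n => g p.1 p.2 (z p)) (Strip n T) := by
  intro p hp
  rw [ContinuousWithinAt, Metric.tendsto_nhds]
  intro ε hε
  obtain ⟨δ', hδ', h1⟩ := hg.cont (ε / 2) (half_pos hε) p hp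
  have h2 : Tendsto (fun q => k * ‖z q - z p‖) (𝓝[Strip n T] p) (𝓝 (k * ‖z p - z p‖)) :=
    (((hz p hp).tendsto.sub_const (z p)).norm).const_mul k
  rw [sub_self, norm_zero, mul_zero] at h2
  filter_upwards [h2.eventually (gt_mem_nhds (half_pos hε)), self_mem_nhdsWithin,
    nhdsWithin_le_nhds (Metric.closedBall_mem_nhds p hδ')] with q q1 q2 q3
  have h3 := h1 q q2 (Metric.mem_closedBall.1 q3) (z q)
  have h4 := hg.lip p.1 hp.1 p.2 (z p) (z q)
  rw [Real.dist_eq]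
  calc |g q.1 q.2 (z q) - g p.1 p.2 (z p)|
      ≤ |g q.1 q.2 (z q) - g p.1 p.2 (z q)| + |g p.1 p.2 (z q) - g p.1 p.2 (z p)| :=
        abs_sub_le _ _ _
    _ < ε := by linarith

lemma isTest_comp_snd {ψ : En n → ℝ} (hψ : ContDiff ℝ 2 ψ) : IsTest (fun (_ : ℝ) x => ψ x) :=
  hψ.comp contDiff_snd

lemma isTest_time (T c : ℝ) : IsTest (fun t (_ : En n) => c * (T - t)) :=
  contDiff_const.mul (contDiff_const.sub contDiff_fst)

lemma parOp_time (a : ℝ → En n → En n) (σm : ℝ → En n → Matrix (Fin n) (Fin d) ℝ)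
    (T c t : ℝ) (x : En n) : parOp a σm (fun t _ => c * (T - t)) t x = -c := by
  have h : deriv (fun s => c * (T - s)) t = -c := by
    simp
  simp [parOp, ptd, genL, pd, pd2, h]

lemma sigGrad_time (σm : ℝ → En n → Matrix (Fin n) (Fin d) ℝ)
    (T c t : ℝ) (x : En n) : sigGrad σm (fun t _ => c * (T - t)) t x = 0 := by
  ext k
  simp [sigGrad, pd]

namespace QVIData

section Order

variable [MetricSpace U] {𝒟 : QVIData n d U} {g : ℝ → En n → Ed d → ℝ}

/-- At a point where `φ` touches `w` from below, the operator of `φ` is at most that of `w`. -/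
lemma operator_le_of_touch {φ w : ℝ → En n → ℝ} (hφ : IsTest φ) (hw : IsTest w) {t : ℝ}
    (ht : t ∈ Ico 0 𝒟.T) {x : En n}
    (h : ∀ᶠ p in 𝓝[Strip n 𝒟.T] (t, x), φ p.1 p.2 - w p.1 p.2 ≤ φ t x - w t x) :
    𝒟.P φ t x + g t x (𝒟.G φ t x) ≤ 𝒟.P w t x + g t x (𝒟.G w t x) := by
  obtain ⟨h1, h2⟩ := (hw.sub hφ).parOp_nonneg_of_isLocalMinOn (a := 𝒟.a) (σm := 𝒟.σ) ht (x := x)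
    (by filter_upwards [h] with p hp; linarith)
  rw [hw.parOp_sub hφ] at h1
  rw [hw.sigGrad_sub hφ, sub_eq_zero] at h2
  rw [P, P, G, G, h2]
  linarith

end Order

variable [MetricSpace U] [CompactSpace U] [Nonempty U] {𝒟 : QVIData n d U}
  {g : ℝ → En n → Ed d → ℝ} {ψ : En n → ℝ}

/-- Near the terminal time, on bounded sets, interventions on `ψ` are strictly suboptimal. -/
lemma exists_gap (hψ : Continuous ψ) (hψΓ : ∀ x b, ψ (𝒟.Γ 𝒟.T x b) - 𝒟.ℓ 𝒟.T x b < ψ x) (R : ℝ) :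
    ∃ ε > 0, ∃ η > 0, ∀ t ∈ Icc 0 𝒟.T, ∀ x : En n, ‖x‖ ≤ R → 𝒟.T - η < t →
      ∀ b, ψ (𝒟.Γ t x b) - 𝒟.ℓ t x b + ε ≤ ψ x := by
  have hT := 𝒟.hT
  have hc : UpperSemicontinuousOn (fun p : ℝ × En n => (fun (_ : ℝ) x => ψ x) p.1 p.2)
      (Strip n 𝒟.T) := (hψ.comp continuous_snd).continuousOn.upperSemicontinuousOn
  set H : ℝ × En n → ℝ := fun p => 𝒟.M (fun _ x => ψ x) p.1 p.2 - ψ p.2 with hH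
  have hHu : UpperSemicontinuousOn H (Strip n 𝒟.T) := by
    have := (usc_M (u := fun _ x => ψ x) hc).add
      ((hψ.comp continuous_snd).neg.continuousOn (s := Strip n 𝒟.T)).upperSemicontinuousOn
    simpa [hH, sub_eq_add_neg] using this
  have hle : ∀ t ∈ Icc 0 𝒟.T, ∀ x b, ψ (𝒟.Γ t x b) - 𝒟.ℓ t x b - ψ x ≤ H (t, x) :=
    fun t ht x b => by
      obtain ⟨b', h1, h2⟩ := exists_max_M (u := fun _ x => ψ x) hc ht x
      have := h2 b
      simp only [hH]
      linarith
  have hneg : ∀ x, H (𝒟.T, x) < 0 := fun x => by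
    obtain ⟨b', h1, h2⟩ := exists_max_M (u := fun _ x => ψ x) hc (right_mem_Icc.2 hT.le) x
    have := hψΓ x b'
    simp only [hH]
    linarith
  have hA : IsCompact (Icc 0 𝒟.T ×ˢ Metric.closedBall (0 : En n) R) :=
    isCompact_Icc.prod (isCompact_closedBall _ _)
  have hAs : Icc 0 𝒟.T ×ˢ Metric.closedBall (0 : En n) R ⊆ Strip n 𝒟.T :=
    prod_mono le_rfl (subset_univ _)
  obtain ⟨ε, hε, hεH⟩ : ∃ ε > 0, ∀ x : En n, ‖x‖ ≤ R → H (𝒟.T, x) < -ε := by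
    have hB : IsCompact (({𝒟.T} : Set ℝ) ×ˢ Metric.closedBall (0 : En n) R) :=
      isCompact_singleton.prod (isCompact_closedBall _ _)
    rcases (({𝒟.T} : Set ℝ) ×ˢ Metric.closedBall (0 : En n) R).eq_empty_or_nonempty with he | he
    · refine ⟨1, one_pos, fun x hx => ?_⟩
      have hx' : (𝒟.T, x) ∈ (({𝒟.T} : Set ℝ) ×ˢ Metric.closedBall (0 : En n) R) :=
        ⟨mem_singleton _, by simpa using hx⟩
      rw [he] at hx'
      exact hx'.elim
    · obtain ⟨⟨t, y⟩, hy, hmax⟩ := (hHu.mono ((prod_mono (singleton_subset_iff.2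
        (right_mem_Icc.2 hT.le)) le_rfl).trans hAs)).exists_isMaxOn he hB
      have hty : t = 𝒟.T := hy.1
      subst hty
      refine ⟨-H (𝒟.T, y) / 2, by linarith [hneg y], fun x hx => ?_⟩
      have := isMaxOn_iff.1 hmax (𝒟.T, x) ⟨mem_singleton _, by simpa using hx⟩
      linarith [hneg y]
  have hC := (hHu.mono hAs).isCompact_inter_preimage_Ici hA (-ε)
  set C := (Icc 0 𝒟.T ×ˢ Metric.closedBall (0 : En n) R) ∩ H ⁻¹' Ici (-ε) with hCdef
  have hfin : ∀ η, (∀ p ∈ C, η ≤ 𝒟.T - p.1) → ∀ t ∈ Icc 0 𝒟.T, ∀ x : En n, ‖x‖ ≤ R →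
      𝒟.T - η < t → ∀ b, ψ (𝒟.Γ t x b) - 𝒟.ℓ t x b + ε ≤ ψ x := by
    intro η hη t ht x hx hlt b
    by_contra! hcon
    have h1 := hle t ht x b
    have h2 := hη (t, x) ⟨⟨ht, by simpa using hx⟩, mem_preimage.2 (mem_Ici.2 (by linarith))⟩
    dsimp only at h2
    linarith
  rcases C.eq_empty_or_nonempty with he | he
  · exact ⟨ε, hε, 1, one_pos, hfin 1 fun p hp => by rw [he] at hp; exact hp.elim⟩
  · obtain ⟨⟨s, y⟩, hy, hmin⟩ := hC.exists_isMinOn he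
      (f := fun p : ℝ × En n => 𝒟.T - p.1) (by fun_prop)
    refine ⟨ε, hε, 𝒟.T - s, ?_, hfin _ fun p hp => isMinOn_iff.1 hmin p hp⟩
    have hs : s ≤ 𝒟.T := hy.1.1.2
    refine sub_pos.2 (lt_of_le_of_ne hs fun he => ?_)
    have h1 := hεH y (by simpa using hy.1.2)
    have h2 : -ε ≤ H (s, y) := hy.2
    rw [he] at h2
    linarith

/-- Continuous supersolutions almost attaining the terminal value at a given point. -/
lemma exists_upper_barrier {k : ℝ} {m : ℕ} (hg : IsDriver 𝒟.T k g)
    {Θ : ℝ → En n → ℝ} (hΘ : IsTest Θ) (hΘg : HasGrowth 𝒟.T m 𝒟.K Θ)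
    (hΘP : ∀ t ∈ Icc 0 𝒟.T, ∀ x, 𝒟.P Θ t x + g t x (𝒟.G Θ t x) ≤ 0)
    (hΘm : ∀ t ∈ Icc 0 𝒟.T, ∀ x y, ‖y‖ ≤ max 𝒟.K ‖x‖ → Θ t y ≤ Θ t x)
    (hψ : Continuous ψ) (hψΘ : ∀ t ∈ Icc 0 𝒟.T, ∀ x, |ψ x| ≤ Θ t x)
    (hψΓ : ∀ x b, ψ (𝒟.Γ 𝒟.T x b) - 𝒟.ℓ 𝒟.T x b < ψ x) (x₀ : En n) {ε : ℝ} (hε : 0 < ε) :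
    ∃ w : ℝ → En n → ℝ, 𝒟.Super g ψ w ∧ ContinuousOn (fun p : ℝ × En n => w p.1 p.2) (Strip n 𝒟.T) ∧
      (∀ t ∈ Icc 0 𝒟.T, ∀ x, |w t x| ≤ Θ t x) ∧ w 𝒟.T x₀ ≤ ψ x₀ + ε := by
  have hT := 𝒟.hT
  have hΘ0 : ∀ t ∈ Icc 0 𝒟.T, ∀ x, 0 ≤ Θ t x := fun t ht x => (abs_nonneg _).trans (hψΘ t ht x)
  set R := max 𝒟.K ‖x₀‖ with hR
  have hKR : 𝒟.K ≤ R := le_max_left _ _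
  obtain ⟨Cg, hCg⟩ := hΘg
  obtain ⟨C₁, hC₁, hw₁⟩ := exists_growth_le_wt (n := n) (ρ := ((2 * m : ℕ) : ℝ)) (by positivity)
    (m := m + 2) (by push_cast; linarith) R
  obtain ⟨r, hr, hw₂⟩ := exists_mul_wt_le (n := n) (m + 2) R (2 * |Cg| * C₁ + 1) (by positivity)
    one_pos
  have hfar : ∀ t ∈ Icc 0 𝒟.T, ∀ x : En n, r ≤ ‖x‖ → Θ t x ≤ ψ x + (wt (m + 3) R x - 1) := by
    intro t ht x hx
    have h1 := hw₂ x hx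
    have h2 := hw₁ x
    rw [Real.rpow_natCast] at h2
    have h3 := (wt_le_one_add m 𝒟.K x).trans h2
    have h4 := (le_abs_self _).trans (hCg t ht x)
    have h5 := mul_le_mul_of_nonneg_right (le_abs_self Cg) (wt_pos m 𝒟.K x).le
    have h6 := mul_le_mul_of_nonneg_left h3 (abs_nonneg Cg)
    have h7 := (abs_le.1 (hψΘ t ht x)).1
    have h8 := one_le_wt (m + 2) R x
    have e : m + 2 + 1 = m + 3 := by ring
    rw [e] at h1
    nlinarith
  obtain ⟨ε₁, hε₁, η, hη, hgap⟩ := exists_gap hψ hψΓ r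
  set ε₂ := min ε ε₁ with hε₂
  have hε₂0 : 0 < ε₂ := lt_min hε hε₁
  obtain ⟨ψ', hψ's, hψ'd, -⟩ := Continuous.exists_contDiff_approx 2
    (hψ.add_const (ε₂ / 2)) (continuous_const (y := ε₂ / 2)) (fun _ => half_pos hε₂0)
  have hψ'1 : ∀ x, ψ x ≤ ψ' x := fun x => by
    have := (abs_lt.1 (Real.dist_eq _ _ ▸ hψ'd x)).1; linarith
  have hψ'2 : ∀ x, ψ' x ≤ ψ x + ε₂ := fun x => by
    have := (abs_lt.1 (Real.dist_eq _ _ ▸ hψ'd x)).2; linarith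
  have hΨt : IsTest (fun (_ : ℝ) x => ψ' x + (wt (m + 3) R x - 1)) :=
    isTest_comp_snd (hψ's.add ((contDiff_wt m R).sub contDiff_const))
  set Ψ : ℝ → En n → ℝ := fun _ x => ψ' x + (wt (m + 3) R x - 1) with hΨ
  have hA : IsCompact (Icc 0 𝒟.T ×ˢ Metric.closedBall (0 : En n) r) :=
    isCompact_Icc.prod (isCompact_closedBall _ _)
  have hAs : Icc 0 𝒟.T ×ˢ Metric.closedBall (0 : En n) r ⊆ Strip n 𝒟.T :=
    prod_mono le_rfl (subset_univ _)
  obtain ⟨D₁, hD₁⟩ := hA.exists_bound_of_continuousOn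
    (((hΨt.continuousOn_parOp 𝒟.hac 𝒟.hσc).add
      (hg.continuousOn (hΨt.continuousOn_sigGrad (σm := 𝒟.σ) 𝒟.hσc))).mono hAs)
  obtain ⟨D₂, hD₂⟩ := hA.exists_bound_of_continuousOn
    (hΘ.continuous.sub hΨt.continuous).continuousOn
  set c := max |D₁| (|D₂| / η) with hc
  have hc0 : 0 ≤ c := (abs_nonneg _).trans (le_max_left _ _)
  have hw1t := hΨt.add (isTest_time 𝒟.T c)
  set w₁ : ℝ → En n → ℝ := fun t x => Ψ t x + c * (𝒟.T - t) with hw1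
  have hψw : ∀ t ∈ Icc 0 𝒟.T, ∀ x, ψ x ≤ w₁ t x := fun t ht x => by
    have h1 := hψ'1 x
    have h2 := one_le_wt (m + 3) R x
    have h3 := mul_nonneg hc0 (sub_nonneg.2 ht.2)
    simp only [hw1, hΨ]
    linarith
  have hnear : ∀ t ∈ Icc 0 𝒟.T, ∀ x, w₁ t x < Θ t x → ‖x‖ ≤ r ∧ 𝒟.T - η < t := by
    intro t ht x hlt
    have h3 := mul_nonneg hc0 (sub_nonneg.2 ht.2)
    have hx : ‖x‖ ≤ r := by
      by_contra! hx
      have h1 := hfar t ht x hx.le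
      have h2 := hψ'1 x
      simp only [hw1, hΨ] at hlt
      linarith
    refine ⟨hx, ?_⟩
    by_contra! hle
    have h1 := hD₂ (t, x) ⟨ht, by simpa using hx⟩
    have h2 : Θ t x - Ψ t x ≤ |D₂| := (le_abs_self _).trans (h1.trans (le_abs_self D₂))
    have h4 : |D₂| / η * η ≤ c * (𝒟.T - t) :=
      mul_le_mul (le_max_right _ _) (by linarith) hη.le hc0
    rw [div_mul_cancel₀ _ hη.ne'] at h4
    simp only [hw1] at hlt
    linarith
  have hw1P : ∀ t ∈ Icc 0 𝒟.T, ∀ x, ‖x‖ ≤ r → 𝒟.P w₁ t x + g t x (𝒟.G w₁ t x) ≤ 0 := by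
    intro t ht x hx
    have h1 := hD₁ (t, x) ⟨ht, by simpa using hx⟩
    have h2 : parOp 𝒟.a 𝒟.σ Ψ t x + g t x (sigGrad 𝒟.σ Ψ t x) ≤ |D₁| :=
      (le_abs_self _).trans (h1.trans (le_abs_self D₁))
    have h3 : |D₁| ≤ c := le_max_left _ _
    rw [P, G, hΨt.parOp_add (isTest_time 𝒟.T c), hΨt.sigGrad_add (isTest_time 𝒟.T c), parOp_time,
      sigGrad_time, add_zero]
    linarith
  set w : ℝ → En n → ℝ := fun t x => min (w₁ t x) (Θ t x) with hw
  have hwc : Continuous (fun p : ℝ × En n => w p.1 p.2) := hw1t.continuous.min hΘ.continuous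
  refine ⟨w, super_iff.2 ⟨hwc.continuousOn.lowerSemicontinuousOn, fun x => ?_, ?_⟩,
    hwc.continuousOn, fun t ht x => ?_, ?_⟩
  · have hT' := right_mem_Icc.2 hT.le
    exact le_min (hψw _ hT' x) ((le_abs_self _).trans (hψΘ _ hT' x))
  · intro t ht x φ hφ he hm
    have ht' := Ico_subset_Icc_self ht
    by_cases hlt : w₁ t x < Θ t x
    · have hwx : w t x = w₁ t x := min_eq_left hlt.le
      obtain ⟨hx, htη⟩ := hnear t ht' x hlt
      refine ⟨M_le fun b => ?_, (operator_le_of_touch hφ hw1t ht ?_).trans (hw1P t ht' x hx)⟩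
      · have h1 : w t (𝒟.Γ t x b) ≤ w₁ t (𝒟.Γ t x b) := min_le_left _ _
        have h2 := hgap t ht' x hx htη b
        have h3 := hψ'2 (𝒟.Γ t x b)
        have h4 := hψ'1 x
        have h5 : wt (m + 3) R (𝒟.Γ t x b) ≤ wt (m + 3) R x :=
          wt_mono _ (𝒟.hK.le.trans hKR) ((𝒟.hΓb t ht' x b).trans (max_le_max hKR le_rfl))
        have h6 : ε₂ ≤ ε₁ := min_le_right _ _
        rw [hwx]
        simp only [hw1, hΨ] at h1 ⊢
        linarith
      · filter_upwards [hm] with p hp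
        have h1 : w p.1 p.2 ≤ w₁ p.1 p.2 := min_le_left _ _
        linarith
    · have hwx : w t x = Θ t x := min_eq_right (not_lt.1 hlt)
      refine ⟨M_le fun b => ?_, (operator_le_of_touch hφ hΘ ht ?_).trans (hΘP t ht' x)⟩
      · have h1 : w t (𝒟.Γ t x b) ≤ Θ t (𝒟.Γ t x b) := min_le_right _ _
        have h2 := hΘm t ht' x _ (𝒟.hΓb t ht' x b)
        have h3 := 𝒟.hℓlb t ht' x b
        have := 𝒟.hδ
        linarith
      · filter_upwards [hm] with p hp
        have h1 : w p.1 p.2 ≤ Θ p.1 p.2 := min_le_right _ _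
        linarith
  · refine abs_le.2 ⟨le_min ?_ ?_, min_le_right _ _⟩
    · exact ((abs_le.1 (hψΘ t ht x)).1).trans (hψw t ht x)
    · linarith [hΘ0 t ht x]
  · have h1 : w 𝒟.T x₀ ≤ w₁ 𝒟.T x₀ := min_le_left _ _
    have h2 : wt (m + 3) R x₀ = 1 := wt_eq_one (by omega) (le_max_right _ _)
    have h3 := hψ'2 x₀
    have h4 : ε₂ ≤ ε := min_le_left _ _
    simp only [hw1, hΨ, h2, sub_self, mul_zero] at h1
    linarith

end QVIData

end Barriers

section Envelopes

variable {n : ℕ} {T : ℝ} {F w : ℝ → En n → ℝ}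

/-- Upper semicontinuous envelope on the strip, extended by zero. -/
def upperEnv (T : ℝ) (F : ℝ → En n → ℝ) (t : ℝ) (x : En n) : ℝ :=
  (Icc 0 T).indicator
    (fun t => sInf {c | ∀ᶠ q : ℝ × En n in 𝓝[Strip n T] (t, x), F q.1 q.2 ≤ c}) t

/-- Lower semicontinuous envelope on the strip, extended by zero. -/
def lowerEnv (T : ℝ) (F : ℝ → En n → ℝ) (t : ℝ) (x : En n) : ℝ :=
  -upperEnv T (fun t x => -F t x) t x

lemma upperEnv_of_notMem {t : ℝ} (ht : t ∉ Icc 0 T) (x : En n) : upperEnv T F t x = 0 :=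
  indicator_of_notMem ht _

lemma lowerEnv_of_notMem {t : ℝ} (ht : t ∉ Icc 0 T) (x : En n) : lowerEnv T F t x = 0 := by
  rw [lowerEnv, upperEnv_of_notMem ht, neg_zero]

lemma upperEnv_of_mem {t : ℝ} (ht : t ∈ Icc 0 T) (x : En n) : upperEnv T F t x =
    sInf {c | ∀ᶠ q : ℝ × En n in 𝓝[Strip n T] (t, x), F q.1 q.2 ≤ c} := by
  rw [upperEnv, indicator_of_mem ht]

lemma le_of_eventually_env {t : ℝ} (ht : t ∈ Icc 0 T) {x : En n} {c : ℝ}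
    (h : ∀ᶠ q : ℝ × En n in 𝓝[Strip n T] (t, x), F q.1 q.2 ≤ c) : F t x ≤ c :=
  h.self_of_nhdsWithin (⟨ht, mem_univ x⟩ : (t, x) ∈ Strip n T)

lemma upperEnv_le_of_eventually {t : ℝ} (ht : t ∈ Icc 0 T) {x : En n} {c : ℝ}
    (h : ∀ᶠ q : ℝ × En n in 𝓝[Strip n T] (t, x), F q.1 q.2 ≤ c) : upperEnv T F t x ≤ c := by
  rw [upperEnv_of_mem ht]
  exact csInf_le ⟨F t x, fun c hc => le_of_eventually_env ht hc⟩ h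

lemma frequently_of_lt_upperEnv {t : ℝ} (ht : t ∈ Icc 0 T) {x : En n} {c : ℝ}
    (h : c < upperEnv T F t x) : ∃ᶠ q : ℝ × En n in 𝓝[Strip n T] (t, x), c < F q.1 q.2 := by
  intro h'
  refine h.not_ge (upperEnv_le_of_eventually ht ?_)
  simpa using h'

lemma frequently_of_lowerEnv_lt {t : ℝ} (ht : t ∈ Icc 0 T) {x : En n} {c : ℝ}
    (h : lowerEnv T F t x < c) : ∃ᶠ q : ℝ × En n in 𝓝[Strip n T] (t, x), F q.1 q.2 < c := by
  refine (frequently_of_lt_upperEnv ht (neg_lt.1 h)).mono fun q hq => ?_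
  linarith

lemma upperEnv_le (hw : ContinuousOn (fun p : ℝ × En n => w p.1 p.2) (Strip n T))
    (h : ∀ t ∈ Icc 0 T, ∀ x, F t x ≤ w t x) {t : ℝ} (ht : t ∈ Icc 0 T) (x : En n) :
    upperEnv T F t x ≤ w t x := by
  refine le_of_forall_pos_le_add fun ε hε => upperEnv_le_of_eventually ht ?_
  have := (hw (t, x) ⟨ht, mem_univ x⟩).tendsto.eventually
    (gt_mem_nhds (show w t x < w t x + ε by linarith))
  filter_upwards [this, self_mem_nhdsWithin] with q hq hq'
  exact (h q.1 hq'.1 q.2).trans hq.le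

lemma le_lowerEnv (hw : ContinuousOn (fun p : ℝ × En n => w p.1 p.2) (Strip n T))
    (h : ∀ t ∈ Icc 0 T, ∀ x, w t x ≤ F t x) {t : ℝ} (ht : t ∈ Icc 0 T) (x : En n) :
    w t x ≤ lowerEnv T F t x :=
  le_neg.1 (upperEnv_le (w := fun t x => -w t x) hw.neg (fun t ht x => neg_le_neg (h t ht x)) ht x)

lemma exists_eventually_le (hw : ContinuousOn (fun p : ℝ × En n => w p.1 p.2) (Strip n T))
    (h : ∀ t ∈ Icc 0 T, ∀ x, F t x ≤ w t x) {t : ℝ} (ht : t ∈ Icc 0 T) (x : En n) :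
    {c | ∀ᶠ q : ℝ × En n in 𝓝[Strip n T] (t, x), F q.1 q.2 ≤ c}.Nonempty := by
  refine ⟨w t x + 1, ?_⟩
  have := (hw (t, x) ⟨ht, mem_univ x⟩).tendsto.eventually
    (gt_mem_nhds (show w t x < w t x + 1 by linarith))
  filter_upwards [this, self_mem_nhdsWithin] with q hq hq'
  exact (h q.1 hq'.1 q.2).trans hq.le

lemma le_upperEnv (hw : ContinuousOn (fun p : ℝ × En n => w p.1 p.2) (Strip n T))
    (h : ∀ t ∈ Icc 0 T, ∀ x, F t x ≤ w t x) {t : ℝ} (ht : t ∈ Icc 0 T) (x : En n) :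
    F t x ≤ upperEnv T F t x := by
  rw [upperEnv_of_mem ht]
  exact le_csInf (exists_eventually_le hw h ht x) fun c hc => le_of_eventually_env ht hc

lemma usc_upperEnv (hw : ContinuousOn (fun p : ℝ × En n => w p.1 p.2) (Strip n T))
    (h : ∀ t ∈ Icc 0 T, ∀ x, F t x ≤ w t x) :
    UpperSemicontinuousOn (fun p : ℝ × En n => upperEnv T F p.1 p.2) (Strip n T) := by
  intro p hp c hc
  dsimp only at hc
  rw [upperEnv_of_mem hp.1] at hc
  obtain ⟨c', hc', hlt⟩ := exists_lt_of_csInf_lt (exists_eventually_le hw h hp.1 p.2) hc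
  filter_upwards [eventually_eventually_nhdsWithin.2 hc', self_mem_nhdsWithin] with q hq hq'
  exact (upperEnv_le_of_eventually hq'.1 hq).trans_lt hlt

lemma lowerEnv_le (hw : ContinuousOn (fun p : ℝ × En n => w p.1 p.2) (Strip n T))
    (h : ∀ t ∈ Icc 0 T, ∀ x, -w t x ≤ F t x) {t : ℝ} (ht : t ∈ Icc 0 T) (x : En n) :
    lowerEnv T F t x ≤ F t x :=
  neg_le.1 (le_upperEnv (F := fun t x => -F t x) hw (fun t ht x => neg_le.1 (h t ht x)) ht x)

lemma lsc_lowerEnv (hw : ContinuousOn (fun p : ℝ × En n => w p.1 p.2) (Strip n T))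
    (h : ∀ t ∈ Icc 0 T, ∀ x, -w t x ≤ F t x) :
    LowerSemicontinuousOn (fun p : ℝ × En n => lowerEnv T F p.1 p.2) (Strip n T) :=
  fun p hp c hc => (usc_upperEnv (F := fun t x => -F t x) hw (fun t ht x => neg_le.1 (h t ht x))
    p hp (-c) (by simp only [lowerEnv] at hc; dsimp only; linarith)).mono fun q hq => by
      simp only [lowerEnv]; dsimp only at hq; linarith

end Envelopes

section Perron

variable {n d : ℕ} {U : Type} [MetricSpace U] [CompactSpace U] [Nonempty U]

/-- `Θ` dominates the data: `Θ` is a supersolution, `-Θ` a subsolution, and `|ψ| ≤ Θ`. -/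
structure Dominates (𝒟 : QVIData n d U) (k : ℝ) (m : ℕ) (g : ℝ → En n → Ed d → ℝ)
    (ψ : En n → ℝ) (Θ : ℝ → En n → ℝ) : Prop where
  k_nonneg : 0 ≤ k
  driver : IsDriver 𝒟.T k g
  test : IsTest Θ
  growth : HasGrowth 𝒟.T (m + 3) 𝒟.K Θ
  upper : ∀ t ∈ Icc 0 𝒟.T, ∀ x, 𝒟.P Θ t x + g t x (𝒟.G Θ t x) ≤ 0
  lower : ∀ t ∈ Icc 0 𝒟.T, ∀ x, 0 ≤ -𝒟.P Θ t x + g t x (-𝒟.G Θ t x)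
  mono : ∀ t ∈ Icc 0 𝒟.T, ∀ x y, ‖y‖ ≤ max 𝒟.K ‖x‖ → Θ t y ≤ Θ t x
  terminal_cont : Continuous ψ
  terminal_le : ∀ t ∈ Icc 0 𝒟.T, ∀ x, |ψ x| ≤ Θ t x
  terminal_jump : ∀ x b, ψ (𝒟.Γ 𝒟.T x b) - 𝒟.ℓ 𝒟.T x b < ψ x

variable {𝒟 : QVIData n d U} {g : ℝ → En n → Ed d → ℝ} {ψ : En n → ℝ} {Θ u v V : ℝ → En n → ℝ}
  {k : ℝ} {m : ℕ}

lemma HasGrowth.of_le {T : ℝ} {R : ℝ} (h : HasGrowth T m R Θ)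
    (hu : ∀ t ∈ Icc (0:ℝ) T, ∀ x, |u t x| ≤ Θ t x) : HasGrowth T m R u := by
  obtain ⟨C, hC⟩ := h
  exact ⟨C, fun t ht x => (hu t ht x).trans ((le_abs_self _).trans (hC t ht x))⟩

lemma IsDriver.reflect {T : ℝ} (hg : IsDriver T k g) :
    IsDriver T k (fun t x z => -g t x (-z)) where
  cont ε hε p hp := by
    obtain ⟨δ', hδ', h⟩ := hg.cont ε hε p hp
    refine ⟨δ', hδ', fun q hq hd z => ?_⟩
    rw [← neg_sub', abs_neg]
    exact h q hq hd (-z)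
  lip t ht x z z' := by
    have := hg.lip t ht x (-z) (-z')
    rw [← neg_sub', norm_neg] at this
    rwa [← neg_sub', abs_neg]

namespace QVIData

/-- The data without interventions. -/
def noJump (𝒟 : QVIData n d U) : QVIData n d U where
  T := 𝒟.T
  Γ := fun _ x _ => x
  ℓ := fun _ _ _ => 1
  a := 𝒟.a
  σ := 𝒟.σ
  K := 𝒟.K
  δ := 1
  Ca := 𝒟.Ca
  ka := 𝒟.ka
  hT := 𝒟.hT
  hK := 𝒟.hK
  hδ := one_pos
  hCa := 𝒟.hCa
  hka := 𝒟.hka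
  hΓc := by fun_prop
  hΓb := fun _ _ _ _ => le_max_right _ _
  hℓc := by fun_prop
  hℓlb := fun _ _ _ _ => le_rfl
  hac := 𝒟.hac
  hσc := 𝒟.hσc
  haσg := 𝒟.haσg
  haσLip := 𝒟.haσLip

/-- Continuous subsolutions almost attaining the terminal value at a given point. -/
lemma exists_lower_barrier (hD : Dominates 𝒟 k m g ψ Θ) (x₀ : En n) {ε : ℝ} (hε : 0 < ε) :
    ∃ w : ℝ → En n → ℝ, 𝒟.Sub g ψ w ∧ ContinuousOn (fun p : ℝ × En n => w p.1 p.2) (Strip n 𝒟.T) ∧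
      (∀ t ∈ Icc 0 𝒟.T, ∀ x, |w t x| ≤ Θ t x) ∧ ψ x₀ - ε ≤ w 𝒟.T x₀ := by
  obtain ⟨w, h1, h2, h3, h4⟩ := exists_upper_barrier (𝒟 := 𝒟.noJump) (ψ := fun x => -ψ x)
    hD.driver.reflect hD.test hD.growth
    (fun t ht x => by
      have : 0 ≤ -𝒟.P Θ t x + g t x (-𝒟.G Θ t x) := hD.lower t ht x
      change 𝒟.P Θ t x + -g t x (-𝒟.G Θ t x) ≤ 0
      linarith)
    hD.mono hD.terminal_cont.neg (fun t ht x => by rw [abs_neg]; exact hD.terminal_le t ht x)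
    (fun x b => by simp [noJump]) x₀ hε
  refine ⟨fun t x => -w t x, sub_iff.2 ⟨h2.neg.upperSemicontinuousOn, fun x => ?_, ?_⟩, h2.neg,
    fun t ht x => by rw [abs_neg]; exact h3 t ht x, ?_⟩
  · exact neg_le.1 (h1.terminal x)
  · intro t ht x φ hφ he hm _
    have key := (h1.le_of_test (x := x) ht (hφ.const_mul (-1)) ?_).2
    · change parOp 𝒟.a 𝒟.σ _ t x + -g t x (-sigGrad 𝒟.σ _ t x) ≤ 0 at key
      rw [hφ.parOp_const_mul, hφ.sigGrad_const_mul, neg_one_smul, neg_neg] at key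
      rw [P, G]
      linarith
    · filter_upwards [hm] with p hp
      linarith
  · change w 𝒟.T x₀ ≤ -ψ x₀ + ε at h4
    dsimp only
    linarith

/-- Comparison for a common local driver. -/
lemma Sub.le_super (hu : 𝒟.Sub g ψ u) (hv : 𝒟.Super g ψ v) (hk : 0 ≤ k) (hg : IsDriver 𝒟.T k g)
    (hug : HasGrowth 𝒟.T (m + 3) 𝒟.K u) (hvg : HasGrowth 𝒟.T (m + 3) 𝒟.K v) {t : ℝ}
    (ht : t ∈ Icc 0 𝒟.T) (x : En n) : u t x ≤ v t x := by
  obtain ⟨C₁, -, h⟩ := exists_comparison (𝒟 := 𝒟) m hk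
  simpa using h 0 0 g g ψ u v le_rfl hg hu hv hug hvg (by simp) t ht x

variable (𝒟 g ψ Θ) in
/-- Subsolutions bounded by `Θ`. -/
def subClass : Set (ℝ → En n → ℝ) :=
  {u | 𝒟.Sub g ψ u ∧ ∀ t ∈ Icc 0 𝒟.T, ∀ x, |u t x| ≤ Θ t x}

variable (𝒟 g ψ Θ) in
/-- Supremum of the subsolutions bounded by `Θ`. -/
def perronSup (t : ℝ) (x : En n) : ℝ := ⨆ u : 𝒟.subClass g ψ Θ, u.1 t x

lemma le_perronSup (hu : u ∈ 𝒟.subClass g ψ Θ) {t : ℝ} (ht : t ∈ Icc 0 𝒟.T) (x : En n) :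
    u t x ≤ 𝒟.perronSup g ψ Θ t x := by
  refine le_ciSup (f := fun u : 𝒟.subClass g ψ Θ => u.1 t x) ⟨Θ t x, ?_⟩ ⟨u, hu⟩
  rintro _ ⟨v, rfl⟩
  exact (abs_le.1 (v.2.2 t ht x)).2

lemma nonempty_subClass (hD : Dominates 𝒟 k m g ψ Θ) : (𝒟.subClass g ψ Θ).Nonempty := by
  obtain ⟨w, h1, -, h3, -⟩ := exists_lower_barrier hD 0 one_pos
  exact ⟨w, h1, h3⟩

lemma exists_of_lt_perronSup (hD : Dominates 𝒟 k m g ψ Θ) {t : ℝ} {x : En n} {c : ℝ}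
    (h : c < 𝒟.perronSup g ψ Θ t x) : ∃ u ∈ 𝒟.subClass g ψ Θ, c < u t x := by
  have := (nonempty_subClass hD).to_subtype
  obtain ⟨u, hu⟩ := exists_lt_of_lt_ciSup h
  exact ⟨u.1, u.2, hu⟩

lemma perronSup_le (hD : Dominates 𝒟 k m g ψ Θ) {t : ℝ} {x : En n} {c : ℝ}
    (h : ∀ u ∈ 𝒟.subClass g ψ Θ, u t x ≤ c) : 𝒟.perronSup g ψ Θ t x ≤ c := by
  have := (nonempty_subClass hD).to_subtype
  exact ciSup_le fun u => h u.1 u.2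

/-- The envelope of the Perron supremum is a subsolution. -/
lemma upperEnv_perronSup_mem (hD : Dominates 𝒟 k m g ψ Θ) :
    upperEnv 𝒟.T (𝒟.perronSup g ψ Θ) ∈ 𝒟.subClass g ψ Θ := by
  set F := 𝒟.perronSup g ψ Θ with hF
  set V := upperEnv 𝒟.T F with hV
  have hΘc : ContinuousOn (fun p : ℝ × En n => Θ p.1 p.2) (Strip n 𝒟.T) :=
    hD.test.continuous.continuousOn
  have hFΘ : ∀ t ∈ Icc 0 𝒟.T, ∀ x, F t x ≤ Θ t x := fun t ht x =>
    perronSup_le hD fun u hu => (abs_le.1 (hu.2 t ht x)).2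
  have hFV : ∀ t ∈ Icc 0 𝒟.T, ∀ x, F t x ≤ V t x := fun t ht x => le_upperEnv hΘc hFΘ ht x
  have huV : ∀ u ∈ 𝒟.subClass g ψ Θ, ∀ t ∈ Icc 0 𝒟.T, ∀ x, u t x ≤ V t x := fun u hu t ht x =>
    (le_perronSup hu ht x).trans (hFV t ht x)
  have hVΘ : ∀ t ∈ Icc 0 𝒟.T, ∀ x, |V t x| ≤ Θ t x := fun t ht x => by
    obtain ⟨u, hu⟩ := nonempty_subClass hD
    exact abs_le.2 ⟨(abs_le.1 (hu.2 t ht x)).1.trans (huV u hu t ht x), upperEnv_le hΘc hFΘ ht x⟩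
  have hVg := hD.growth.of_le hVΘ
  have hVu : UpperSemicontinuousOn (fun p : ℝ × En n => V p.1 p.2) (Strip n 𝒟.T) :=
    usc_upperEnv hΘc hFΘ
  refine ⟨sub_iff.2 ⟨hVu, fun x => ?_, ?_⟩, hVΘ⟩
  · refine le_of_forall_pos_le_add fun ε hε => ?_
    obtain ⟨w, h1, h2, h3, h4⟩ := exists_upper_barrier hD.driver hD.test hD.growth hD.upper hD.mono
      hD.terminal_cont hD.terminal_le hD.terminal_jump x hε
    refine le_trans (upperEnv_le h2 (fun t ht y => perronSup_le hD fun u hu => ?_)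
      (right_mem_Icc.2 𝒟.hT.le) x) h4
    exact hu.1.le_super h1 hD.k_nonneg hD.driver (hD.growth.of_le hu.2) (hD.growth.of_le h3) ht y
  · intro t ht x φ hφ he hm hM
    by_contra! hneg
    have ht' := Ico_subset_Icc_self ht
    have hz := mem_strip (𝒟 := 𝒟) ht' x
    have hφ' := hφ.add (isTest_quartic t x)
    set φ' : ℝ → En n → ℝ := fun s y => φ s y + quartic t x s y with hφ'd
    have hφ'0 : φ' t x = V t x := by simp only [hφ'd, quartic_self, add_zero, he]
    obtain ⟨hQP, hQG⟩ := quartic_jet (a := 𝒟.a) (σm := 𝒟.σ) ht x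
    have hop : 𝒟.P φ' t x + g t x (𝒟.G φ' t x) < 0 := by
      rw [P, G, hφ.parOp_add (isTest_quartic t x), hφ.sigGrad_add (isTest_quartic t x), hQP, hQG,
        add_zero, add_zero]
      exact hneg
    set s₀ := (V t x - 𝒟.M V t x) / 4 with hs₀
    have hs₀0 : 0 < s₀ := by linarith
    have e1 : ∀ᶠ q : ℝ × En n in 𝓝[Strip n 𝒟.T] (t, x), V q.1 q.2 ≤ φ q.1 q.2 := by
      filter_upwards [hm] with q hq
      linarith
    have e2 : ∀ᶠ q : ℝ × En n in 𝓝[Strip n 𝒟.T] (t, x), q.1 < 𝒟.T :=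
      nhdsWithin_le_nhds (continuous_fst.continuousAt.eventually (gt_mem_nhds ht.2))
    have e3 : ∀ᶠ q : ℝ × En n in 𝓝[Strip n 𝒟.T] (t, x),
        𝒟.P φ' q.1 q.2 + g q.1 q.2 (𝒟.G φ' q.1 q.2) < 0 :=
      ((hφ'.continuousOn_parOp 𝒟.hac 𝒟.hσc).add
        (hD.driver.continuousOn (hφ'.continuousOn_sigGrad (σm := 𝒟.σ) 𝒟.hσc)) _ hz).tendsto.eventually
          (gt_mem_nhds hop)
    have e4 : ∀ᶠ q : ℝ × En n in 𝓝[Strip n 𝒟.T] (t, x), 𝒟.M V q.1 q.2 < V t x - 2 * s₀ :=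
      usc_M hVu _ hz _ (by dsimp only; linarith)
    have e5 : ∀ᶠ q : ℝ × En n in 𝓝[Strip n 𝒟.T] (t, x), V t x - s₀ < φ' q.1 q.2 :=
      nhdsWithin_le_nhds (hφ'.continuous.continuousAt.eventually
        (lt_mem_nhds (by dsimp only; rw [hφ'0]; linarith)))
    obtain ⟨r, hr, hball⟩ := (nhdsWithin_hasBasis Metric.nhds_basis_closedBall _).eventually_iff.1
      (e1.and (e2.and (e3.and (e4.and e5))))
    set s := min s₀ (r ^ 4) with hs
    have hs0 : 0 < s := lt_min hs₀0 (by positivity)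
    have f1 := frequently_of_lt_upperEnv (F := F) ht' (x := x) (c := V t x - s / 2) (by
      change _ < V t x
      linarith)
    have f2 : ∀ᶠ q : ℝ × En n in 𝓝[Strip n 𝒟.T] (t, x), φ' q.1 q.2 < V t x + s / 2 :=
      nhdsWithin_le_nhds (hφ'.continuous.continuousAt.eventually
        (gt_mem_nhds (by dsimp only; rw [hφ'0]; linarith)))
    have f3 : ∀ᶠ q : ℝ × En n in 𝓝[Strip n 𝒟.T] (t, x), q ∈ Metric.closedBall (t, x) r :=
      nhdsWithin_le_nhds (Metric.closedBall_mem_nhds _ hr)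
    obtain ⟨q, ⟨⟨q1, q2⟩, q3⟩, q4⟩ :=
      (((f1.and_eventually f2).and_eventually f3).and_eventually self_mem_nhdsWithin).exists
    obtain ⟨u, hu, hqu⟩ := exists_of_lt_perronSup hD q1
    have husc : UpperSemicontinuousOn (fun p : ℝ × En n => u p.1 p.2 - φ' p.1 p.2)
        (Strip n 𝒟.T ∩ Metric.closedBall (t, x) r) := by
      have := (hu.1.usc.mono inter_subset_left).add
        (hφ'.continuous.neg.continuousOn
          (s := Strip n 𝒟.T ∩ Metric.closedBall (t, x) r)).upperSemicontinuousOn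
      simpa [sub_eq_add_neg] using this
    have hqm : q ∈ Strip n 𝒟.T ∩ Metric.closedBall (t, x) r := ⟨q4, q3⟩
    obtain ⟨p, hp, hmax⟩ := husc.exists_isMaxOn ⟨_, hqm⟩ (isCompact_strip_inter _ _ _)
    have p1 := isMaxOn_iff.1 hmax q hqm
    obtain ⟨b1, b2, b3, b4, b5⟩ := hball ⟨hp.2, hp.1⟩
    have p2 := huV u hu p.1 hp.1.1 p.2
    have hss : s ≤ s₀ := min_le_left _ _
    have hsr : s ≤ r ^ 4 := min_le_right _ _
    have p3 : quartic t x p.1 p.2 < r ^ 4 := by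
      simp only [hφ'd] at p1 q2
      linarith
    have p4 : dist p (t, x) < r := by
      have h1 := dist_sq_le_sqDist p (t, x)
      have h2 : (dist p (t, x) ^ 2) ^ 2 ≤ quartic t x p.1 p.2 :=
        pow_le_pow_left₀ (sq_nonneg _) h1 2
      exact lt_of_pow_lt_pow_left₀ 4 hr.le (by nlinarith)
    have p5 : 𝒟.M u p.1 p.2 < u p.1 p.2 := by
      have h1 := M_mono hVg hp.1.1 p.2 (huV u hu p.1 hp.1.1)
      linarith
    refine b3.not_ge (hu.1.le_of_test (t := p.1) (x := p.2) ⟨hp.1.1.1, b2⟩ hφ' ?_ p5)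
    rw [← nhdsWithin_strip_inter p4]
    filter_upwards [self_mem_nhdsWithin] with q hq
    exact isMaxOn_iff.1 hmax q hq

end QVIData

end Perron

section LocalExistence

variable {n d : ℕ} {U : Type} [MetricSpace U] [CompactSpace U] [Nonempty U]

variable {𝒟 : QVIData n d U} {g : ℝ → En n → Ed d → ℝ} {ψ : En n → ℝ} {Θ V φ : ℝ → En n → ℝ}
  {k : ℝ} {m : ℕ}

/-- The function `V` raised to `φ` inside a ball. -/
def bump (V φ : ℝ → En n → ℝ) (p₀ : ℝ × En n) (r : ℝ) (t : ℝ) (x : En n) : ℝ :=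
  if dist (t, x) p₀ < r then max (V t x) (φ t x) else V t x

lemma le_bump (p₀ : ℝ × En n) (r t : ℝ) (x : En n) : V t x ≤ bump V φ p₀ r t x := by
  rw [bump]
  split_ifs
  exacts [le_max_left _ _, le_rfl]

lemma le_bump_of_dist_lt {p₀ : ℝ × En n} {r t : ℝ} {x : En n} (h : dist (t, x) p₀ < r) :
    φ t x ≤ bump V φ p₀ r t x := by
  rw [bump, if_pos h]
  exact le_max_right _ _

lemma bump_eq_or {p₀ : ℝ × En n} {r t : ℝ} {x : En n} :
    bump V φ p₀ r t x = V t x ∨ dist (t, x) p₀ < r ∧ bump V φ p₀ r t x = φ t x := by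
  rw [bump]
  split_ifs with h
  · rcases le_total (V t x) (φ t x) with h' | h'
    · exact Or.inr ⟨h, max_eq_right h'⟩
    · exact Or.inl (max_eq_left h')
  · exact Or.inl rfl

lemma usc_bump {T : ℝ} (hV : UpperSemicontinuousOn (fun p : ℝ × En n => V p.1 p.2) (Strip n T))
    (hφ : Continuous (fun p : ℝ × En n => φ p.1 p.2)) {p₀ : ℝ × En n} {r : ℝ} (hr : 0 < r)
    (h : ∀ q ∈ Strip n T, dist q p₀ ≤ r → r / 2 ≤ dist q p₀ → φ q.1 q.2 ≤ V q.1 q.2) :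
    UpperSemicontinuousOn (fun p : ℝ × En n => bump V φ p₀ r p.1 p.2) (Strip n T) := by
  intro p hp c hc
  have e1 := hV p hp c ((le_bump p₀ r p.1 p.2).trans_lt hc)
  rcases lt_or_ge (dist p p₀) r with hd | hd
  · have e2 : ∀ᶠ q : ℝ × En n in 𝓝[Strip n T] p, φ q.1 q.2 < c :=
      nhdsWithin_le_nhds (hφ.continuousAt.eventually
        (gt_mem_nhds ((le_bump_of_dist_lt hd).trans_lt hc)))
    filter_upwards [e1, e2] with q h1 h2
    rcases bump_eq_or (V := V) (φ := φ) (p₀ := p₀) (r := r) (t := q.1) (x := q.2) with h3 | ⟨-, h3⟩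
    · rwa [h3]
    · rwa [h3]
  · have e2 : ∀ᶠ q : ℝ × En n in 𝓝[Strip n T] p, r / 2 < dist q p₀ :=
      nhdsWithin_le_nhds ((continuous_id.dist continuous_const).continuousAt.eventually
        (lt_mem_nhds (show r / 2 < dist p p₀ by linarith)))
    filter_upwards [e1, e2, self_mem_nhdsWithin] with q h1 h2 hq
    rcases bump_eq_or (V := V) (φ := φ) (p₀ := p₀) (r := r) (t := q.1) (x := q.2) with h3 | ⟨h4, h3⟩
    · rwa [h3]
    · rw [h3]
      exact (h q hq h4.le h2.le).trans_lt h1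

namespace QVIData

lemma bump_mem_subClass (hΘ : HasGrowth 𝒟.T m 𝒟.K Θ) (hV : V ∈ 𝒟.subClass g ψ Θ) (hφ : IsTest φ)
    {p₀ : ℝ × En n} {r : ℝ} (hr : 0 < r)
    (h : ∀ q ∈ Strip n 𝒟.T, dist q p₀ ≤ r → r / 2 ≤ dist q p₀ → φ q.1 q.2 ≤ V q.1 q.2)
    (h' : ∀ q ∈ Strip n 𝒟.T, dist q p₀ ≤ r → q.1 < 𝒟.T ∧ φ q.1 q.2 ≤ Θ q.1 q.2 ∧
      (φ q.1 q.2 ≤ 𝒟.M V q.1 q.2 ∨ 0 ≤ 𝒟.P φ q.1 q.2 + g q.1 q.2 (𝒟.G φ q.1 q.2))) :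
    bump V φ p₀ r ∈ 𝒟.subClass g ψ Θ := by
  have hbd : ∀ t ∈ Icc 0 𝒟.T, ∀ x, |bump V φ p₀ r t x| ≤ Θ t x := fun t ht x => by
    refine abs_le.2 ⟨(abs_le.1 (hV.2 t ht x)).1.trans (le_bump _ _ _ _), ?_⟩
    rcases bump_eq_or (V := V) (φ := φ) (p₀ := p₀) (r := r) (t := t) (x := x) with h3 | ⟨h4, h3⟩
    · rw [h3]
      exact (abs_le.1 (hV.2 t ht x)).2
    · rw [h3]
      exact (h' (t, x) (mem_strip ht x) h4.le).2.1
  refine ⟨sub_iff.2 ⟨usc_bump hV.1.usc hφ.continuous hr h, fun x => ?_, ?_⟩, hbd⟩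
  · rcases bump_eq_or (V := V) (φ := φ) (p₀ := p₀) (r := r) (t := 𝒟.T) (x := x) with h3 | ⟨h4, -⟩
    · rw [h3]
      exact hV.1.terminal x
    · exact absurd (h' (𝒟.T, x) (mem_strip (right_mem_Icc.2 𝒟.hT.le) x) h4.le).1 (lt_irrefl _)
  · intro t ht x φ₁ hφ₁ he hm hM
    have ht' := Ico_subset_Icc_self ht
    have hMM : 𝒟.M V t x ≤ 𝒟.M (bump V φ p₀ r) t x := by
      obtain ⟨C, hC⟩ := hΘ
      exact M_mono (m := m) ⟨C, fun t ht x => (hbd t ht x).trans ((le_abs_self _).trans (hC t ht x))⟩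
        ht' x fun y => le_bump _ _ _ _
    rcases bump_eq_or (V := V) (φ := φ) (p₀ := p₀) (r := r) (t := t) (x := x) with h3 | ⟨h4, h3⟩
    · refine hV.1.le_of_test ht hφ₁ ?_ (by linarith)
      filter_upwards [hm] with q hq
      have := le_bump (V := V) (φ := φ) p₀ r q.1 q.2
      linarith
    · rcases (h' (t, x) (mem_strip ht' x) h4.le).2.2 with h5 | h5
      · dsimp only at h5
        linarith
      · refine h5.trans (operator_le_of_touch hφ hφ₁ ht ?_)
        have e1 : ∀ᶠ q : ℝ × En n in 𝓝[Strip n 𝒟.T] (t, x), dist q p₀ < r :=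
          nhdsWithin_le_nhds ((continuous_id.dist continuous_const).continuousAt.eventually
            (gt_mem_nhds h4))
        filter_upwards [hm, e1] with q hq hq'
        have := le_bump_of_dist_lt (V := V) (φ := φ) (x := q.2) hq'
        linarith

/-- The lower envelope of a maximal subsolution is a supersolution. -/
lemma super_lowerEnv (hD : Dominates 𝒟 k m g ψ Θ) (hV : V ∈ 𝒟.subClass g ψ Θ)
    (hmax : ∀ u ∈ 𝒟.subClass g ψ Θ, ∀ t ∈ Icc 0 𝒟.T, ∀ x, u t x ≤ V t x) :
    𝒟.Super g ψ (lowerEnv 𝒟.T V) := by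
  set L := lowerEnv 𝒟.T V with hL
  have hΘc := hD.test.continuous
  have hnV : ∀ t ∈ Icc 0 𝒟.T, ∀ x, -Θ t x ≤ V t x := fun t ht x => (abs_le.1 (hV.2 t ht x)).1
  have hLV : ∀ t ∈ Icc 0 𝒟.T, ∀ x, L t x ≤ V t x := fun t ht x =>
    lowerEnv_le hΘc.continuousOn hnV ht x
  have hLΘ : ∀ t ∈ Icc 0 𝒟.T, ∀ x, |L t x| ≤ Θ t x := fun t ht x =>
    abs_le.2 ⟨le_lowerEnv (w := fun t x => -Θ t x) hΘc.continuousOn.neg hnV ht x,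
      (hLV t ht x).trans (abs_le.1 (hV.2 t ht x)).2⟩
  have hLl : LowerSemicontinuousOn (fun p : ℝ × En n => L p.1 p.2) (Strip n 𝒟.T) :=
    lsc_lowerEnv hΘc.continuousOn hnV
  refine super_iff.2 ⟨hLl, fun x => ?_, ?_⟩
  · refine le_of_forall_pos_le_add fun ε hε => ?_
    obtain ⟨w, h1, h2, h3, h4⟩ := exists_lower_barrier hD x hε
    have := le_lowerEnv h2 (hmax w ⟨h1, h3⟩) (right_mem_Icc.2 𝒟.hT.le) x
    linarith
  intro t ht x φ hφ he hm
  have ht' := Ico_subset_Icc_self ht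
  have hz := mem_strip (𝒟 := 𝒟) ht' x
  rcases ((le_abs_self _).trans (hLΘ t ht' x)).eq_or_lt with heq | hlt
  · refine ⟨M_le fun b => ?_, (operator_le_of_touch hφ hD.test ht ?_).trans (hD.upper t ht' x)⟩
    · have h1 := (le_abs_self _).trans (hLΘ t ht' (𝒟.Γ t x b))
      have h2 := hD.mono t ht' x _ (𝒟.hΓb t ht' x b)
      have h3 := 𝒟.hℓlb t ht' x b
      have := 𝒟.hδ
      linarith
    · filter_upwards [hm, self_mem_nhdsWithin] with q hq hq'
      have := (le_abs_self _).trans (hLΘ q.1 hq'.1 q.2)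
      linarith
  by_contra hneg
  have hφ' := hφ.sub (isTest_quartic t x)
  set φ' : ℝ → En n → ℝ := fun s y => φ s y - quartic t x s y with hφ'd
  have hφ'0 : φ' t x = L t x := by simp only [hφ'd, quartic_self, sub_zero, he]
  obtain ⟨hQP, hQG⟩ := quartic_jet (a := 𝒟.a) (σm := 𝒟.σ) ht x
  have hgap : ∃ γ > (0:ℝ), ∀ᶠ q : ℝ × En n in 𝓝[Strip n 𝒟.T] (t, x),
      φ' q.1 q.2 + γ < 𝒟.M L q.1 q.2 ∨
        0 < 𝒟.P φ' q.1 q.2 + g q.1 q.2 (𝒟.G φ' q.1 q.2) := by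
    by_cases hM : 𝒟.M L t x ≤ L t x
    · have hop : 0 < 𝒟.P φ' t x + g t x (𝒟.G φ' t x) := by
        rw [P, G, hφ.parOp_sub (isTest_quartic t x), hφ.sigGrad_sub (isTest_quartic t x), hQP, hQG,
          sub_zero, sub_zero]
        exact not_le.1 fun h => hneg ⟨hM, h⟩
      refine ⟨1, one_pos, ?_⟩
      have := (((hφ'.continuousOn_parOp 𝒟.hac 𝒟.hσc).add
        (hD.driver.continuousOn (hφ'.continuousOn_sigGrad (σm := 𝒟.σ) 𝒟.hσc)))
          _ hz).tendsto.eventually (lt_mem_nhds hop)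
      filter_upwards [this] with q hq
      exact Or.inr hq
    · refine ⟨(𝒟.M L t x - L t x) / 3, by linarith, ?_⟩
      have e1 := lsc_M (hD.growth.of_le hLΘ) hLl _ hz (L t x + 2 * ((𝒟.M L t x - L t x) / 3))
        (by dsimp only; linarith)
      have e2 : ∀ᶠ q : ℝ × En n in 𝓝[Strip n 𝒟.T] (t, x),
          φ' q.1 q.2 < L t x + (𝒟.M L t x - L t x) / 3 :=
        nhdsWithin_le_nhds (hφ'.continuous.continuousAt.eventually
          (gt_mem_nhds (by dsimp only; rw [hφ'0]; linarith)))
      filter_upwards [e1, e2] with q h1 h2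
      left
      linarith
  obtain ⟨γ₀, hγ₀, e1⟩ := hgap
  have e2 : ∀ᶠ q : ℝ × En n in 𝓝[Strip n 𝒟.T] (t, x), φ q.1 q.2 ≤ L q.1 q.2 := by
    filter_upwards [hm] with q hq
    linarith
  have e3 : ∀ᶠ q : ℝ × En n in 𝓝[Strip n 𝒟.T] (t, x), q.1 < 𝒟.T :=
    nhdsWithin_le_nhds (continuous_fst.continuousAt.eventually (gt_mem_nhds ht.2))
  set γ₁ := (Θ t x - L t x) / 2 with hγ₁
  have e4 : ∀ᶠ q : ℝ × En n in 𝓝[Strip n 𝒟.T] (t, x), φ' q.1 q.2 + γ₁ < Θ q.1 q.2 := by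
    refine nhdsWithin_le_nhds (((hφ'.sub hD.test).continuous.continuousAt.eventually
      (gt_mem_nhds (show φ' t x - Θ t x < -γ₁ by linarith))).mono fun q hq => ?_)
    linarith
  obtain ⟨r, hr, hball⟩ := (nhdsWithin_hasBasis Metric.nhds_basis_closedBall _).eventually_iff.1
    (e1.and (e2.and (e3.and e4)))
  set γ := min (min γ₀ γ₁) ((r / 2) ^ 4) with hγ
  have hγ0 : 0 < γ := lt_min (lt_min hγ₀ (by linarith)) (by positivity)
  have hγa : γ ≤ γ₀ := (min_le_left _ _).trans (min_le_left _ _)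
  have hγb : γ ≤ γ₁ := (min_le_left _ _).trans (min_le_right _ _)
  have hγc : γ ≤ (r / 2) ^ 4 := min_le_right _ _
  have hφγ := hφ'.add (isTest_const γ)
  have hmem := bump_mem_subClass (p₀ := (t, x)) (r := r) hD.growth hV hφγ hr ?_ ?_
  · have f1 := frequently_of_lowerEnv_lt (F := V) ht' (x := x) (c := L t x + γ / 2) (by
      change L t x < _
      linarith)
    have f2 : ∀ᶠ q : ℝ × En n in 𝓝[Strip n 𝒟.T] (t, x), L t x - γ / 2 < φ' q.1 q.2 :=
      nhdsWithin_le_nhds (hφ'.continuous.continuousAt.eventually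
        (lt_mem_nhds (by dsimp only; rw [hφ'0]; linarith)))
    have f3 : ∀ᶠ q : ℝ × En n in 𝓝[Strip n 𝒟.T] (t, x), q ∈ Metric.ball (t, x) r :=
      nhdsWithin_le_nhds (Metric.ball_mem_nhds _ hr)
    obtain ⟨q, ⟨⟨q1, q2⟩, q3⟩, q4⟩ :=
      (((f1.and_eventually f2).and_eventually f3).and_eventually self_mem_nhdsWithin).exists
    have h1 := hmax _ hmem q.1 q4.1 q.2
    have h2 := le_bump_of_dist_lt (V := V) (φ := fun s y => φ' s y + γ) (x := q.2)
      (Metric.mem_ball.1 q3)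
    linarith
  · intro q hq hd hd'
    have h1 := (hball ⟨Metric.mem_closedBall.2 hd, hq⟩).2.1
    have h2 := hLV q.1 hq.1 q.2
    have h3 : (dist q (t, x) ^ 2) ^ 2 ≤ quartic t x q.1 q.2 :=
      pow_le_pow_left₀ (sq_nonneg _) (dist_sq_le_sqDist q (t, x)) 2
    have h4 : (r / 2) ^ 4 ≤ dist q (t, x) ^ 4 := pow_le_pow_left₀ (by positivity) hd' 4
    have h5 : dist q (t, x) ^ 4 = (dist q (t, x) ^ 2) ^ 2 := by ring
    simp only [hφ'd]
    linarith
  · intro q hq hd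
    obtain ⟨b1, b2, b3, b4⟩ := hball ⟨Metric.mem_closedBall.2 hd, hq⟩
    refine ⟨b3, by linarith, b1.imp (fun h => ?_) fun h => ?_⟩
    · have := M_mono (hD.growth.of_le hV.2) hq.1 q.2 (hLV q.1 hq.1)
      linarith
    · rw [P, G, hφ'.parOp_add (isTest_const γ), hφ'.sigGrad_add (isTest_const γ), parOp_const,
        sigGrad_const, add_zero, add_zero]
      exact h.le

/-- Existence for local drivers. -/
lemma exists_local_solution (hD : Dominates 𝒟 k m g ψ Θ) :
    ∃ V : ℝ → En n → ℝ, 𝒟.Sub g ψ V ∧ 𝒟.Super g ψ V ∧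
      (∀ t ∈ Icc 0 𝒟.T, ∀ x, |V t x| ≤ Θ t x) ∧ ∀ t ∉ Icc 0 𝒟.T, ∀ x, V t x = 0 := by
  set V := upperEnv 𝒟.T (𝒟.perronSup g ψ Θ) with hVd
  have hΘc : ContinuousOn (fun p : ℝ × En n => Θ p.1 p.2) (Strip n 𝒟.T) :=
    hD.test.continuous.continuousOn
  have hV : V ∈ 𝒟.subClass g ψ Θ := upperEnv_perronSup_mem hD
  have hmax : ∀ u ∈ 𝒟.subClass g ψ Θ, ∀ t ∈ Icc 0 𝒟.T, ∀ x, u t x ≤ V t x := fun u hu t ht x =>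
    (le_perronSup hu ht x).trans (le_upperEnv hΘc
      (fun t ht x => perronSup_le hD fun u hu => (abs_le.1 (hu.2 t ht x)).2) ht x)
  have hS := super_lowerEnv hD hV hmax
  have hnV : ∀ t ∈ Icc 0 𝒟.T, ∀ x, -Θ t x ≤ V t x := fun t ht x => (abs_le.1 (hV.2 t ht x)).1
  have hLV : ∀ t ∈ Icc 0 𝒟.T, ∀ x, lowerEnv 𝒟.T V t x ≤ V t x := fun t ht x =>
    lowerEnv_le hΘc hnV ht x
  have hLΘ : ∀ t ∈ Icc 0 𝒟.T, ∀ x, |lowerEnv 𝒟.T V t x| ≤ Θ t x := fun t ht x =>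
    abs_le.2 ⟨le_lowerEnv (w := fun t x => -Θ t x) hΘc.neg hnV ht x,
      (hLV t ht x).trans (abs_le.1 (hV.2 t ht x)).2⟩
  have heq : lowerEnv 𝒟.T V = V := by
    funext t x
    by_cases ht : t ∈ Icc 0 𝒟.T
    · exact (hLV t ht x).antisymm (hV.1.le_super hS hD.k_nonneg hD.driver (hD.growth.of_le hV.2)
        (hD.growth.of_le hLΘ) ht x)
    · rw [lowerEnv_of_notMem ht, hVd, upperEnv_of_notMem ht]
  rw [heq] at hS
  exact ⟨V, hV.1, hS, hV.2, fun t ht x => upperEnv_of_notMem ht x⟩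

end QVIData

end LocalExistence

section FixedPoint

variable {n d : ℕ} {T R : ℝ} {m : ℕ} {u v w : ℝ → En n → ℝ}

lemma continuous_slice (hv : ContinuousOn (fun p : ℝ × En n => v p.1 p.2) (Strip n T)) {t : ℝ}
    (ht : t ∈ Icc 0 T) : Continuous (v t) :=
  hv.comp_continuous (f := fun x : En n => (t, x)) (by fun_prop) fun x => ⟨ht, mem_univ x⟩

lemma HasGrowth.exists_le_expWt (h : HasGrowth T m R u) {c : ℝ} (hc : 0 ≤ c) :
    ∃ s ≥ 0, ∀ t ∈ Icc (0:ℝ) T, ∀ x, |u t x| ≤ s * expWt T m R c t x := by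
  obtain ⟨C, hC⟩ := h
  refine ⟨|C|, abs_nonneg C, fun t ht x => (hC t ht x).trans ?_⟩
  exact mul_le_mul (le_abs_self C) (wt_le_expWt m R hc ht.2 x) (wt_pos m R x).le (abs_nonneg C)

lemma hasGrowth_of_le_expWt {s c : ℝ} (hs : 0 ≤ s) (hc : 0 ≤ c)
    (h : ∀ t ∈ Icc (0:ℝ) T, ∀ x, |u t x| ≤ s * expWt T m R c t x) : HasGrowth T m R u := by
  refine ⟨s * Real.exp (c * T), fun t ht x => (h t ht x).trans ?_⟩
  rw [mul_assoc, expWt]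
  have h1 : Real.exp (c * (T - t)) ≤ Real.exp (c * T) :=
    Real.exp_le_exp.2 (mul_le_mul_of_nonneg_left (by linarith [ht.1]) hc)
  exact mul_le_mul_of_nonneg_left (mul_le_mul_of_nonneg_right h1 (wt_pos m R x).le) hs

lemma HasGrowth.polyGrowth (hm : m ≠ 0) (h : HasGrowth T m R u) : PolyGrowth T u := by
  obtain ⟨C, hC⟩ := h
  refine ⟨|C| + 1, by positivity, (2 * m : ℕ), by positivity, fun t ht x => (hC t ht x).trans ?_⟩
  rw [Real.rpow_natCast]
  have h1 : C ≤ |C| + 1 := by linarith [le_abs_self C]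
  exact mul_le_mul h1 (wt_le_one_add m R x) (wt_pos m R x).le (by positivity)

lemma PolyGrowth.exists_hasGrowth (h : PolyGrowth T u) (R : ℝ) :
    ∃ m₀, ∀ m ≥ m₀, HasGrowth T m R u := by
  obtain ⟨C, hC, ρ, hρ, h⟩ := h
  obtain ⟨m₀, hm₀⟩ := exists_nat_ge ρ
  refine ⟨m₀, fun m hm => ?_⟩
  have hm' : (m₀ : ℝ) ≤ m := by exact_mod_cast hm
  have hm0 : (0 : ℝ) ≤ m := Nat.cast_nonneg m
  obtain ⟨C', hC', h'⟩ := exists_growth_le_wt (n := n) hρ.le (m := m) (by linarith) R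
  refine ⟨C * C', fun t ht x => (h t ht x).trans ?_⟩
  rw [mul_assoc]
  exact mul_le_mul_of_nonneg_left (h' x) hC.le

/-- The standing assumptions on the non-local driver. -/
structure IsNLDriver (T K k C ρ : ℝ) (f : ℝ → En n → (En n → ℝ) → Ed d → ℝ) : Prop where
  cont : ∀ v : ℝ → En n → ℝ, PGc T v → ∀ ε > (0:ℝ), ∀ p ∈ Strip n T, ∃ δ' > (0:ℝ),
    ∀ q ∈ Strip n T, dist q p ≤ δ' → ∀ z : Ed d, |f q.1 q.2 (v q.1) z - f p.1 p.2 (v p.1) z| ≤ ε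
  growth : ∀ t ∈ Icc (0:ℝ) T, ∀ x : En n, |f t x 0 0| ≤ C * (1 + ‖x‖ ^ ρ)
  lip : ∀ t ∈ Icc (0:ℝ) T, ∀ x : En n, ∀ g g' : En n → ℝ, Continuous g → Continuous g' →
    ∀ z z' : Ed d, |f t x g' z' - f t x g z| ≤
      k * (sSup ((fun x' : En n => |g' x' - g x'|) '' Metric.closedBall 0 (max ‖x‖ K)) + ‖z' - z‖)

/-- The local driver obtained by freezing the non-local argument. -/
def frozen (f : ℝ → En n → (En n → ℝ) → Ed d → ℝ) (v : ℝ → En n → ℝ) (t : ℝ) (x : En n)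
    (z : Ed d) : ℝ := f t x (v t) z

variable {f : ℝ → En n → (En n → ℝ) → Ed d → ℝ} {K k C ρ : ℝ}

lemma IsNLDriver.abs_sub_le (hf : IsNLDriver T K k C ρ f) (hk : 0 ≤ k) (hK : 0 ≤ K) {c s t : ℝ}
    (ht : t ∈ Icc 0 T) (hs : 0 ≤ s) {g g' : En n → ℝ} (hg : Continuous g) (hg' : Continuous g')
    (h : ∀ x, |g' x - g x| ≤ s * expWt T m K c t x) (x : En n) (z z' : Ed d) :
    |f t x g' z' - f t x g z| ≤ k * (s * expWt T m K c t x + ‖z' - z‖) := by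
  refine (hf.lip t ht x g g' hg hg' z z').trans ?_
  refine mul_le_mul_of_nonneg_left (add_le_add_left ?_ _) hk
  refine Real.sSup_le ?_ (mul_nonneg hs (expWt_pos _ _ _ _ _ _).le)
  rintro _ ⟨y, hy, rfl⟩
  refine (h y).trans (mul_le_mul_of_nonneg_left (expWt_mono T m hK c t ?_) hs)
  rw [max_comm]
  exact mem_closedBall_zero_iff.1 hy

lemma IsNLDriver.frozen (hf : IsNLDriver T K k C ρ f) (hk : 0 ≤ k) (hK : 0 ≤ K) (hv : PGc T v) :
    IsDriver T k (frozen f v) where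
  cont := hf.cont v hv
  lip t ht x z z' := by
    have hc := continuous_slice hv.2 ht
    simpa [_root_.frozen] using hf.abs_sub_le (m := 0) (c := 0) hk hK ht le_rfl hc hc (by simp) x z z'

namespace QVIData

variable {U : Type} [MetricSpace U] [CompactSpace U] [Nonempty U]

variable {𝒟 : QVIData n d U} {ψ : En n → ℝ}

lemma continuousOn_of_sub_super {g : ℝ → En n → Ed d → ℝ} (h : 𝒟.Sub g ψ v)
    (h' : 𝒟.Super g ψ v) : ContinuousOn (fun p : ℝ × En n => v p.1 p.2) (Strip n 𝒟.T) :=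
  continuousOn_iff_lower_upperSemicontinuousOn.2 ⟨h'.lsc, h.usc⟩

/-- The solution map contracts in a suitably weighted norm. -/
lemma exists_contraction (hf : IsNLDriver 𝒟.T 𝒟.K k C ρ f) (hk : 0 ≤ k) (m : ℕ) :
    ∃ lam₀ ≥ 0, ∀ lam ≥ lam₀, ∀ (ψ : En n → ℝ) (v v' V V' : ℝ → En n → ℝ) (s : ℝ), 0 ≤ s →
      PGc 𝒟.T v → PGc 𝒟.T v' → 𝒟.Sub (frozen f v) ψ V → 𝒟.Super (frozen f v) ψ V →
      𝒟.Sub (frozen f v') ψ V' → 𝒟.Super (frozen f v') ψ V' →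
      HasGrowth 𝒟.T (m + 3) 𝒟.K V → HasGrowth 𝒟.T (m + 3) 𝒟.K V' →
      (∀ t ∈ Icc 0 𝒟.T, ∀ x, |v t x - v' t x| ≤ s * expWt 𝒟.T (m + 3) 𝒟.K lam t x) →
      ∀ t ∈ Icc 0 𝒟.T, ∀ x, |V t x - V' t x| ≤ s / 2 * expWt 𝒟.T (m + 3) 𝒟.K lam t x := by
  obtain ⟨C₁, hC₁, H⟩ := exists_comparison (𝒟 := 𝒟) m hk
  refine ⟨C₁ + 2 * k, by positivity, fun lam hlam ψ v v' V V' s hs hv hv' h1 h2 h3 h4 h5 h6 hd => ?_⟩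
  have key : ∀ v v' V V' : ℝ → En n → ℝ, PGc 𝒟.T v → PGc 𝒟.T v' → 𝒟.Sub (frozen f v) ψ V →
      𝒟.Super (frozen f v') ψ V' → HasGrowth 𝒟.T (m + 3) 𝒟.K V →
      HasGrowth 𝒟.T (m + 3) 𝒟.K V' →
      (∀ t ∈ Icc 0 𝒟.T, ∀ x, |v t x - v' t x| ≤ s * expWt 𝒟.T (m + 3) 𝒟.K lam t x) →
      ∀ t ∈ Icc 0 𝒟.T, ∀ x, V t x ≤ V' t x + s / 2 * expWt 𝒟.T (m + 3) 𝒟.K lam t x := by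
    intro v v' V V' hv hv' h1 h4 h5 h6 hd
    refine H lam (s / 2) (frozen f v) (frozen f v') ψ V V' (by positivity)
      (hf.frozen hk 𝒟.hK.le hv') h1 h4 h5 h6 fun t ht x z => ?_
    have e1 := hf.abs_sub_le (m := m + 3) (c := lam) hk 𝒟.hK.le ht hs (continuous_slice hv'.2 ht)
      (continuous_slice hv.2 ht) (hd t ht) x z z
    rw [sub_self, norm_zero, add_zero] at e1
    have e2 := (abs_le.1 e1).2
    have e3 : 0 ≤ s * expWt 𝒟.T (m + 3) 𝒟.K lam t x := mul_nonneg hs (expWt_pos _ _ _ _ _ _).le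
    have e4 := mul_le_mul_of_nonneg_right (show k ≤ (lam - C₁) / 2 by linarith) e3
    rw [frozen, frozen]
    linarith
  intro t ht x
  have a1 := key v v' V V' hv hv' h1 h4 h5 h6 hd t ht x
  have a2 := key v' v V' V hv' hv h3 h2 h6 h5
    (fun t ht x => by rw [abs_sub_comm]; exact hd t ht x) t ht x
  exact abs_le.2 ⟨by linarith, by linarith⟩

/-- Multiples of the exponential weight dominate the frozen problem. -/
lemma exists_dominates (hf : IsNLDriver 𝒟.T 𝒟.K k C ρ f) (hk : 0 ≤ k) (hC : 0 ≤ C) (hρ : 0 ≤ ρ)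
    {m : ℕ} (hm : ρ ≤ 2 * m) (hψc : Continuous ψ) {C' : ℝ} (hC' : 0 ≤ C')
    (hψg : ∀ x, |ψ x| ≤ C' * (1 + ‖x‖ ^ ρ))
    (hψΓ : ∀ x b, ψ (𝒟.Γ 𝒟.T x b) - 𝒟.ℓ 𝒟.T x b < ψ x) :
    ∃ lam₀ ≥ 0, ∀ lam ≥ lam₀, ∀ (v : ℝ → En n → ℝ) (s : ℝ), 0 ≤ s → PGc 𝒟.T v →
      (∀ t ∈ Icc 0 𝒟.T, ∀ x, |v t x| ≤ s * expWt 𝒟.T (m + 3) 𝒟.K lam t x) →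
      ∃ B ≥ 0, Dominates 𝒟 k m (frozen f v) ψ
        (fun t x => B * expWt 𝒟.T (m + 3) 𝒟.K lam t x) := by
  obtain ⟨C₀, hC₀, H₀⟩ := exists_expWt_bound 𝒟.a 𝒟.σ 𝒟.hCa 𝒟.haσg m 𝒟.K
  obtain ⟨D, hD, hDw⟩ := exists_growth_le_wt (n := n) hρ (m := m + 3)
    (by push_cast; linarith) 𝒟.K
  refine ⟨C₀ * (1 + k) + 1, by positivity, fun lam hlam v s hs hv hvs => ?_⟩
  have hlam0 : 0 ≤ lam := le_trans (by positivity) hlam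
  set Θ := expWt 𝒟.T (m + 3) 𝒟.K lam (n := n) with hΘd
  have hΘt : IsTest Θ := isTest_expWt _ _ _ _
  have hΘ0 : ∀ t x, 0 < Θ t x := fun t x => expWt_pos _ _ _ _ _ _
  have hwΘ : ∀ t ∈ Icc 0 𝒟.T, ∀ x, 1 + ‖x‖ ^ ρ ≤ D * Θ t x := fun t ht x =>
    (hDw x).trans (mul_le_mul_of_nonneg_left (wt_le_expWt _ _ hlam0 ht.2 x) hD.le)
  set B := C * D + k * s + C' * D with hB
  have hB0 : 0 ≤ B := by positivity
  have hfb : ∀ t ∈ Icc 0 𝒟.T, ∀ x z, ‖z‖ ≤ B * (C₀ * Θ t x) →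
      |frozen f v t x z| ≤ (C * D + k * s + k * B * C₀) * Θ t x := by
    intro t ht x z hz
    have e1 := hf.abs_sub_le (m := m + 3) (c := lam) hk 𝒟.hK.le ht hs continuous_zero
      (continuous_slice hv.2 ht) (by simpa using hvs t ht) x 0 z
    have e2 := (hf.growth t ht x).trans (mul_le_mul_of_nonneg_left (hwΘ t ht x) hC)
    rw [sub_zero] at e1
    have e3 := mul_le_mul_of_nonneg_left hz hk
    have e4 := abs_sub_abs_le_abs_sub (f t x (v t) z) (f t x 0 0)
    change |f t x (v t) z| ≤ _
    change _ ≤ k * (s * Θ t x + _) at e1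
    linarith
  have hbig : ∀ t x, (C * D + k * s + k * B * C₀) * Θ t x ≤ B * (lam - C₀) * Θ t x := by
    intro t x
    refine mul_le_mul_of_nonneg_right ?_ (hΘ0 t x).le
    have h1 : B * (C₀ * (1 + k) + 1) ≤ B * lam := mul_le_mul_of_nonneg_left hlam hB0
    have h2 : 0 ≤ C' * D := by positivity
    linarith
  have hP : ∀ t ∈ Icc 0 𝒟.T, ∀ x, B * parOp 𝒟.a 𝒟.σ Θ t x ≤ -(B * (lam - C₀) * Θ t x) := by
    intro t ht x
    have h1 := mul_le_mul_of_nonneg_left (abs_le.1 (H₀ lam t ht x).1).2 hB0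
    change B * (_ + lam * Θ t x) ≤ B * (C₀ * Θ t x) at h1
    linarith
  have hG : ∀ t ∈ Icc 0 𝒟.T, ∀ x, ‖B • sigGrad 𝒟.σ Θ t x‖ ≤ B * (C₀ * Θ t x) := by
    intro t ht x
    rw [norm_smul, Real.norm_eq_abs, abs_of_nonneg hB0]
    exact mul_le_mul_of_nonneg_left (H₀ lam t ht x).2 hB0
  refine ⟨B, hB0, hk, hf.frozen hk 𝒟.hK.le hv, hΘt.const_mul B, ?_, fun t ht x => ?_,
    fun t ht x => ?_, fun t ht x y h => ?_, hψc, fun t ht x => ?_, hψΓ⟩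
  · refine hasGrowth_of_le_expWt hB0 hlam0 fun t ht x => ?_
    rw [abs_of_nonneg (mul_nonneg hB0 (hΘ0 t x).le)]
  · rw [P, G, hΘt.parOp_const_mul, hΘt.sigGrad_const_mul]
    have h1 := (abs_le.1 (hfb t ht x _ (hG t ht x))).2
    linarith [hP t ht x, hbig t x]
  · rw [P, G, hΘt.parOp_const_mul, hΘt.sigGrad_const_mul]
    have h1 := (abs_le.1 (hfb t ht x _ ((norm_neg _).trans_le (hG t ht x)))).1
    linarith [hP t ht x, hbig t x]
  · exact mul_le_mul_of_nonneg_left (expWt_mono _ _ 𝒟.hK.le _ _ h) hB0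
  · refine (hψg x).trans ((mul_le_mul_of_nonneg_left (hwΘ t ht x) hC').trans ?_)
    rw [← mul_assoc]
    refine mul_le_mul_of_nonneg_right ?_ (hΘ0 t x).le
    have h1 : 0 ≤ C * D := by positivity
    have h2 : 0 ≤ k * s := by positivity
    linarith

open BoundedContinuousFunction in
/-- Existence of a fixed point of the solution map. -/
lemma exists_fixed_point (hf : IsNLDriver 𝒟.T 𝒟.K k C ρ f) (hk : 0 ≤ k) (hC : 0 ≤ C) (hρ : 0 ≤ ρ)
    (hψc : Continuous ψ) {C' : ℝ} (hC' : 0 ≤ C') (hψg : ∀ x, |ψ x| ≤ C' * (1 + ‖x‖ ^ ρ))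
    (hψΓ : ∀ x b, ψ (𝒟.Γ 𝒟.T x b) - 𝒟.ℓ 𝒟.T x b < ψ x) :
    ∃ v, PGc 𝒟.T v ∧ 𝒟.Sub (frozen f v) ψ v ∧ 𝒟.Super (frozen f v) ψ v := by
  obtain ⟨m, hm⟩ := exists_nat_ge ρ
  obtain ⟨lam₁, -, H₁⟩ := exists_contraction hf hk m
  obtain ⟨lam₂, hlam₂, H₂⟩ := exists_dominates hf hk hC hρ
    (show ρ ≤ 2 * m by have := Nat.cast_nonneg (α := ℝ) m; linarith) hψc hC' hψg hψΓ
  set lam := max lam₁ lam₂ with hlam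
  have hlam0 : 0 ≤ lam := hlam₂.trans (le_max_right _ _)
  set Θ := expWt 𝒟.T (m + 3) 𝒟.K lam (n := n) with hΘd
  have hΘ0 : ∀ t x, 0 < Θ t x := fun t x => expWt_pos _ _ _ _ _ _
  have hΘc : Continuous (fun p : ℝ × En n => Θ p.1 p.2) :=
    (isTest_expWt 𝒟.T m 𝒟.K lam).continuous
  set lift : (Strip n 𝒟.T →ᵇ ℝ) → ℝ → En n → ℝ := fun w t x =>
    if h : t ∈ Icc 0 𝒟.T then w ⟨(t, x), mem_strip h x⟩ * Θ t x else 0 with hlift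
  have hlift' : ∀ w t (h : t ∈ Icc 0 𝒟.T) x, lift w t x = w ⟨(t, x), mem_strip h x⟩ * Θ t x :=
    fun w t h x => by simp only [hlift, dif_pos h]
  have hb : ∀ w, ∀ t ∈ Icc 0 𝒟.T, ∀ x, |lift w t x| ≤ ‖w‖ * Θ t x := fun w t ht x => by
    rw [hlift' w t ht, abs_mul, abs_of_pos (hΘ0 t x)]
    exact mul_le_mul_of_nonneg_right (w.norm_coe_le_norm _) (hΘ0 t x).le
  have hg : ∀ w, HasGrowth 𝒟.T (m + 3) 𝒟.K (lift w) := fun w =>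
    hasGrowth_of_le_expWt (norm_nonneg w) hlam0 (hb w)
  have hpg : ∀ w, PGc 𝒟.T (lift w) := fun w => by
    refine ⟨(hg w).polyGrowth (by omega), continuousOn_iff_continuous_domRestrict.2 ?_⟩
    have e : (Strip n 𝒟.T).domRestrict (fun p : ℝ × En n => lift w p.1 p.2) =
        fun p => w p * Θ p.1.1 p.1.2 := by
      funext p
      exact hlift' w p.1.1 p.2.1 p.1.2
    rw [e]
    exact w.continuous.mul (hΘc.comp continuous_subtype_val)
  have hex : ∀ w, ∃ w', 𝒟.Sub (frozen f (lift w)) ψ (lift w') ∧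
      𝒟.Super (frozen f (lift w)) ψ (lift w') := fun w => by
    obtain ⟨B, hB0, hB⟩ := H₂ lam (le_max_right _ _) (lift w) ‖w‖ (norm_nonneg w) (hpg w) (hb w)
    obtain ⟨V, hV1, hV2, hV3, hV4⟩ := exists_local_solution hB
    have hc : Continuous (fun p : Strip n 𝒟.T => V p.1.1 p.1.2 / Θ p.1.1 p.1.2) :=
      (continuousOn_iff_continuous_domRestrict.1 (continuousOn_of_sub_super hV1 hV2)).div
        (hΘc.comp continuous_subtype_val) fun p => (hΘ0 _ _).ne'
    have hV : lift (BoundedContinuousFunction.ofNormedAddCommGroup _ hc B fun p => by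
        rw [norm_div, Real.norm_eq_abs, Real.norm_eq_abs, abs_of_pos (hΘ0 _ _),
          div_le_iff₀ (hΘ0 _ _)]
        exact hV3 p.1.1 p.2.1 p.1.2) = V := by
      funext t x
      by_cases ht : t ∈ Icc 0 𝒟.T
      · rw [hlift' _ t ht]
        exact div_mul_cancel₀ _ (hΘ0 t x).ne'
      · simp only [hlift, dif_neg ht, hV4 t ht x]
    exact ⟨_, by rwa [hV], by rwa [hV]⟩
  choose F hF1 hF2 using hex
  have hF : ContractingWith (1 / 2) F := by
    refine ⟨by norm_num, LipschitzWith.of_dist_le_mul fun w w' => ?_⟩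
    refine (BoundedContinuousFunction.dist_le (by positivity)).2 fun p => ?_
    have h1 := H₁ lam (le_max_left _ _) ψ (lift w) (lift w') (lift (F w)) (lift (F w')) (dist w w')
      dist_nonneg (hpg w) (hpg w') (hF1 w) (hF2 w) (hF1 w') (hF2 w') (hg _) (hg _)
      (fun t ht x => by
        rw [hlift' w t ht, hlift' w' t ht, ← sub_mul, abs_mul, abs_of_pos (hΘ0 t x)]
        exact mul_le_mul_of_nonneg_right ((Real.dist_eq _ _).symm.trans_le (w.dist_coe_le_dist _))
          (hΘ0 t x).le) p.1.1 p.2.1 p.1.2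
    rw [hlift' _ _ p.2.1, hlift' _ _ p.2.1, ← sub_mul, abs_mul, abs_of_pos (hΘ0 _ _)] at h1
    have h2 := le_of_mul_le_mul_right h1 (hΘ0 _ _)
    rw [Real.dist_eq]
    refine h2.trans_eq ?_
    push_cast
    ring
  have hfix : F (hF.fixedPoint F) = hF.fixedPoint F := hF.fixedPoint_isFixedPt
  refine ⟨lift (hF.fixedPoint F), hpg _, ?_, ?_⟩
  · have := hF1 (hF.fixedPoint F)
    rwa [hfix] at this
  · have := hF2 (hF.fixedPoint F)
    rwa [hfix] at this

/-- Uniqueness of the fixed point of the solution map. -/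
lemma eq_of_fixed_point (hf : IsNLDriver 𝒟.T 𝒟.K k C ρ f) (hk : 0 ≤ k)
    (hv : PGc 𝒟.T v) (hv1 : 𝒟.Sub (frozen f v) ψ v) (hv2 : 𝒟.Super (frozen f v) ψ v)
    (hw : PGc 𝒟.T w) (hw1 : 𝒟.Sub (frozen f w) ψ w) (hw2 : 𝒟.Super (frozen f w) ψ w) {t : ℝ}
    (ht : t ∈ Icc 0 𝒟.T) (x : En n) : v t x = w t x := by
  obtain ⟨m₁, hm₁⟩ := hv.1.exists_hasGrowth 𝒟.K
  obtain ⟨m₂, hm₂⟩ := hw.1.exists_hasGrowth 𝒟.K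
  set m := max m₁ m₂ with hm
  have hvg := hm₁ (m + 3) (by omega)
  have hwg := hm₂ (m + 3) (by omega)
  obtain ⟨lam, hlam, H⟩ := exists_contraction hf hk m
  obtain ⟨s₁, hs₁, h1⟩ := hvg.exists_le_expWt hlam
  obtain ⟨s₂, hs₂, h2⟩ := hwg.exists_le_expWt hlam
  have hind : ∀ j : ℕ, ∀ t ∈ Icc 0 𝒟.T, ∀ x, |v t x - w t x| ≤
      (s₁ + s₂) * (1 / 2) ^ j * expWt 𝒟.T (m + 3) 𝒟.K lam t x := by
    intro j
    induction j with
    | zero =>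
      intro t ht x
      have := abs_sub (v t x) (w t x)
      rw [pow_zero, mul_one, add_mul]
      linarith [h1 t ht x, h2 t ht x]
    | succ j ih =>
      have := H lam le_rfl ψ v w v w _ (by positivity) hv hw hv1 hv2 hw1 hw2 hvg hwg ih
      intro t ht x
      refine (this t ht x).trans_eq ?_
      rw [pow_succ]
      ring
  have hlim : Tendsto (fun j : ℕ => (s₁ + s₂) * (1 / 2) ^ j * expWt 𝒟.T (m + 3) 𝒟.K lam t x) atTop
      (𝓝 0) := by
    have := ((tendsto_pow_atTop_nhds_zero_of_lt_one (r := (1 / 2 : ℝ)) (by norm_num)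
      (by norm_num)).const_mul (s₁ + s₂)).mul_const (expWt 𝒟.T (m + 3) 𝒟.K lam t x)
    simpa using this
  have h0 : |v t x - w t x| ≤ 0 := ge_of_tendsto' hlim fun j => hind j t ht x
  exact sub_eq_zero.1 (abs_nonpos_iff.1 h0)

end QVIData

end FixedPoint

/-- Existence and uniqueness in `Π^g_c` of a viscosity solution to the
non-local quasi-variational inequality
`min{ v - Mv, -v_t - Lv - f(t,x,v(t,·),σᵀ∇v) } = 0` on `[0,T) × ℝ^n`, `v(T,·) = ψ`. -/
theorem nonlocal_qvi_viscosity_existence_uniqueness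
    (n d : ℕ) (hn : 0 < n) (hd : 0 < d) (T : ℝ) (hT : 0 < T)
    (U : Type) [MetricSpace U] [CompactSpace U] [Nonempty U]
    (Γ : ℝ → En n → U → En n) (ℓ : ℝ → En n → U → ℝ)
    (a : ℝ → En n → En n) (σm : ℝ → En n → Matrix (Fin n) (Fin d) ℝ)
    (f : ℝ → En n → (En n → ℝ) → Ed d → ℝ) (ψ : En n → ℝ)
    (KΓ δ Cf kf Cψ Cℓ qℓ Caσ kaσ ρ : ℝ)
    (hKΓ : 0 < KΓ) (hδ : 0 < δ) (hρ : 0 < ρ)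
    (hCf : 0 < Cf) (hkf : 0 < kf) (hCψ : 0 < Cψ) (hCℓ : 0 < Cℓ) (hqℓ : 0 < qℓ)
    (hCaσ : 0 < Caσ) (hkaσ : 0 < kaσ)
    -- assumptions on Γ
    (hΓc : ContinuousOn (fun p : ℝ × En n × U => Γ p.1 p.2.1 p.2.2)
      (Icc 0 T ×ˢ (univ : Set (En n × U))))
    (hΓb : ∀ t ∈ Icc (0:ℝ) T, ∀ (x : En n) (b : U), ‖Γ t x b‖ ≤ max KΓ ‖x‖)
    -- assumptions on ℓ
    (hℓc : ContinuousOn (fun p : ℝ × En n × U => ℓ p.1 p.2.1 p.2.2)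
      (Icc 0 T ×ˢ (univ : Set (En n × U))))
    (hℓlb : ∀ t ∈ Icc (0:ℝ) T, ∀ (x : En n) (b : U), δ ≤ ℓ t x b)
    (hℓg : ∀ t ∈ Icc (0:ℝ) T, ∀ (x : En n) (b : U), |ℓ t x b| ≤ Cℓ * (1 + ‖x‖ ^ qℓ))
    -- assumptions on ψ
    (hψc : Continuous ψ)
    (hψg : ∀ x : En n, |ψ x| ≤ Cψ * (1 + ‖x‖ ^ ρ))
    (hψΓ : ∀ (x : En n) (b : U), ψ (Γ T x b) - ℓ T x b < ψ x)
    -- assumptions on a and σ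
    (hac : ContinuousOn (fun p : ℝ × En n => a p.1 p.2) (Strip n T))
    (hσc : ContinuousOn (fun p : ℝ × En n => σm p.1 p.2) (Strip n T))
    (haσg : ∀ t ∈ Icc (0:ℝ) T, ∀ x : En n, ‖a t x‖ + frob (σm t x) ≤ Caσ * (1 + ‖x‖))
    (haσLip : ∀ t ∈ Icc (0:ℝ) T, ∀ x x' : En n,
      ‖a t x - a t x'‖ + frob (σm t x - σm t x') ≤ kaσ * ‖x - x'‖)
    -- assumptions on the non-local driver f:
    -- (t,x) ↦ f(t,x,v(t,·),z) is jointly continuous uniformly in z, for every v ∈ Π^g_c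
    (hfc : ∀ v : ℝ → En n → ℝ, PGc T v → ∀ ε > (0:ℝ), ∀ p ∈ Strip n T, ∃ δ' > (0:ℝ),
      ∀ q ∈ Strip n T, dist q p ≤ δ' → ∀ z : Ed d,
        |f q.1 q.2 (v q.1) z - f p.1 p.2 (v p.1) z| ≤ ε)
    -- polynomial growth of f(t,x,0,0)
    (hfg : ∀ t ∈ Icc (0:ℝ) T, ∀ x : En n, |f t x 0 0| ≤ Cf * (1 + ‖x‖ ^ ρ))
    -- non-local Lipschitz condition
    (hfLip : ∀ t ∈ Icc (0:ℝ) T, ∀ x : En n, ∀ g g' : En n → ℝ,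
      Continuous g → Continuous g' → ∀ z z' : Ed d,
        |f t x g' z' - f t x g z| ≤
          kf * (sSup ((fun x' : En n => |g' x' - g x'|) '' Metric.closedBall 0 (max ‖x‖ KΓ))
            + ‖z' - z‖)) :
    ∃ v : ℝ → En n → ℝ, PGc T v ∧
      IsSuperNL T Γ ℓ a σm f ψ v ∧ IsSubNL T Γ ℓ a σm f ψ v ∧
      ∀ w : ℝ → En n → ℝ, PGc T w →
        IsSuperNL T Γ ℓ a σm f ψ w → IsSubNL T Γ ℓ a σm f ψ w →
        ∀ t ∈ Icc (0:ℝ) T, ∀ x : En n, w t x = v t x := by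
  set 𝒟 : QVIData n d U :=
    ⟨T, Γ, ℓ, a, σm, KΓ, δ, Caσ, kaσ, hT, hKΓ, hδ, hCaσ, hkaσ, hΓc, hΓb, hℓc, hℓlb, hac, hσc, haσg,
      haσLip⟩ with h𝒟
  have hf : IsNLDriver 𝒟.T 𝒟.K kf Cf ρ f := ⟨hfc, hfg, hfLip⟩
  obtain ⟨v, hv, hv1, hv2⟩ := QVIData.exists_fixed_point (𝒟 := 𝒟) hf hkf.le hCf.le hρ.le hψc hCψ.le
    hψg hψΓ
  exact ⟨v, hv, hv2, hv1, fun w hw hw2 hw1 t ht x =>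
    QVIData.eq_of_fixed_point hf hkf.le hw hw1 hw2 hv hv1 hv2 ht x⟩
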